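/- If λ is a strict partition, then Q_{z_λ} = Q_λ, and P_EGᴼ(a) = T_λ for every primed involution word a ∈ R_inv^+(z_λ). -/

import Mathlib

/-! ## Primed letters: the alphabet `ℤ ⊔ ℤ'`, with `i' = i - 1/2`.
A letter is encoded by its "ceiling" together with a flag recording whether it is primed. -/

structure Letter where
  ceil : ℤ
  primed : Bool
deriving DecidableEq, Repr

instance : Inhabited Letter := ⟨⟨0, false⟩⟩

/-- The order `⋯ < 1' < 1 < 2' < 2 < ⋯`. -/
instance : LinearOrder Letter :=
  LinearOrder.lift' (fun x : Letter => toLex (x.ceil, !x.primed))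
    (fun a b h => by
      have h' : (a.ceil, !a.primed) = (b.ceil, !b.primed) := toLex.injective h
      obtain ⟨ac, ap⟩ := a
      obtain ⟨bc, bp⟩ := b
      simp only [Prod.mk.injEq] at h'
      obtain ⟨h1, h2⟩ := h'
      cases ap <;> cases bp <;> simp_all)

/-- A primed word. -/
abbrev PWord := List Letter

def Letter.unprime (x : Letter) : Letter := ⟨x.ceil, false⟩

def Letter.succL (x : Letter) : Letter := ⟨x.ceil + 1, x.primed⟩

/-- `unprime` of a primed word: replace each letter `x` by `⌈x⌉`. -/
def unprimeWord (a : PWord) : List ℤ := a.map Letter.ceil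

/-- `unprime` of a primed word, as a primed word with no primes. -/
def unprimeP (a : PWord) : PWord := a.map Letter.unprime

/-! ## Involution words -/

/-- The simple transposition `s_i = (i, i+1)` of `ℤ`. -/
def sPerm (i : ℤ) : Equiv.Perm ℤ := Equiv.swap i (i + 1)

/-- The Demazure product `s_{w_1} ∘ s_{w_2} ∘ ⋯ ∘ s_{w_k}` of a word, computed by the
defining recursion `σ ∘ s_i = σ·s_i` if `σ(i) < σ(i+1)` and `σ ∘ s_i = σ` otherwise. -/
def heckeProd (w : List ℤ) : Equiv.Perm ℤ :=
  w.foldl (fun σ i => if σ i < σ (i + 1) then σ * sPerm i else σ) 1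

/-- `s_{a_n} ∘ ⋯ ∘ s_{a_2} ∘ s_{a_1} ∘ s_{a_2} ∘ ⋯ ∘ s_{a_n}` for `a = a_1 a_2 ⋯ a_n`. -/
def invHecke (a : List ℤ) : Equiv.Perm ℤ := heckeProd (a.reverse ++ a.tail)

/-- Membership in `I_ℤ`: a finitely supported involution of `ℤ`. -/
def IZ (z : Equiv.Perm ℤ) : Prop := {x : ℤ | z x ≠ x}.Finite ∧ z * z = 1

/-- The set of involution words of `z`. -/
def Rinv (z : Equiv.Perm ℤ) : Set (List ℤ) :=
  {a | invHecke a = z ∧ ∀ b : List ℤ, invHecke b = z → a.length ≤ b.length}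

/-- 0-based index `k` is a commutation in the word `a` (this corresponds to the 1-based
index `k+1`): `a_{k+1}` and `a_{k+1} + 1` are both fixed points of
`s_{a_k} ∘ ⋯ ∘ s_{a_1} ∘ ⋯ ∘ s_{a_k}`. -/
def IsCommutation (a : List ℤ) (k : ℕ) : Prop :=
  ∃ x, a[k]? = some x ∧ invHecke (a.take k) x = x ∧ invHecke (a.take k) (x + 1) = x + 1

/-- The set of primed involution words of `z`. -/
def RinvPlus (z : Equiv.Perm ℤ) : Set PWord :=
  {a | unprimeWord a ∈ Rinv z ∧
     ∀ (k : ℕ) (x : Letter), a[k]? = some x → x.primed = true →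
       IsCommutation (unprimeWord a) k}

/-! ## Shifted tableaux.
A shifted tableau is recorded as its list of rows, from the first (bottom) row upward;
the entry at 0-based index `k` of 0-based row `r` occupies the box in row `r+1` and
column `r+1+k` of the shifted diagram. -/

abbrev STab := List (List Letter)

/-- A strict partition, recorded as its (strictly decreasing) list of positive parts. -/
def IsStrictPartition (sh : List ℕ) : Prop :=
  List.Chain' (fun a b => b < a) sh ∧ ∀ m ∈ sh, 0 < m

def shapeOf {α : Type*} (T : List (List α)) : List ℕ := T.map List.length

/-- The rows form the shifted diagram of a strict partition. -/
def IsShifted {α : Type*} (T : List (List α)) : Prop := IsStrictPartition (shapeOf T)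

/-- The entry of `T` in (0-based) row `r` and column `c` of the shifted diagram. -/
def entryG? {α : Type*} (T : List (List α)) (r c : ℕ) : Option α :=
  if r ≤ c then (T[r]?).bind (fun row => row[c - r]?) else none

def entry? (T : STab) (r c : ℕ) : Option Letter := entryG? T r c

def setRowG {α : Type*} (T : List (List α)) (r : ℕ) (row : List α) : List (List α) :=
  if r < T.length then T.set r row else T ++ [row]

def setEntryG {α : Type*} (T : List (List α)) (r c : ℕ) (x : α) : List (List α) :=
  T.set r ((T.getD r []).set (c - r) x)

def numCols {α : Type*} (T : List (List α)) : ℕ := (T.getD 0 []).length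

/-- Row reading word: rows left to right, starting with the last (top) row. -/
def rowWord (T : STab) : PWord := T.reverse.flatten

/-- Column reading word: columns top to bottom, starting with the first column. -/
def colWord (T : STab) : PWord :=
  (List.range (numCols T)).flatMap (fun c =>
    ((List.range (c + 1)).reverse).filterMap (fun r => entry? T r c))

def unprimeT (T : STab) : STab := T.map (List.map Letter.unprime)

/-- Remove the primes from all main-diagonal entries. -/
def unprimeDiagT (T : STab) : STab :=
  T.map (fun row =>
    match row with
    | [] => []
    | x :: rest => Letter.unprime x :: rest)

/-- Rows and columns are strictly increasing. -/
def IsIncreasing (T : STab) : Prop :=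
  (∀ r c x y, entry? T r c = some x → entry? T r (c + 1) = some y → x < y) ∧
  (∀ r c x y, entry? T r c = some x → entry? T (r + 1) c = some y → x < y)

/-- No primed entries on the main diagonal. -/
def NoDiagPrimes (T : STab) : Prop :=
  ∀ r x, entry? T r r = some x → x.primed = false

/-- Entries positive, rows and columns weakly increasing, no primed entry repeated
in a row and no unprimed entry repeated in a column. -/
def IsSemistandard (T : STab) : Prop :=
  (∀ x ∈ T.flatten, 0 < x.ceil) ∧
  (∀ r c x y, entry? T r c = some x → entry? T r (c + 1) = some y → x ≤ y) ∧
  (∀ r c x y, entry? T r c = some x → entry? T (r + 1) c = some y → x ≤ y) ∧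
  (∀ r c c' x, c < c' → entry? T r c = some x → entry? T r c' = some x →
    x.primed = false) ∧
  (∀ r r' c x, r < r' → entry? T r c = some x → entry? T r' c = some x →
    x.primed = true)

/-- Increasing, with exactly one of `i` or `i'` as an entry for each `i = 1, …, n`,
where `n` is the number of boxes. -/
def IsStandard (T : STab) : Prop :=
  IsIncreasing T ∧
  ∀ i : ℤ, 1 ≤ i → i ≤ (T.flatten.length : ℤ) →
    T.flatten.countP (fun x => decide (x.ceil = i)) = 1
/-! ## Orthogonal Edelman–Greene insertion -/

/-- "Switching the primes" of a pair: reverse the primes on both letters if exactly one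
of them is unprimed, and leave them unchanged otherwise. -/
def switchPrimes (x y : Letter) : Letter × Letter :=
  if x.primed = y.primed then (x, y)
  else (⟨x.ceil, !x.primed⟩, ⟨y.ceil, !y.primed⟩)

/-- Column-insertion stage of orthogonal Edelman–Greene insertion:
insert letter `w` into column `c` of `T` (then continue into later columns). -/
def egCol : ℕ → STab → ℕ → Letter → STab × Bool
  | 0, T, _, _ => (T, true)
  | fuel + 1, T, c, w =>
    let occ := (List.range (c + 1)).filterMap (fun r => (entry? T r c).map (fun x => (r, x)))
    match occ.findIdx? (fun p => decide (w.ceil < p.2.ceil)) with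
    | none =>
        -- place `w` in the first empty box of the column
        let r := occ.length
        let w' := if r = c ∧ w.primed then Letter.unprime w else w
        (setRowG T r ((T.getD r []) ++ [w']), if r = c then w.primed else true)
    | some kM =>
        let km := (occ.findIdx? (fun p => decide (w.ceil ≤ p.2.ceil))).getD kM
        let im := (occ.getD km (0, default)).1
        let m := (occ.getD km (0, default)).2
        if km = kM then
          if im = c then
            -- m = M on the main diagonal
            egCol fuel (setEntryG T im c (Letter.unprime w)) (c + 1) ⟨m.ceil, w.primed⟩
          else
            -- m = M off the main diagonal
            egCol fuel (setEntryG T im c w) (c + 1) m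
        else
          -- m < M : switch the primes on m and M, insert w+1 into the next column
          let iM := (occ.getD kM (0, default)).1
          let M := (occ.getD kM (0, default)).2
          let p := switchPrimes m M
          egCol fuel (setEntryG (setEntryG T im c p.1) iM c p.2) (c + 1) (Letter.succL w)

/-- Row-insertion stage of orthogonal Edelman–Greene insertion:
insert letter `w` into row `r` of `T`. -/
def egRow : ℕ → STab → ℕ → Letter → STab × Bool
  | 0, T, _, _ => (T, true)
  | fuel + 1, T, r, w =>
    let row := T.getD r []
    match row.findIdx? (fun x => decide (w.ceil < x.ceil)) with
    | none =>
        if row.isEmpty ∧ w.primed then (setRowG T r [Letter.unprime w], true)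
        else (setRowG T r (row ++ [w]), false)
    | some kM =>
        let km := (row.findIdx? (fun x => decide (w.ceil ≤ x.ceil))).getD kM
        let m := row.getD km default
        if km = kM then
          if km = 0 then
            -- m = M on the main diagonal
            egCol fuel (setRowG T r (row.set 0 (Letter.unprime w))) (r + 1)
              ⟨m.ceil, w.primed⟩
          else
            -- m = M off the main diagonal
            egRow fuel (setRowG T r (row.set km w)) (r + 1) m
        else
          -- m < M : switch primes; insert w+1 into the next column (if m is on the
          -- main diagonal) or the next row (otherwise)
          let M := row.getD kM default
          let p := switchPrimes m M
          let row' := (row.set km p.1).set kM p.2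
          if km = 0 then egCol fuel (setRowG T r row') (r + 1) (Letter.succL w)
          else egRow fuel (setRowG T r row') (r + 1) (Letter.succL w)

/-- `T ←ᴼ u` together with the flag recording whether the insertion ended in
column insertion. -/
def egInsert (T : STab) (u : Letter) : STab × Bool :=
  egRow (T.flatten.length + T.length + 2) T 0 u

/-- The orthogonal Edelman–Greene insertion tableau `P_EGᴼ(a)`. -/
def PEG (a : PWord) : STab := a.foldl (fun T u => (egInsert T u).1) []

/-- Add the recording letter `x` to `Q` in the unique box of `Pnew` not in `Pold`. -/
def addBox (Q Pold Pnew : STab) (x : Letter) : STab :=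
  match (List.range Pnew.length).find?
      (fun r => decide ((Pold.getD r []).length ≠ (Pnew.getD r []).length)) with
  | some r => setRowG Q r ((Q.getD r []) ++ [x])
  | none => Q

def QEGaux : STab → STab → ℕ → PWord → STab
  | _, Q, _, [] => Q
  | P, Q, n, u :: rest =>
      let res := egInsert P u
      QEGaux res.1 (addBox Q P res.1 ⟨(n : ℤ), res.2⟩) (n + 1) rest

/-- The orthogonal Edelman–Greene recording tableau `Q_EGᴼ(a)`. -/
def QEG (a : PWord) : STab := QEGaux [] [] 1 a

/-! ## Orthogonal Coxeter–Knuth operators -/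

def ock1 (x : Letter) : Letter := ⟨x.ceil, !x.primed⟩

def ock2 (x y : Letter) : Letter × Letter := (⟨y.ceil, x.primed⟩, ⟨x.ceil, y.primed⟩)

def ock3 (x y z : Letter) : Letter × Letter × Letter :=
  if x.ceil = z.ceil ∧ (x.ceil - y.ceil = 1 ∨ y.ceil - x.ceil = 1) then
    if x.primed = false ∧ y.primed = false ∧ z.primed = false then
      -- XYX ↔ YXY
      (⟨y.ceil, false⟩, ⟨x.ceil, false⟩, ⟨y.ceil, false⟩)
    else if x.primed = true ∧ y.primed = false ∧ z.primed = false then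
      -- X'YX ↦ YXY'
      (⟨y.ceil, false⟩, ⟨x.ceil, false⟩, ⟨y.ceil, true⟩)
    else if x.primed = false ∧ y.primed = false ∧ z.primed = true then
      -- YXY' ↦ X'YX
      (⟨y.ceil, true⟩, ⟨x.ceil, false⟩, ⟨y.ceil, false⟩)
    else (x, y, z)
  else if (x.ceil < z.ceil ∧ z.ceil < y.ceil) ∨ (y.ceil < z.ceil ∧ z.ceil < x.ceil) then
    -- ACB ↔ CAB
    (y, x, z)
  else if (y.ceil < x.ceil ∧ x.ceil < z.ceil) ∨ (z.ceil < x.ceil ∧ x.ceil < y.ceil) then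
    -- BCA ↔ BAC
    (x, z, y)
  else (x, y, z)

/-- The operator `ock_i` for `i ∈ ℤ`. -/
def ockW (i : ℤ) (a : PWord) : PWord :=
  if i = -1 then
    match a with
    | [] => []
    | x :: rest => ock1 x :: rest
  else if i = 0 then
    match a with
    | x :: y :: rest => (ock2 x y).1 :: (ock2 x y).2 :: rest
    | _ => a
  else if 1 ≤ i ∧ i + 2 ≤ (a.length : ℤ) then
    let k := (i - 1).toNat
    match a[k]?, a[k + 1]?, a[k + 2]? with
    | some x, some y, some z =>
        a.take k ++ [(ock3 x y z).1, (ock3 x y z).2.1, (ock3 x y z).2.2] ++ a.drop (k + 3)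
    | _, _, _ => a
  else a

/-- Orthogonal Coxeter–Knuth equivalence: generated by `a ∼ ock_i(a)` for all `i ∈ ℤ`. -/
def OckEquiv : PWord → PWord → Prop :=
  Relation.EqvGen (fun a b => ∃ i : ℤ, b = ockW i a)
/-! ## Descents -/

/-- Descent set of a primed word (as a set of 1-based positions). -/
def DesWord (a : PWord) : Set ℤ :=
  {i | ∃ k : ℕ, i = (k : ℤ) + 1 ∧ ∃ x y, a[k]? = some x ∧ a[k + 1]? = some y ∧ y < x}

/-- Descent set of a standard shifted tableau. -/
def DesT (T : STab) : Set ℤ :=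
  {i | 0 < i ∧ (
    (∃ r c r' c', entry? T r c = some ⟨i, false⟩ ∧
        entry? T r' c' = some ⟨i + 1, false⟩ ∧ r < r') ∨
    (∃ r c r' c', entry? T r c = some ⟨i, true⟩ ∧
        entry? T r' c' = some ⟨i + 1, true⟩ ∧ c < c') ∨
    (∃ r c r' c', entry? T r c = some ⟨i, false⟩ ∧
        entry? T r' c' = some ⟨i + 1, true⟩))}

/-! ## Dual equivalence operators on standard shifted tableaux -/

def numPrimes (T : STab) : ℕ := T.flatten.countP (fun x => x.primed)

/-- The entries of column `c`, read from bottom to top (increasing). -/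
def colLetters (T : STab) (c : ℕ) : PWord :=
  (List.range (c + 1)).filterMap (fun r => entry? T r c)

/-- The shifted reading word `unprime(C_q R_q ⋯ C_1 R_1)`. -/
def shword (T : STab) : List ℤ :=
  (((List.range (numCols T)).reverse).flatMap (fun idx =>
    (colLetters T idx).filter (fun x => x.primed) ++
      ((T.getD idx []).filter (fun x => !x.primed)))).map Letter.ceil

def idxOfZ (v : ℤ) : List ℤ → ℕ
  | [] => 0
  | x :: r => if x = v then 0 else idxOfZ v r + 1

def positionsOf (T : STab) : List (ℕ × ℕ) :=
  (List.range T.length).flatMap (fun r =>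
    (List.range (T.getD r []).length).map (fun k => (r, r + k)))

/-- The box `□_v` of `T` containing `v` or `v'`. -/
def boxOf (T : STab) (v : ℤ) : Option (ℕ × ℕ) :=
  (positionsOf T).find? (fun p =>
    match entry? T p.1 p.2 with
    | some x => decide (x.ceil = v)
    | none => false)

/-- Reverse the prime of the entry in position `(r, c)`. -/
def togglePos (T : STab) (r c : ℕ) : STab :=
  match entry? T r c with
  | some x => setEntryG T r c ⟨x.ceil, !x.primed⟩
  | none => T

/-- Switch the primes of the entries in the two given positions. -/
def switchAt (T : STab) (p q : ℕ × ℕ) : STab :=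
  match entry? T p.1 p.2, entry? T q.1 q.2 with
  | some x, some y =>
      if x.primed = y.primed then T else togglePos (togglePos T p.1 p.2) q.1 q.2
  | _, _ => T

/-- The row index of `□_v` if it is a main-diagonal box. -/
def diagBox? (T : STab) (v : ℤ) : Option ℕ :=
  (boxOf T v).bind (fun p => if p.1 = p.2 then some p.1 else none)

def switchDiag (T T' : STab) (u v : ℤ) : STab :=
  match diagBox? T u, diagBox? T v with
  | some r, some s => switchAt T' (r, r) (s, s)
  | _, _ => T'

/-- The operator `𝔰_i`. -/
def sOp (i : ℤ) (T : STab) : STab :=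
  match boxOf T i, boxOf T (i + 1) with
  | some (r1, c1), some (r2, c2) =>
      if r1 ≠ r2 ∧ c1 ≠ c2 then
        -- swap i ↔ i+1 and i' ↔ (i+1)'
        setEntryG (setEntryG T r1 c1 ⟨i + 1, ((entry? T r1 c1).getD default).primed⟩)
          r2 c2 ⟨i, ((entry? T r2 c2).getD default).primed⟩
      else if r1 ≠ c1 ∧ r2 ≠ c2 then
        -- same row or column, neither box diagonal: reverse both primes
        togglePos (togglePos T r1 c1) r2 c2
      else
        -- same row or column, one box diagonal
        let T1 := if r1 = c1 then togglePos T r2 c2 else togglePos T r1 c1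
        let T2 :=
          if 1 ≤ i - 1 ∧ (diagBox? T (i - 1)).isSome ∧ (diagBox? T (i + 1)).isSome then
            switchDiag T T1 (i - 1) (i + 1)
          else T1
        if i + 2 ≤ (T.flatten.length : ℤ) ∧ (diagBox? T i).isSome ∧
            (diagBox? T (i + 2)).isSome then
          switchDiag T T2 i (i + 2)
        else T2
  | _, _ => T

def btwn (a m b : ℕ) : Prop := (a < m ∧ m < b) ∨ (b < m ∧ m < a)

instance (a m b : ℕ) : Decidable (btwn a m b) := by unfold btwn; infer_instance

/-- The dual equivalence operator `𝔡_i` for `i ∈ ℤ`. -/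
def dOp (i : ℤ) (T : STab) : STab :=
  if ¬(1 ≤ i + 2 ∧ i + 2 ≤ (T.flatten.length : ℤ)) then T
  else if i = -1 then togglePos T 0 0
  else if i = 0 then togglePos T 0 1
  else
    let w := shword T
    if btwn (idxOfZ i w) (idxOfZ (i + 2) w) (idxOfZ (i + 1) w) then sOp i T
    else if btwn (idxOfZ (i + 1) w) (idxOfZ i w) (idxOfZ (i + 2) w) then sOp (i + 1) T
    else T

/-! ## Marked cycles -/

/-- The 2-cycles of `z`, as ordered pairs `(i, j)` with `i < j = z(i)`. -/
def cycSet (z : Equiv.Perm ℤ) : Set (ℤ × ℤ) := {p | p.1 < p.2 ∧ z p.1 = p.2}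

/-- `s_{a_n} ⋯ s_{a_{k+2}} s_{a_{k+1}}` (ordinary product; 0-based index `k`). -/
def suffixPerm (a : List ℤ) (k : ℕ) : Equiv.Perm ℤ :=
  ((a.drop (k + 1)).reverse.map sPerm).prod

/-- `γ_{k+1}(a)` as an ordered pair (junk value `(0,0)` off the commutation set). -/
def gammaPair (a : List ℤ) (k : ℕ) : ℤ × ℤ :=
  match a[k]? with
  | some x => (min (suffixPerm a k x) (suffixPerm a k (x + 1)),
               max (suffixPerm a k x) (suffixPerm a k (x + 1)))
  | none => (0, 0)
/-! ## Increasing factorization sequences and Schur Q-functions -/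

/-- `Incr_∞(R_inv^+(z))`: sequences of weakly increasing primed words, all but
finitely many empty, whose concatenation is a primed involution word for `z`. -/
def IncrSeq (z : Equiv.Perm ℤ) : Set (ℕ → PWord) :=
  {φ | (∀ n, List.Chain' (· ≤ ·) (φ n)) ∧
    ∃ N, (∀ n, N ≤ n → φ n = []) ∧ ((List.range N).map φ).flatten ∈ RinvPlus z}

/-- Least bound past which a sequence of words is empty. -/
noncomputable def seqBound (φ : ℕ → PWord) : ℕ := sInf {N | ∀ n, N ≤ n → φ n = []}

/-- The concatenation `a^1 a^2 ⋯` of a sequence of words. -/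
noncomputable def concatSeq (φ : ℕ → PWord) : PWord :=
  ((List.range (seqBound φ)).map φ).flatten

/-- `ℓ(a^1) + ⋯ + ℓ(a^i)`. -/
def prefLen (φ : ℕ → PWord) (i : ℕ) : ℕ := (((List.range i).map φ).map List.length).sum

/-- The minimal `i ≥ 1` with `j ≤ ℓ(a^1) + ⋯ + ℓ(a^i)`. -/
noncomputable def relabel (φ : ℕ → PWord) (j : ℤ) : ℤ :=
  ((sInf {i : ℕ | 1 ≤ i ∧ j ≤ (prefLen φ i : ℤ)} : ℕ) : ℤ)

/-- The semistandard recording tableau `Q_EGᴼ(φ)`. -/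
noncomputable def QEGseq (φ : ℕ → PWord) : STab :=
  (QEG (concatSeq φ)).map (List.map (fun x => (⟨relabel φ x.ceil, x.primed⟩ : Letter)))

/-- The insertion tableau `P_EGᴼ(φ)`. -/
noncomputable def PEGseq (φ : ℕ → PWord) : STab := PEG (concatSeq φ)

/-- The Schur Q-function of a strict partition: the coefficient of the monomial with
exponent vector `d` is the number of semistandard shifted tableaux `T` of the given
shape with `x^T = x^d`. -/
noncomputable def SchurQ (sh : List ℕ) : MvPowerSeries ℤ ℤ :=
  fun d => (({T : STab | shapeOf T = sh ∧ IsSemistandard T ∧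
    ∀ i : ℤ, d i = T.flatten.countP (fun x => decide (x.ceil = i))} : Set STab).ncard : ℤ)

/-- `Q_z = Σ_{φ ∈ Incr_∞(R_inv^+(z))} x^φ`. -/
noncomputable def Qz (z : Equiv.Perm ℤ) : MvPowerSeries ℤ ℤ :=
  fun d => (({φ : ℕ → PWord | φ ∈ IncrSeq z ∧
    (∀ i : ℕ, d ((i : ℤ) + 1) = (φ i).length) ∧
    (∀ j : ℤ, j ≤ 0 → d j = 0)} : Set (ℕ → PWord)).ncard : ℤ)

/-! ## Dominant involutions -/

/-- The shifted diagram `SD_λ ⊆ ℤ × ℤ` of a strict partition. -/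
def SDset (sh : List ℕ) : Set (ℤ × ℤ) :=
  {p | ∃ i j : ℕ, 1 ≤ i ∧ i ≤ sh.length ∧ 1 ≤ j ∧ j ≤ sh.getD (i - 1) 0 ∧
    p.1 = (i : ℤ) ∧ p.2 = (i : ℤ) + (j : ℤ) - 1}

/-- The involution Rothe diagram `D̂(z) = {(i,j) : z(i) > j ≤ i < z(j)}`. -/
def invRothe (z : Equiv.Perm ℤ) : Set (ℤ × ℤ) :=
  {p | p.2 < z p.1 ∧ p.2 ≤ p.1 ∧ p.1 < z p.2}

/-- The tableau `T_λ` with entry `i + j - 1` in box `(i, j)` of `SD_λ`. -/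
def Tlam (sh : List ℕ) : STab :=
  (List.range sh.length).map (fun r =>
    (List.range (sh.getD r 0)).map (fun k =>
      (⟨2 * (r : ℤ) + (k : ℤ) + 1, false⟩ : Letter)))

/-- The permutation `i + m ↦ w(i) + m` (fixing everything outside `m + support`). -/
def shiftPerm (m : ℕ) (w : Equiv.Perm ℤ) : Equiv.Perm ℤ :=
  (Equiv.addLeft (m : ℤ)).permCongr w

/-- `z ∈ S_m`: `z` fixes every point outside `[1, m]`. -/
def SupportedOn (z : Equiv.Perm ℤ) (m : ℕ) : Prop :=
  ∀ x : ℤ, x < 1 ∨ (m : ℤ) < x → z x = x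
/-! ## Primed compatible sequences -/

/-- A primed compatible sequence, recorded as the list of its columns `(index; value)`. -/
def IsPrimedCompatible (φ : List (ℕ × Letter)) : Prop :=
  (∀ p ∈ φ, 0 < p.1 ∧ 0 < p.2.ceil) ∧
  List.Chain' (fun p q : ℕ × Letter => p.1 ≤ q.1 ∧ (p.1 = q.1 → p.2 ≤ q.2)) φ ∧
  (∀ (k l : ℕ) (p : ℕ × Letter), k < l → φ[k]? = some p → φ[l]? = some p →
    p.2.primed = false)

def IsIndexStrict (φ : List (ℕ × Letter)) : Prop :=
  List.Chain' (fun p q : ℕ × Letter => p.1 < q.1) φ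

/-! ## Sagan–Worley insertion (orthogonal and symplectic versions) -/

/-- Whether `u` bumps `v`: strict comparison when inserting an unprimed letter into a
row or a primed letter into a column, weak comparison otherwise. -/
def swBump (isRow : Bool) (u v : Letter) : Bool :=
  if (isRow && !u.primed) || (!isRow && u.primed) then decide (u < v) else decide (u ≤ v)

/-- Column stage of orthogonal Sagan–Worley insertion. -/
def swColO : ℕ → STab → ℕ → Letter → STab × Bool
  | 0, T, _, _ => (T, true)
  | fuel + 1, T, c, u =>
    let occ := (List.range (c + 1)).filterMap (fun r => (entry? T r c).map (fun x => (r, x)))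
    match occ.find? (fun p => swBump false u p.2) with
    | none =>
        let r := occ.length
        let u' := if r = c ∧ u.primed then Letter.unprime u else u
        (setRowG T r ((T.getD r []) ++ [u']), true)
    | some p =>
        if p.1 = c then
          if u.ceil = p.2.ceil then swColO fuel T (c + 1) (Letter.unprime p.2)
          else
            let q := switchPrimes u p.2
            swColO fuel (setEntryG T p.1 c q.1) (c + 1) q.2
        else swColO fuel (setEntryG T p.1 c u) (c + 1) p.2

/-- Row stage of orthogonal Sagan–Worley insertion. -/
def swRowO : ℕ → STab → ℕ → Letter → STab × Bool
  | 0, T, _, _ => (T, true)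
  | fuel + 1, T, r, u =>
    let row := T.getD r []
    match row.findIdx? (fun v => swBump true u v) with
    | none =>
        if row.isEmpty ∧ u.primed then (setRowG T r [Letter.unprime u], true)
        else (setRowG T r (row ++ [u]), false)
    | some k =>
        let v := row.getD k default
        if k = 0 then
          if u.ceil = v.ceil then swColO fuel T (r + 1) (Letter.unprime v)
          else
            let q := switchPrimes u v
            swColO fuel (setRowG T r (row.set 0 q.1)) (r + 1) q.2
        else swRowO fuel (setRowG T r (row.set k u)) (r + 1) v

def swInsertO (T : STab) (u : Letter) : STab × Bool :=
  swRowO (T.flatten.length + T.length + 2) T 0 u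

/-- Column stage of symplectic (original) Sagan–Worley insertion. -/
def swColSp : ℕ → STab → ℕ → Letter → STab × Bool
  | 0, T, _, _ => (T, true)
  | fuel + 1, T, c, u =>
    let occ := (List.range (c + 1)).filterMap (fun r => (entry? T r c).map (fun x => (r, x)))
    match occ.find? (fun p => swBump false u p.2) with
    | none => (setRowG T occ.length ((T.getD occ.length []) ++ [u]), true)
    | some p =>
        if p.1 = c then
          if u.ceil = p.2.ceil then swColSp fuel T (c + 1) (Letter.unprime p.2)
          else swColSp fuel (setEntryG T p.1 c u) (c + 1) p.2
        else swColSp fuel (setEntryG T p.1 c u) (c + 1) p.2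

/-- Row stage of symplectic (original) Sagan–Worley insertion. -/
def swRowSp : ℕ → STab → ℕ → Letter → STab × Bool
  | 0, T, _, _ => (T, true)
  | fuel + 1, T, r, u =>
    let row := T.getD r []
    match row.findIdx? (fun v => swBump true u v) with
    | none => (setRowG T r (row ++ [u]), false)
    | some k =>
        let v := row.getD k default
        if k = 0 then
          if u.ceil = v.ceil then swColSp fuel T (r + 1) (Letter.unprime v)
          else swColSp fuel (setRowG T r (row.set 0 u)) (r + 1) v
        else swRowSp fuel (setRowG T r (row.set k u)) (r + 1) v

def swInsertSp (T : STab) (u : Letter) : STab × Bool :=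
  swRowSp (T.flatten.length + T.length + 2) T 0 u

def PSWO (φ : List (ℕ × Letter)) : STab := φ.foldl (fun T p => (swInsertO T p.2).1) []

def PSWSp (φ : List (ℕ × Letter)) : STab := φ.foldl (fun T p => (swInsertSp T p.2).1) []

def QSWaux (ins : STab → Letter → STab × Bool) : STab → STab → List (ℕ × Letter) → STab
  | _, Q, [] => Q
  | P, Q, p :: rest =>
      let res := ins P p.2
      QSWaux ins res.1 (addBox Q P res.1 ⟨(p.1 : ℤ), res.2⟩) rest

def QSWO (φ : List (ℕ × Letter)) : STab := QSWaux swInsertO [] [] φ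

def QSWSp (φ : List (ℕ × Letter)) : STab := QSWaux swInsertSp [] [] φ

/-- Entry `A_{ij}` of the circled matrix of `φ` (forgetting the circles). -/
def cmEntry (φ : List (ℕ × Letter)) (i j : ℕ) : ℕ :=
  φ.countP (fun p => decide (p.1 = i ∧ p.2.ceil = (j : ℤ)))

/-! ## Shifted mixed insertion (orthogonal and symplectic versions) -/

/-- Tableaux whose entries are signed letters `(ε, u)`, `ε ∈ {+, -}`
(`true` records the sign `-`). -/
abbrev MTab := List (List (Bool × Letter))

def extractO (U : MTab) : STab :=
  U.map (fun row =>
    match row with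
    | [] => []
    | (e, x) :: rest => (if e then (⟨x.ceil, true⟩ : Letter) else x) :: rest.map Prod.snd)

def extractSp (U : MTab) : STab := U.map (List.map Prod.snd)

/-- One mixed insertion, of the pair `β` into row (`isCol = false`) or column
(`isCol = true`) number `idx`; returns the tableau and the added box. -/
def hmIns (sympl : Bool) : ℕ → MTab → Bool → ℕ → Bool × Letter → MTab × (ℕ × ℕ)
  | 0, T, _, _, _ => (T, (0, 0))
  | fuel + 1, T, isCol, idx, β =>
    if isCol then
      let c := idx
      let occ := (List.range (c + 1)).filterMap
        (fun r => (entryG? T r c).map (fun x => (r, x)))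
      match occ.find? (fun p => decide (β.2 < p.2.2)) with
      | none =>
          let r := occ.length
          (setRowG T r ((T.getD r []) ++ [β]), (r, c))
      | some p =>
          if p.1 = c then
            hmIns sympl fuel
              (setEntryG T p.1 c (if sympl then (p.2.1, β.2) else β)) true (c + 1)
              (if sympl then (β.1, ⟨p.2.2.ceil, true⟩) else (p.2.1, ⟨p.2.2.ceil, true⟩))
          else
            hmIns sympl fuel (setEntryG T p.1 c (p.2.1, β.2)) p.2.2.primed
              (if p.2.2.primed then c + 1 else p.1 + 1) (β.1, p.2.2)
    else
      let r := idx
      let row := T.getD r []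
      match row.findIdx? (fun p => decide (β.2 < p.2)) with
      | none => (setRowG T r (row ++ [β]), (r, r + row.length))
      | some k =>
          let q := row.getD k default
          if k = 0 then
            hmIns sympl fuel
              (setRowG T r (row.set 0 (if sympl then (q.1, β.2) else β))) true (r + 1)
              (if sympl then (β.1, ⟨q.2.ceil, true⟩) else (q.1, ⟨q.2.ceil, true⟩))
          else
            hmIns sympl fuel (setRowG T r (row.set k (q.1, β.2))) q.2.primed
              (if q.2.primed then r + k + 1 else r + 1) (β.1, q.2)

def hmInsert (sympl : Bool) (T : MTab) (x : Letter) : MTab × (ℕ × ℕ) :=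
  hmIns sympl (2 * T.flatten.length + 4) T false 0 (x.primed, ⟨x.ceil, false⟩)

def hmAuxCS (sympl : Bool) : MTab → STab → List (ℕ × Letter) → MTab × STab
  | U, Q, [] => (U, Q)
  | U, Q, p :: rest =>
      let res := hmInsert sympl U p.2
      let pos := res.2
      let sgn := ((entryG? res.1 pos.1 pos.2).map Prod.fst).getD false
      let pr : Bool := if sympl then sgn else (decide (pos.1 ≠ pos.2) && sgn)
      hmAuxCS sympl res.1
        (setRowG Q pos.1 ((Q.getD pos.1 []) ++ [(⟨(p.1 : ℤ), pr⟩ : Letter)])) rest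

def PHMO (φ : List (ℕ × Letter)) : STab := extractO (hmAuxCS false [] [] φ).1
def QHMO (φ : List (ℕ × Letter)) : STab := (hmAuxCS false [] [] φ).2
def PHMSp (φ : List (ℕ × Letter)) : STab := extractSp (hmAuxCS true [] [] φ).1
def QHMSp (φ : List (ℕ × Letter)) : STab := (hmAuxCS true [] [] φ).2

/-- A primed word, identified with the primed compatible sequence with
index row `1, 2, …, n`. -/
def wordCS (a : PWord) : List (ℕ × Letter) :=
  ((List.range a.length).zip a).map (fun p => (p.1 + 1, p.2))

/-! ## The transpose of a primed compatible sequence -/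

def insSortedCS (p : ℕ × Letter) : List (ℕ × Letter) → List (ℕ × Letter)
  | [] => [p]
  | q :: rest =>
      if p.1 < q.1 ∨ (p.1 = q.1 ∧ p.2 ≤ q.2) then p :: q :: rest
      else q :: insSortedCS p rest

def sortCS (l : List (ℕ × Letter)) : List (ℕ × Letter) := l.foldr insSortedCS []

/-- `φ^⊤`: move each prime from the value to the index above it, interchange the two
rows, and reorder the columns lexicographically. -/
def transposeCS (φ : List (ℕ × Letter)) : List (ℕ × Letter) :=
  sortCS (φ.map (fun p => (p.2.ceil.toNat, (⟨(p.1 : ℤ), p.2.primed⟩ : Letter))))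

/-- The simple transposition `(i, i+1)` as a function. -/
def sw (i x : ℤ) : ℤ := if x = i then i + 1 else if x = i + 1 then i else x

def IsInv (y : ℤ → ℤ) : Prop := ∀ x, y (y x) = x

def Fix2 (y : ℤ → ℤ) (i : ℤ) : Prop := y i = i ∧ y (i + 1) = i + 1

open Classical in
/-- One ascending step of the involution weak order. -/
noncomputable def istep (y : ℤ → ℤ) (i : ℤ) : ℤ → ℤ :=
  fun x => if Fix2 y i then y (sw i x) else sw i (y (sw i x))

/-- The letter `x` can be appended to a primed involution word of `y`. -/
def Asc (y : ℤ → ℤ) (x : Letter) : Prop :=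
  y x.ceil < y (x.ceil + 1) ∧ (x.primed = true → Fix2 y x.ceil)

noncomputable def irun (y : ℤ → ℤ) : PWord → ℤ → ℤ
  | [] => y
  | x :: a => irun (istep y x.ceil) a

def AscW (y : ℤ → ℤ) : PWord → Prop
  | [] => True
  | x :: a => Asc y x ∧ AscW (istep y x.ceil) a

theorem sw_sw (i x : ℤ) : sw i (sw i x) = x := by
  unfold sw; split_ifs <;> omega

theorem IsInv.istep {y : ℤ → ℤ} (h : IsInv y) (i : ℤ) : IsInv (istep y i) := by
  intro x
  unfold _root_.istep
  have h1 := h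
  unfold IsInv at h1
  by_cases hf : Fix2 y i
  · simp only [hf, if_true]
    obtain ⟨ha, hb⟩ := hf
    unfold sw
    grind
  · simp only [hf, if_false, sw_sw, h1 _]

theorem IsInv.inj {y : ℤ → ℤ} (h : IsInv y) {a b : ℤ} (e : y a = y b) : a = b := by
  rw [← h a, ← h b, e]

theorem irun_append (y : ℤ → ℤ) (a b : PWord) : irun y (a ++ b) = irun (irun y a) b := by
  induction a generalizing y with
  | nil => rfl
  | cons x a ih => simp [irun, ih]

theorem ascW_append (y : ℤ → ℤ) (a b : PWord) :
    AscW y (a ++ b) ↔ AscW y a ∧ AscW (irun y a) b := by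
  induction a generalizing y with
  | nil => simp [AscW, irun]
  | cons x a ih => simp [AscW, irun, ih, and_assoc]

theorem IsInv.irun {y : ℤ → ℤ} (h : IsInv y) (a : PWord) : IsInv (irun y a) := by
  induction a generalizing y with
  | nil => exact h
  | cons x a ih => exact ih (h.istep _)

/-- Two words act in the same way on all involutions. -/
def WEq (a b : PWord) : Prop :=
  ∀ y, IsInv y → (AscW y a ↔ AscW y b) ∧ (AscW y a → irun y a = irun y b)

theorem WEq.refl (a : PWord) : WEq a a := fun _ _ => ⟨Iff.rfl, fun _ => rfl⟩

theorem WEq.symm {a b : PWord} (h : WEq a b) : WEq b a := fun y hy =>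
  ⟨(h y hy).1.symm, fun k => ((h y hy).2 ((h y hy).1.2 k)).symm⟩

theorem WEq.trans {a b c : PWord} (h : WEq a b) (k : WEq b c) : WEq a c := fun y hy =>
  ⟨(h y hy).1.trans (k y hy).1, fun l =>
    ((h y hy).2 l).trans ((k y hy).2 ((h y hy).1.1 l))⟩

theorem WEq.append {a b c d : PWord} (h : WEq a b) (k : WEq c d) : WEq (a ++ c) (b ++ d) := by
  intro y hy
  simp only [ascW_append, irun_append]
  have h1 := h y hy
  constructor
  · constructor
    · rintro ⟨p, q⟩
      exact ⟨h1.1.1 p, h1.2 p ▸ (k _ (hy.irun a)).1.1 q⟩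
    · rintro ⟨p, q⟩
      have p' := h1.1.2 p
      refine ⟨p', (k _ (hy.irun a)).1.2 ?_⟩
      rw [h1.2 p']; exact q
  · rintro ⟨p, q⟩
    rw [(k _ (hy.irun a)).2 q, h1.2 p]

theorem istep_fix {y : ℤ → ℤ} {i : ℤ} (h : Fix2 y i) (x : ℤ) : istep y i x = y (sw i x) := by
  simp [istep, h]

theorem istep_nfix {y : ℤ → ℤ} {i : ℤ} (h : ¬ Fix2 y i) (x : ℤ) :
    istep y i x = sw i (y (sw i x)) := by
  simp [istep, h]

theorem istep_comm_aux {y : ℤ → ℤ} (hy : IsInv y) {i j : ℤ} (hij : i + 2 ≤ j ∨ j + 2 ≤ i)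
    (hi : y i < y (i + 1)) (hj : istep y i j < istep y i (j + 1)) :
    (y j < y (j + 1) ∧ istep y j i < istep y j (i + 1)) ∧
    (Fix2 (istep y i) j ↔ Fix2 y j) ∧ (Fix2 (istep y j) i ↔ Fix2 y i) ∧
    istep (istep y i) j = istep (istep y j) i := by
  have hy' := hy
  unfold IsInv at hy
  have hsi : ∀ x, x ≠ i → x ≠ i + 1 → sw i x = x := by intro x h1 h2; simp [sw, h1, h2]
  have hsj : ∀ x, x ≠ j → x ≠ j + 1 → sw j x = x := by intro x h1 h2; simp [sw, h1, h2]
  have hcomm : ∀ x, sw i (sw j x) = sw j (sw i x) := by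
    intro x; unfold sw; split_ifs <;> omega
  have e1 : sw i i = i + 1 := by simp [sw]
  have e2 : sw i (i + 1) = i := by simp [sw]
  have e3 : sw j j = j + 1 := by simp [sw]
  have e4 : sw j (j + 1) = j := by simp [sw]
  have a1 := hsi j (by omega) (by omega)
  have a2 := hsi (j + 1) (by omega) (by omega)
  have a3 := hsj i (by omega) (by omega)
  have a4 := hsj (i + 1) (by omega) (by omega)
  have inj : ∀ {a b : ℤ}, y a = y b → a = b := hy'.inj
  have F1 : Fix2 (istep y i) j ↔ Fix2 y j := by
    unfold Fix2 istep
    by_cases hf : Fix2 y i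
    · simp only [hf, if_true, a1, a2]
    · simp only [hf, if_false, a1, a2]
      constructor
      · rintro ⟨p, q⟩
        constructor
        · have := congrArg (sw i) p; rwa [sw_sw, a1] at this
        · have := congrArg (sw i) q; rwa [sw_sw, a2] at this
      · rintro ⟨p, q⟩; rw [p, q]; exact ⟨a1, a2⟩
  have F2 : Fix2 (istep y j) i ↔ Fix2 y i := by
    unfold Fix2 istep
    by_cases hf : Fix2 y j
    · simp only [hf, if_true, a3, a4]
    · simp only [hf, if_false, a3, a4]
      constructor
      · rintro ⟨p, q⟩
        constructor
        · have := congrArg (sw j) p; rwa [sw_sw, a3] at this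
        · have := congrArg (sw j) q; rwa [sw_sw, a4] at this
      · rintro ⟨p, q⟩; rw [p, q]; exact ⟨a3, a4⟩
  refine ⟨?_, F1, F2, ?_⟩
  · have n1 := @inj j (j+1)
    have n2 := @inj i (i+1)
    have m1 := hy i
    have m2 := hy (i+1)
    have m3 := hy j
    have m4 := hy (j+1)
    by_cases hf : Fix2 y i <;> by_cases hg : Fix2 y j <;>
      simp only [istep, hf, hg, if_true, if_false, a1, a2, a3, a4] at hj ⊢ <;>
      unfold Fix2 at * <;> unfold sw at * <;> grind
  · funext x
    by_cases hf : Fix2 y i <;> by_cases hg : Fix2 y j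
    · rw [istep_fix (F1.2 hg), istep_fix hf, istep_fix (F2.2 hf), istep_fix hg, hcomm]
    · rw [istep_nfix (mt F1.1 hg), istep_fix hf, istep_fix (F2.2 hf), istep_nfix hg, hcomm]
    · rw [istep_fix (F1.2 hg), istep_nfix hf, istep_nfix (mt F2.1 hf), istep_fix hg, hcomm]
    · rw [istep_nfix (mt F1.1 hg), istep_nfix hf, istep_nfix (mt F2.1 hf), istep_nfix hg, hcomm,
        hcomm]

theorem wEq_comm (x w : Letter) (h : x.ceil + 2 ≤ w.ceil ∨ w.ceil + 2 ≤ x.ceil) :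
    WEq [x, w] [w, x] := by
  intro y hy
  have k1 := @istep_comm_aux y hy x.ceil w.ceil h
  have k2 := @istep_comm_aux y hy w.ceil x.ceil h.symm
  simp only [AscW, irun, Asc, and_true]
  constructor
  · constructor
    · rintro ⟨⟨a, b⟩, c, d⟩
      obtain ⟨e, f, g, -⟩ := k1 a c
      exact ⟨⟨e.1, fun t => f.1 (d t)⟩, e.2, fun t => g.2 (b t)⟩
    · rintro ⟨⟨a, b⟩, c, d⟩
      obtain ⟨e, f, g, -⟩ := k2 a c
      exact ⟨⟨e.1, fun t => f.1 (d t)⟩, e.2, fun t => g.2 (b t)⟩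
  · rintro ⟨⟨a, b⟩, c, d⟩
    exact (k1 a c).2.2.2

theorem not_ascW_self (y : ℤ → ℤ) (hy : IsInv y) (x w : Letter) (h : x.ceil = w.ceil) :
    ¬ AscW y [x, w] := by
  simp only [AscW, Asc, and_true, ← h]
  rintro ⟨⟨a, -⟩, b, -⟩
  have m1 := hy x.ceil
  have m2 := hy (x.ceil + 1)
  by_cases hf : Fix2 y x.ceil
  · simp only [istep_fix hf] at b
    simp [sw] at b
    omega
  · simp only [istep_nfix hf] at b
    unfold Fix2 at hf
    unfold sw at b
    grind

theorem sw_braid {i k : ℤ} (h : k = i + 1 ∨ i = k + 1) (x : ℤ) :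
    sw i (sw k (sw i x)) = sw k (sw i (sw k x)) := by
  unfold sw; rcases h with rfl | rfl <;> grind

theorem sw_eq_self {i x : ℤ} (h : x ≠ i) (h' : x ≠ i + 1) : sw i x = x := by
  simp [sw, h, h']

def Braidable (y : ℤ → ℤ) (i : ℤ) : Prop :=
  y i < y (i + 1) ∧ y (i + 1) < y (i + 2) ∧ (Fix2 y i → Fix2 y (i + 1) → False)

open Classical in
theorem istep_apply (y : ℤ → ℤ) (i x : ℤ) :
    istep y i x = if Fix2 y i then y (sw i x) else sw i (y (sw i x)) := rfl

theorem sw_left (i : ℤ) : sw i i = i + 1 := by simp [sw]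
theorem sw_right (i : ℤ) : sw i (i + 1) = i := by simp [sw]
theorem sw_add_two (i : ℤ) : sw i (i + 2) = i + 2 := by unfold sw; split_ifs <;> omega
theorem sw_succ_self (i : ℤ) : sw (i + 1) i = i := by unfold sw; split_ifs <;> omega
theorem sw_succ_add_two (i : ℤ) : sw (i + 1) (i + 2) = i + 1 := by unfold sw; split_ifs <;> omega
theorem add_one_one (i : ℤ) : i + 1 + 1 = i + 2 := by ring

theorem braidable_of_up {y : ℤ → ℤ} (hy : IsInv y) {i : ℤ}
    (a1 : y i < y (i + 1)) (a2 : istep y i (i + 1) < istep y i (i + 1 + 1))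
    (a3 : istep (istep y i) (i + 1) i < istep (istep y i) (i + 1) (i + 1)) : Braidable y i := by
  have e1 := hy i
  have e2 := hy (i + 1)
  have e3 := hy (i + 2)
  by_cases f1 : Fix2 y i <;> by_cases f2 : Fix2 (istep y i) (i + 1) <;>
    simp only [f1, f2, istep_apply, if_true, if_false, sw_left, sw_right, sw_add_two, sw_succ_self,
      sw_succ_add_two, add_one_one] at a1 a2 a3 <;>
    simp only [f1, Fix2, istep_apply, if_true, if_false, sw_left, sw_right, sw_add_two,
      sw_succ_self, sw_succ_add_two, add_one_one] at f1 f2 <;>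
    unfold Braidable Fix2 <;> unfold sw at * <;> grind

theorem braidable_of_down {y : ℤ → ℤ} (hy : IsInv y) {i : ℤ}
    (a1 : y (i + 1) < y (i + 1 + 1)) (a2 : istep y (i + 1) i < istep y (i + 1) (i + 1))
    (a3 : istep (istep y (i + 1)) i (i + 1) < istep (istep y (i + 1)) i (i + 1 + 1)) :
    Braidable y i := by
  have e1 := hy i
  have e2 := hy (i + 1)
  have e3 := hy (i + 2)
  by_cases f1 : Fix2 y (i + 1) <;> by_cases f2 : Fix2 (istep y (i + 1)) i <;>
    simp only [f1, f2, istep_apply, if_true, if_false, sw_left, sw_right, sw_add_two, sw_succ_self,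
      sw_succ_add_two, add_one_one] at a1 a2 a3 <;>
    simp only [f1, Fix2, istep_apply, if_true, if_false, sw_left, sw_right, sw_add_two,
      sw_succ_self, sw_succ_add_two, add_one_one] at f1 f2 <;>
    unfold Braidable Fix2 <;> unfold sw at * <;> grind (splits := 20)

theorem Braidable.up {y : ℤ → ℤ} (hy : IsInv y) {i : ℤ} (h : Braidable y i) :
    istep y i (i + 1) < istep y i (i + 1 + 1) ∧ ¬ Fix2 (istep y i) (i + 1) ∧
    istep (istep y i) (i + 1) i < istep (istep y i) (i + 1) (i + 1) ∧
    (Fix2 (istep (istep y i) (i + 1)) i ↔ Fix2 y (i + 1)) := by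
  have e1 := hy i
  have e2 := hy (i + 1)
  have e3 := hy (i + 2)
  obtain ⟨h1, h2, h3⟩ := h
  have f2 : ¬ Fix2 (istep y i) (i + 1) := by
    by_cases f1 : Fix2 y i <;>
    simp only [f1, Fix2, istep_apply, if_true, if_false, sw_left, sw_right, sw_add_two,
      sw_succ_self, sw_succ_add_two, add_one_one] <;>
    unfold Fix2 at * <;> unfold sw at * <;> grind (splits := 20)
  by_cases f1 : Fix2 y i <;>
    simp only [Fix2, f1, f2, istep_apply, if_true, if_false, sw_left, sw_right, sw_add_two, sw_succ_self,
      sw_succ_add_two, add_one_one, not_false_eq_true, true_and] <;>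
    unfold Fix2 at * <;> unfold sw at * <;> grind (splits := 20)

theorem Braidable.down {y : ℤ → ℤ} (hy : IsInv y) {i : ℤ} (h : Braidable y i) :
    istep y (i + 1) i < istep y (i + 1) (i + 1) ∧ ¬ Fix2 (istep y (i + 1)) i ∧
    istep (istep y (i + 1)) i (i + 1) < istep (istep y (i + 1)) i (i + 1 + 1) ∧
    (Fix2 (istep (istep y (i + 1)) i) (i + 1) ↔ Fix2 y i) := by
  have e1 := hy i
  have e2 := hy (i + 1)
  have e3 := hy (i + 2)
  obtain ⟨h1, h2, h3⟩ := h
  have f2 : ¬ Fix2 (istep y (i + 1)) i := by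
    by_cases f1 : Fix2 y (i + 1) <;>
    simp only [f1, Fix2, istep_apply, if_true, if_false, sw_left, sw_right, sw_add_two,
      sw_succ_self, sw_succ_add_two, add_one_one] <;>
    unfold Fix2 at * <;> unfold sw at * <;> grind (splits := 20)
  by_cases f1 : Fix2 y (i + 1) <;>
    simp only [Fix2, f1, f2, istep_apply, if_true, if_false, sw_left, sw_right, sw_add_two, sw_succ_self,
      sw_succ_add_two, add_one_one, not_false_eq_true, true_and] <;>
    unfold Fix2 at * <;> unfold sw at * <;> grind (splits := 20)

theorem wEq_braid_up (i : ℤ) (p q : Bool) :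
    WEq [⟨i, p⟩, ⟨i + 1, false⟩, ⟨i, q⟩] [⟨i + 1, q⟩, ⟨i, false⟩, ⟨i + 1, p⟩] := by
  intro y hy
  simp only [AscW, irun, Asc, and_true, Bool.false_eq_true, false_imp_iff]
  constructor
  · constructor
    · rintro ⟨⟨a1, f1⟩, a2, a3, f3⟩
      have hb := braidable_of_up hy a1 a2 a3
      have k1 := hb.up hy
      have k2 := hb.down hy
      rw [k1.2.2.2] at f3
      rw [k2.2.2.2]
      exact ⟨⟨by simpa only [add_one_one] using hb.2.1, f3⟩, k2.1, k2.2.2.1, f1⟩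
    · rintro ⟨⟨a1, f1⟩, a2, a3, f3⟩
      have hb := braidable_of_down hy a1 a2 a3
      have k1 := hb.up hy
      have k2 := hb.down hy
      rw [k2.2.2.2] at f3
      rw [k1.2.2.2]
      exact ⟨⟨hb.1, f3⟩, k1.1, k1.2.2.1, f1⟩
  · rintro ⟨⟨a1, f1⟩, a2, a3, f3⟩
    have hb := braidable_of_up hy a1 a2 a3
    have k1 := hb.up hy
    have k2 := hb.down hy
    have hs := @sw_braid i (i + 1) (Or.inl rfl)
    have h3 := hb.2.2
    funext x
    by_cases g1 : Fix2 y i <;> by_cases g2 : Fix2 y (i + 1)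
    · exact (h3 g1 g2).elim
    · rw [istep_nfix (mt k1.2.2.2.1 g2), istep_nfix k1.2.1, istep_fix g1,
        istep_fix (k2.2.2.2.2 g1), istep_nfix k2.2.1, istep_nfix g2, hs]
    · rw [istep_fix (k1.2.2.2.2 g2), istep_nfix k1.2.1, istep_nfix g1,
        istep_nfix (mt k2.2.2.2.1 g1), istep_nfix k2.2.1, istep_fix g2, hs]
    · rw [istep_nfix (mt k1.2.2.2.1 g2), istep_nfix k1.2.1, istep_nfix g1,
        istep_nfix (mt k2.2.2.2.1 g1), istep_nfix k2.2.1, istep_nfix g2, hs, hs]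

theorem wEq_braid {i k : ℤ} (h : k = i + 1 ∨ i = k + 1) (p q : Bool) :
    WEq [⟨i, p⟩, ⟨k, false⟩, ⟨i, q⟩] [⟨k, q⟩, ⟨i, false⟩, ⟨k, p⟩] := by
  rcases h with rfl | rfl
  · exact wEq_braid_up i p q
  · exact (wEq_braid_up k q p).symm

/-- In a braid configuration the middle letter is unprimed. -/
theorem not_ascW_braid {y : ℤ → ℤ} (hy : IsInv y) {i k : ℤ} (h : k = i + 1 ∨ i = k + 1)
    (p q : Bool) : ¬ AscW y [⟨i, p⟩, ⟨k, true⟩, ⟨i, q⟩] := by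
  simp only [AscW, Asc, and_true, true_imp_iff]
  rintro ⟨⟨a1, -⟩, ⟨a2, f2⟩, a3, -⟩
  rcases h with rfl | rfl
  · exact ((braidable_of_up hy a1 a2 a3).up hy).2.1 f2
  · exact ((braidable_of_down hy a1 a2 a3).down hy).2.1 f2

/-- The primed word `a` builds the involution `z` from the identity. -/
def Builds (a : PWord) (z : ℤ → ℤ) : Prop := AscW id a ∧ irun id a = z

theorem isInv_id : IsInv id := fun _ => rfl

theorem fix2_id (i : ℤ) : Fix2 id i := ⟨rfl, rfl⟩

theorem WEq.builds {a b : PWord} (h : WEq a b) (z : ℤ → ℤ) : Builds a z ↔ Builds b z := by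
  unfold Builds
  have := h id isInv_id
  constructor
  · rintro ⟨p, q⟩; exact ⟨this.1.1 p, this.2 p ▸ q⟩
  · rintro ⟨p, q⟩; exact ⟨this.1.2 p, (this.2 (this.1.2 p)).trans q⟩

theorem builds_first (i : ℤ) (p q : Bool) (r : PWord) (z : ℤ → ℤ) :
    Builds (⟨i, p⟩ :: r) z → Builds (⟨i, q⟩ :: r) z := by
  simp only [Builds, AscW, irun, Asc, fix2_id, imp_true_iff, and_true]
  exact id

theorem istep_id (i : ℤ) : istep id i = sw i := by
  funext x; rw [istep_fix (fix2_id i)]; rfl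

theorem fix2_sw (i k : ℤ) : Fix2 (sw i) k ↔ i + 2 ≤ k ∨ k + 2 ≤ i := by
  unfold Fix2 sw; grind

theorem builds_swap (x w : Letter) (r : PWord) (z : ℤ → ℤ) (h : Builds (x :: w :: r) z) :
    Builds (⟨w.ceil, false⟩ :: ⟨x.ceil, w.primed⟩ :: r) z := by
  obtain ⟨⟨a1, a2, a3⟩, b⟩ := h
  have hne : x.ceil ≠ w.ceil := fun hl => not_ascW_self id isInv_id x w hl ⟨a1, a2, trivial⟩
  simp only [irun, Asc, istep_id, fix2_sw] at a2 a3 b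
  have e : istep (sw x.ceil) w.ceil = istep (sw w.ceil) x.ceil := by
    funext t
    by_cases hf : x.ceil + 2 ≤ w.ceil ∨ w.ceil + 2 ≤ x.ceil
    · rw [istep_fix ((fix2_sw _ _).2 hf), istep_fix ((fix2_sw _ _).2 hf.symm)]
      unfold sw; grind
    · rw [istep_nfix (mt (fix2_sw _ _).1 hf), istep_nfix (mt (fix2_sw _ _).1 (mt Or.symm hf))]
      exact (sw_braid (by omega) _).symm
  refine ⟨⟨⟨by simp, fun _ => fix2_id _⟩, ?_, ?_⟩, ?_⟩
  · refine ⟨?_, fun hp => ?_⟩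
    · simp only [istep_id]; unfold sw; grind
    · simp only [istep_id, fix2_sw]; exact (a2.2 hp).symm
  · simp only [istep_id, ← e]; exact a3
  · simp only [irun, istep_id, ← e]; exact b

/-- The congruence generated by commutations and primed braid relations. -/
inductive Eqv : PWord → PWord → Prop
  | refl (a) : Eqv a a
  | symm {a b} : Eqv a b → Eqv b a
  | trans {a b c} : Eqv a b → Eqv b c → Eqv a c
  | comm (a b : PWord) (x w : Letter) : (x.ceil + 2 ≤ w.ceil ∨ w.ceil + 2 ≤ x.ceil) →
      Eqv (a ++ ([x, w] ++ b)) (a ++ ([w, x] ++ b))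
  | braid (a b : PWord) (i k : ℤ) (p q : Bool) : (k = i + 1 ∨ i = k + 1) →
      Eqv (a ++ ([⟨i, p⟩, ⟨k, false⟩, ⟨i, q⟩] ++ b)) (a ++ ([⟨k, q⟩, ⟨i, false⟩, ⟨k, p⟩] ++ b))

theorem Eqv.wEq {a b : PWord} (h : Eqv a b) : WEq a b := by
  induction h with
  | refl a => exact WEq.refl a
  | symm _ ih => exact ih.symm
  | trans _ _ ih1 ih2 => exact ih1.trans ih2
  | comm a b x w h => exact (WEq.refl a).append ((wEq_comm x w h).append (WEq.refl b))
  | braid a b i k p q h => exact (WEq.refl a).append ((wEq_braid h p q).append (WEq.refl b))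

theorem Eqv.append_left (c : PWord) {a b : PWord} (h : Eqv a b) : Eqv (c ++ a) (c ++ b) := by
  induction h with
  | refl a => exact Eqv.refl _
  | symm _ ih => exact ih.symm
  | trans _ _ ih1 ih2 => exact ih1.trans ih2
  | comm a b x w h => simpa using Eqv.comm (c ++ a) b x w h
  | braid a b i k p q h => simpa using Eqv.braid (c ++ a) b i k p q h

theorem Eqv.append_right (c : PWord) {a b : PWord} (h : Eqv a b) : Eqv (a ++ c) (b ++ c) := by
  induction h with
  | refl a => exact Eqv.refl _
  | symm _ ih => exact ih.symm
  | trans _ _ ih1 ih2 => exact ih1.trans ih2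
  | comm a b x w h => simpa using Eqv.comm a (b ++ c) x w h
  | braid a b i k p q h => simpa using Eqv.braid a (b ++ c) i k p q h

theorem Eqv.reverse {a b : PWord} (h : Eqv a b) : Eqv a.reverse b.reverse := by
  induction h with
  | refl a => exact Eqv.refl _
  | symm _ ih => exact ih.symm
  | trans _ _ ih1 ih2 => exact ih1.trans ih2
  | comm a b x w h => simpa using Eqv.comm b.reverse a.reverse w x h.symm
  | braid a b i k p q h => simpa using Eqv.braid b.reverse a.reverse i k q p h

theorem Eqv.cons (x : Letter) {a b : PWord} (h : Eqv a b) : Eqv (x :: a) (x :: b) :=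
  h.append_left [x]

/-- Letters which commute. -/
def Far (x w : Letter) : Prop := x.ceil + 2 ≤ w.ceil ∨ w.ceil + 2 ≤ x.ceil

theorem eqv_move (x : Letter) (a : PWord) (h : ∀ w ∈ a, Far w x) : Eqv (a ++ [x]) (x :: a) := by
  induction a with
  | nil => exact Eqv.refl _
  | cons w a ih =>
    have h1 := (ih fun t ht => h t (List.mem_cons_of_mem _ ht)).cons w
    exact h1.trans (by simpa using Eqv.comm [] a w x (h w List.mem_cons_self))

/-- Subwords (or their reversals) of words which build something. -/
def Red (u : PWord) : Prop :=
  ∃ X Y z, Builds (X ++ u ++ Y) z ∨ Builds (X ++ u.reverse ++ Y) z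

theorem Red.eqv {u v : PWord} (h : Red u) (e : Eqv u v) : Red v := by
  obtain ⟨X, Y, z, h | h⟩ := h
  · exact ⟨X, Y, z, Or.inl ((((e.append_left X).append_right Y).wEq.builds z).1 h)⟩
  · exact ⟨X, Y, z, Or.inr ((((e.reverse.append_left X).append_right Y).wEq.builds z).1 h)⟩

theorem Red.middle (A u B : PWord) (h : Red (A ++ u ++ B)) : Red u := by
  obtain ⟨X, Y, z, h | h⟩ := h
  · exact ⟨X ++ A, B ++ Y, z, Or.inl (by simpa using h)⟩
  · exact ⟨X ++ B.reverse, A.reverse ++ Y, z, Or.inr (by simpa using h)⟩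

theorem Red.ne {x w : Letter} (h : Red [x, w]) : x.ceil ≠ w.ceil := by
  intro e
  obtain ⟨X, Y, z, h | h⟩ := h
  · have := ((ascW_append _ _ _).1 ((ascW_append _ _ _).1 h.1).1).2
    exact not_ascW_self _ (isInv_id.irun X) _ _ e this
  · have := ((ascW_append _ _ _).1 ((ascW_append _ _ _).1 h.1).1).2
    exact not_ascW_self _ (isInv_id.irun X) _ _ e.symm this

theorem Red.mid {x k w : Letter} (h : Red [x, k, w]) (e : w.ceil = x.ceil)
    (hk : k.ceil = x.ceil + 1 ∨ x.ceil = k.ceil + 1) : k.primed = false := by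
  obtain ⟨i, p⟩ := x
  obtain ⟨k, r⟩ := k
  obtain ⟨i', q⟩ := w
  simp only at e hk
  subst e
  cases r
  · rfl
  · obtain ⟨X, Y, z, h | h⟩ := h
    · have := ((ascW_append _ _ _).1 ((ascW_append _ _ _).1 h.1).1).2
      exact (not_ascW_braid (isInv_id.irun X) hk _ _ this).elim
    · have := ((ascW_append _ _ _).1 ((ascW_append _ _ _).1 h.1).1).2
      exact (not_ascW_braid (isInv_id.irun X) hk _ _ this).elim

/-- Inserting `w` in a strictly increasing line `A m B` so that it replaces `m`. -/
theorem eqv_bump (A B : PWord) (m w : Letter) (hA : ∀ a ∈ A, a.ceil < w.ceil)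
    (hB : ∀ b ∈ B, m.ceil < b.ceil) (h : w.ceil < m.ceil) :
    Eqv (A ++ m :: B ++ [w]) (m :: (A ++ w :: B)) := by
  have h1 : Eqv (B ++ [w]) (w :: B) := eqv_move w B fun b hb => by
    have := hB b hb; unfold Far; omega
  have h2 : Eqv (A ++ [m]) (m :: A) := eqv_move m A fun b hb => by
    have := hA b hb; unfold Far; omega
  have h3 := h1.append_left (A ++ [m])
  have h4 := h2.append_right (w :: B)
  simp only [List.append_assoc, List.cons_append, List.nil_append] at h3 h4 ⊢
  exact h3.trans h4

theorem eqv_pass (A B : PWord) (w : ℤ) (p q : Bool) (hA : ∀ a ∈ A, a.ceil < w)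
    (hB : ∀ b ∈ B, w + 1 < b.ceil) :
    Eqv (A ++ ⟨w, p⟩ :: ⟨w + 1, false⟩ :: B ++ [⟨w, q⟩])
      (⟨w + 1, q⟩ :: (A ++ ⟨w, false⟩ :: ⟨w + 1, p⟩ :: B)) := by
  have h1 : Eqv (B ++ [⟨w, q⟩]) (⟨w, q⟩ :: B) := eqv_move _ B fun b hb => by
    have := hB b hb; unfold Far; simp only; omega
  have h2 : Eqv (A ++ [⟨w + 1, q⟩]) (⟨w + 1, q⟩ :: A) := eqv_move _ A fun b hb => by
    have := hA b hb; unfold Far; simp only; omega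
  have h3 := h1.append_left (A ++ [⟨w, p⟩, ⟨w + 1, false⟩])
  have h4 := h2.append_right (⟨w, false⟩ :: ⟨w + 1, p⟩ :: B)
  have h5 := Eqv.braid A B w (w + 1) p q (Or.inl rfl)
  simp only [List.append_assoc, List.cons_append, List.nil_append] at h3 h4 h5 ⊢
  exact (h3.trans h5).trans h4

theorem Red.pass_fwd {A B : PWord} {m w : Letter} (h : Red (A ++ m :: B ++ [w]))
    (e : m.ceil = w.ceil) (hB : (m :: B).Pairwise (fun a b => a.ceil < b.ceil)) :
    ∃ B', B = ⟨w.ceil + 1, false⟩ :: B' := by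
  cases B with
  | nil => exact (Red.ne (Red.middle A _ [] (by simpa using h)) e).elim
  | cons M B =>
    simp only [List.pairwise_cons, List.mem_cons, forall_eq_or_imp] at hB
    obtain ⟨⟨h1, h2⟩, h3, -⟩ := hB
    have hm : Eqv (B ++ [w]) (w :: B) := eqv_move w B fun b hb => by
      have := h3 b hb; unfold Far; omega
    have h4 : Red (A ++ [m, M, w] ++ B) := h.eqv (by
      simpa using hm.append_left (A ++ [m, M]))
    have h5 := Red.middle _ _ _ h4
    by_cases hM : M.ceil = w.ceil + 1
    · have := h5.mid e.symm (by omega)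
      obtain ⟨c, b⟩ := M
      simp only at this hM
      subst this hM
      exact ⟨B, rfl⟩
    · have h6 : Red ([] ++ [m, w] ++ [M]) := h5.eqv (by
        simpa using Eqv.comm [m] [] M w (by omega))
      exact ((Red.middle _ _ _ h6).ne e).elim

theorem Red.pass_bwd {A B : PWord} {m w : Letter} (h : Red (w :: (A ++ m :: B)))
    (e : m.ceil = w.ceil) (hA : (A ++ [m]).Pairwise (fun a b => a.ceil < b.ceil)) :
    ∃ A', A = A' ++ [⟨w.ceil - 1, false⟩] := by
  rcases List.eq_nil_or_concat A with rfl | ⟨A, M, rfl⟩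
  · exact (Red.ne (Red.middle [] _ B (by simpa using h)) e.symm).elim
  · simp only [List.concat_eq_append, List.append_assoc, List.pairwise_append, List.mem_append,
      List.mem_singleton, List.cons_append, List.nil_append, List.pairwise_cons, List.mem_cons,
      List.not_mem_nil, or_false, forall_eq_or_imp, forall_eq] at hA h ⊢
    obtain ⟨-, ⟨h1, -⟩, h2⟩ := hA
    have hm : Eqv (A ++ [w]) (w :: A) := eqv_move w A fun b hb => by
      have := h2 b hb; unfold Far; omega
    have h4 : Red (A ++ [w, M, m] ++ B) := h.eqv (by
      simpa using (hm.append_right (M :: m :: B)).symm)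
    have h5 := Red.middle _ _ _ h4
    by_cases hM : M.ceil = w.ceil - 1
    · have := h5.mid e (by omega)
      obtain ⟨c, b⟩ := M
      simp only at this hM
      subst this hM
      exact ⟨A, by simp⟩
    · have h6 : Red ([M] ++ [w, m] ++ []) := h5.eqv (by
        simpa using Eqv.comm [] [m] w M (by omega))
      exact ((Red.middle _ _ _ h6).ne e.symm).elim

/-- The entries listed by `f` at the first `n` positions. -/
def line (f : ℕ → Option Letter) (n : ℕ) : PWord := (List.range n).filterMap f

theorem line_succ (f : ℕ → Option Letter) (n : ℕ) :
    line f (n + 1) = line f n ++ (f n).toList := by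
  simp only [line, List.range_succ, List.filterMap_append]
  cases h : f n <;> simp [h]

theorem mem_line {f : ℕ → Option Letter} {n : ℕ} {x : Letter} :
    x ∈ line f n ↔ ∃ j < n, f j = some x := by
  simp [line]

theorem line_congr {f g : ℕ → Option Letter} {n : ℕ} (h : ∀ j < n, f j = g j) :
    line f n = line g n := by
  induction n with
  | zero => rfl
  | succ n ih => rw [line_succ, line_succ, ih fun j hj => h j (by omega), h n (by omega)]

theorem line_extend {f : ℕ → Option Letter} {n k : ℕ} (hk : n ≤ k)
    (h : ∀ j, n ≤ j → f j = none) : line f k = line f n := by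
  induction k, hk using Nat.le_induction with
  | base => rfl
  | succ k hk ih => rw [line_succ, ih, h k hk]; simp

/-- The entries listed by `f` at the positions from `p + 1` up to `n - 1`. -/
def tailLine (f : ℕ → Option Letter) (p n : ℕ) : PWord :=
  (List.range' (p + 1) (n - (p + 1))).filterMap f

theorem mem_tailLine {f : ℕ → Option Letter} {p n : ℕ} {x : Letter} :
    x ∈ tailLine f p n ↔ ∃ j, p < j ∧ j < n ∧ f j = some x := by
  simp only [tailLine, List.mem_filterMap, List.mem_range'_1]
  constructor
  · rintro ⟨j, h, e⟩; exact ⟨j, by omega, by omega, e⟩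
  · rintro ⟨j, h, h', e⟩; exact ⟨j, by omega, e⟩

theorem line_split (f : ℕ → Option Letter) {p n : ℕ} (hp : p < n) :
    line f n = line f p ++ ((f p).toList ++ tailLine f p n) := by
  have h : List.range n = List.range p ++ p :: List.range' (p + 1) (n - (p + 1)) := by
    have h1 : List.range' 0 n = List.range' 0 (p + (n - p)) := by congr 1; omega
    rw [List.range_eq_range', List.range_eq_range', h1, ← List.range'_append_1]
    congr 1
    have h2 : n - p = (n - (p + 1)) + 1 := by omega
    rw [h2, List.range'_succ]; simp
  rw [line, h, List.filterMap_append, line, List.filterMap_cons]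
  cases f p <;> simp [tailLine]

theorem tailLine_congr {f g : ℕ → Option Letter} {p n : ℕ} (h : ∀ j, p < j → f j = g j) :
    tailLine f p n = tailLine g p n := by
  apply List.filterMap_congr
  intro j hj
  rw [List.mem_range'_1] at hj
  exact h j (by omega)

theorem tailLine_head {f : ℕ → Option Letter} {p n : ℕ} (hp : p + 1 < n) :
    tailLine f p n = (f (p + 1)).toList ++ tailLine f (p + 1) n := by
  have h2 : n - (p + 1) = (n - (p + 2)) + 1 := by omega
  rw [tailLine, h2, List.range'_succ, List.filterMap_cons]
  cases f (p + 1) <;> simp [tailLine, add_assoc]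

/-- Strict increase of the entries listed by `f`. -/
def LInc (f : ℕ → Option Letter) : Prop :=
  ∀ i j x w, i < j → f i = some x → f j = some w → x.ceil < w.ceil

theorem LInc.pairwise {f : ℕ → Option Letter} (h : LInc f) (n : ℕ) :
    (line f n).Pairwise (fun a b => a.ceil < b.ceil) := by
  induction n with
  | zero => simp [line]
  | succ n ih =>
    rw [line_succ, List.pairwise_append]
    refine ⟨ih, by cases f n <;> simp, fun a ha b hb => ?_⟩
    obtain ⟨j, hj, e⟩ := mem_line.1 ha
    exact h j n a b hj e (by simpa using hb)

abbrev Grid := ℕ → ℕ → Option Letter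

def tr (G : Grid) : Grid := fun i j => G j i

/-- The word of the lines `a, …, a + k - 1`, in decreasing order. -/
def rows (H : Grid) (n a : ℕ) : ℕ → PWord
  | 0 => []
  | k + 1 => line (H (a + k)) n ++ rows H n a k

theorem mem_rows {H : Grid} {n a k : ℕ} {x : Letter} :
    x ∈ rows H n a k ↔ ∃ i j, a ≤ i ∧ i < a + k ∧ j < n ∧ H i j = some x := by
  induction k with
  | zero => simp [rows]; omega
  | succ k ih =>
    rw [rows, List.mem_append, ih, mem_line]
    constructor
    · rintro (⟨j, hj, e⟩ | ⟨i, j, h1, h2, h3, e⟩)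
      · exact ⟨a + k, j, by omega, by omega, hj, e⟩
      · exact ⟨i, j, h1, by omega, h3, e⟩
    · rintro ⟨i, j, h1, h2, h3, e⟩
      rcases (show i = a + k ∨ i < a + k by omega) with rfl | h
      · exact Or.inl ⟨j, h3, e⟩
      · exact Or.inr ⟨i, j, h1, h, h3, e⟩

theorem rows_append (H : Grid) (n a k l : ℕ) :
    rows H n a (k + l) = rows H n (a + k) l ++ rows H n a k := by
  induction l with
  | zero => rfl
  | succ l ih => rw [← add_assoc, rows, ih, rows, List.append_assoc, add_assoc]

theorem rows_congr {H H' : Grid} {n a k : ℕ}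
    (h : ∀ i j, a ≤ i → i < a + k → j < n → H i j = H' i j) :
    rows H n a k = rows H' n a k := by
  induction k with
  | zero => rfl
  | succ k ih =>
    rw [rows, rows, ih fun i j h1 h2 => h i j h1 (by omega),
      line_congr (h (a + k) · (by omega) (by omega))]

theorem rows_one (H : Grid) (n a : ℕ) : rows H n a 1 = line (H a) n := by simp [rows]

theorem eqv_move_list (a b : PWord) (h : ∀ x ∈ b, ∀ w ∈ a, Far w x) : Eqv (a ++ b) (b ++ a) := by
  induction b with
  | nil => simpa using Eqv.refl a
  | cons x b ih =>
    have h1 := (eqv_move x a (h x List.mem_cons_self)).append_right b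
    have h2 := (ih fun t ht => h t (List.mem_cons_of_mem _ ht)).cons x
    simp only [List.append_assoc, List.cons_append, List.nil_append] at h1 h2 ⊢
    exact h1.trans h2

/-- The row and column reading words are equivalent. -/
theorem rows_tr {G : Grid} {n k : ℕ}
    (hG : ∀ i j i' j' x w, i < i' → j < j' → j' < n → i' < k → G i j = some x →
      G i' j' = some w → Far x w) :
    Eqv (rows G n 0 k) (rows (tr G) k 0 n).reverse := by
  induction n with
  | zero =>
    have : rows G 0 0 k = [] := by
      rw [List.eq_nil_iff_forall_not_mem]; intro x hx
      obtain ⟨i, j, h⟩ := mem_rows.1 hx; omega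
    rw [this]; exact Eqv.refl _
  | succ n ih =>
    have key : ∀ l ≤ k, Eqv (rows G (n + 1) 0 l) (rows G n 0 l ++ (line (tr G n) l).reverse) := by
      intro l
      induction l with
      | zero => intro; exact Eqv.refl _
      | succ l ihl =>
        intro hl
        have h1 := (ihl (by omega)).append_left (line (G (0 + l)) (n + 1))
        have h2 := ((eqv_move_list (rows G n 0 l) (G l n).toList (by
          intro x hx w hw
          obtain ⟨i, j, -, h2, h3, e⟩ := mem_rows.1 hw
          exact hG i j l n w x (by omega) h3 (by omega) (by omega) e (by simpa using hx))).symm.append_left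
            (line (G (0 + l)) n)).append_right (line (tr G n) l).reverse
        rw [rows, rows, line_succ (tr G n)]
        refine h1.trans ?_
        rw [line_succ]
        simp only [zero_add, List.append_assoc, List.reverse_append] at h2 ⊢
        have h3 : ((tr G n l).toList).reverse = (G l n).toList := by
          unfold tr; cases G l n <;> rfl
        rw [h3]
        exact h2
    have h1 := key k le_rfl
    refine h1.trans ?_
    rw [rows, List.reverse_append, zero_add]
    exact (ih fun i j i' j' x w h1 h2 h3 => hG i j i' j' x w h1 h2 (by omega)).append_right _

/-- The word of a grid with a letter waiting to be inserted into line `s`. -/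
def cw (H : Grid) (n s : ℕ) (w : Letter) : PWord :=
  rows H n s (n - s) ++ w :: rows H n 0 s

theorem cw_start {H : Grid} {n s : ℕ} {w : Letter} (hs : s < n) :
    cw H n s w = rows H n (s + 1) (n - (s + 1)) ++ (line (H s) n ++ [w]) ++ rows H n 0 s := by
  have h : n - s = 1 + (n - (s + 1)) := by omega
  rw [cw, h, rows_append, rows_one]
  simp

theorem cw_succ {H : Grid} {n s : ℕ} {w : Letter} :
    cw H n (s + 1) w = rows H n (s + 1) (n - (s + 1)) ++ (w :: line (H s) n) ++ rows H n 0 s := by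
  rw [cw, rows, zero_add]
  simp

theorem cw_step {H H' : Grid} {n s : ℕ} {w w' : Letter} (hs : s < n)
    (h : Eqv (line (H s) n ++ [w]) (w' :: line (H' s) n)) (hH : ∀ i ≠ s, H i = H' i) :
    Eqv (cw H n s w) (cw H' n (s + 1) w') := by
  rw [cw_start hs, cw_succ]
  have h1 : rows H n (s + 1) (n - (s + 1)) = rows H' n (s + 1) (n - (s + 1)) :=
    rows_congr fun i j h1 h2 _ => by rw [hH i (by omega)]
  have h2 : rows H n 0 s = rows H' n 0 s :=
    rows_congr fun i j h1 h2 _ => by rw [hH i (by omega)]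
  rw [h1, h2]
  exact (h.append_left _).append_right _

/-- Replace the entry in box `(i, j)`. -/
def setG (G : Grid) (i j : ℕ) (x : Option Letter) : Grid :=
  fun a b => if a = i ∧ b = j then x else G a b

theorem setG_same (G : Grid) (i j : ℕ) (x : Option Letter) : setG G i j x i j = x := by
  simp [setG]

theorem setG_of_ne {G : Grid} {i j a b : ℕ} (x : Option Letter) (h : a ≠ i ∨ b ≠ j) :
    setG G i j x a b = G a b := by
  unfold setG; rw [if_neg]; omega

theorem cw_bump {H : Grid} {n s p : ℕ} {w m : Letter} (hs : s < n) (hp : p < n)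
    (hL : LInc (H s)) (hm : H s p = some m) (hw : w.ceil < m.ceil)
    (hlt : ∀ j x, j < p → H s j = some x → x.ceil < w.ceil) :
    Eqv (cw H n s w) (cw (setG H s p (some w)) n (s + 1) m) := by
  apply cw_step hs
  · rw [line_split (H s) hp, line_split (setG H s p (some w) s) hp, hm, setG_same]
    rw [line_congr (f := setG H s p (some w) s) (g := H s)
      fun j hj => setG_of_ne _ (Or.inr (by omega)),
      tailLine_congr (f := setG H s p (some w) s) (g := H s)
      fun j hj => setG_of_ne _ (Or.inr (by omega))]
    have := eqv_bump (line (H s) p) (tailLine (H s) p n) m w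
      (fun a ha => by obtain ⟨j, hj, e⟩ := mem_line.1 ha; exact hlt j a hj e)
      (fun a ha => by obtain ⟨j, hj, -, e⟩ := mem_tailLine.1 ha; exact hL p j m a hj hm e) hw
    simpa using this
  · intro i hi; funext j; exact (setG_of_ne _ (Or.inl hi)).symm

theorem cw_pass {H : Grid} {n s p : ℕ} {w : ℤ} {a q : Bool} (hs : s < n) (hp : p + 1 < n)
    (hL : LInc (H s)) (hm : H s p = some ⟨w, a⟩) (hM : H s (p + 1) = some ⟨w + 1, false⟩) :
    Eqv (cw H n s ⟨w, q⟩)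
      (cw (setG (setG H s p (some ⟨w, false⟩)) s (p + 1) (some ⟨w + 1, a⟩)) n (s + 1)
        ⟨w + 1, q⟩) := by
  apply cw_step hs
  · set H' := setG (setG H s p (some ⟨w, false⟩)) s (p + 1) (some ⟨w + 1, a⟩) with hH'
    have e1 : H' s p = some ⟨w, false⟩ := by
      rw [hH', setG_of_ne _ (Or.inr (by omega)), setG_same]
    have e2 : H' s (p + 1) = some ⟨w + 1, a⟩ := setG_same _ _ _ _
    rw [line_split (H s) (show p < n by omega), line_split (H' s) (show p < n by omega), hm,
      tailLine_head hp, hM, tailLine_head hp, e1, e2]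
    rw [line_congr (f := H' s) (g := H s)
      fun j hj => by
        rw [hH', setG_of_ne _ (Or.inr (by omega)), setG_of_ne _ (Or.inr (by omega))],
      tailLine_congr (f := H' s) (g := H s)
      fun j hj => by
        rw [hH', setG_of_ne _ (Or.inr (by omega)), setG_of_ne _ (Or.inr (by omega))]]
    have := eqv_pass (line (H s) p) (tailLine (H s) (p + 1) n) w a q
      (fun x ha => by obtain ⟨j, hj, e⟩ := mem_line.1 ha; exact hL j p _ _ hj e hm)
      (fun x ha => by
        obtain ⟨j, hj, -, e⟩ := mem_tailLine.1 ha; exact hL (p + 1) j _ _ hj hM e)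
    simpa using this
  · intro i hi; funext j
    rw [setG_of_ne _ (Or.inl hi), setG_of_ne _ (Or.inl hi)]

theorem cw_end {H : Grid} {n s e : ℕ} {w : Letter} (hs : s < n) (he : e < n)
    (hn : ∀ j, e ≤ j → H s j = none) :
    cw H n s w = rows (setG H s e (some w)) n 0 n := by
  set H' := setG H s e (some w) with hH'
  have hH : ∀ i ≠ s, H i = H' i := fun i hi => by
    funext j; exact (setG_of_ne _ (Or.inl hi)).symm
  have h : n = s + (1 + (n - (s + 1))) := by omega
  conv_rhs => rw [show rows H' n 0 n = rows H' n 0 (s + (1 + (n - (s + 1)))) from by rw [← h]]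
  rw [cw_start hs, rows_append, rows_append, rows_one]
  have h1 : rows H n (s + 1) (n - (s + 1)) = rows H' n (s + 1) (n - (s + 1)) :=
    rows_congr fun i j h1 h2 _ => by rw [hH i (by omega)]
  have h2 : rows H n 0 s = rows H' n 0 s :=
    rows_congr fun i j h1 h2 _ => by rw [hH i (by omega)]
  rw [h1, h2, zero_add]
  congr 2
  rw [line_split (H' s) he, hH', setG_same, line_extend (k := n) he.le hn]
  congr 1
  · exact line_congr fun j hj => (setG_of_ne _ (Or.inr (by omega))).symm
  · have : tailLine (setG H s e (some w) s) e n = [] := by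
      rw [List.eq_nil_iff_forall_not_mem]
      intro x hx
      obtain ⟨j, hj, -, e'⟩ := mem_tailLine.1 hx
      rw [setG_of_ne _ (Or.inr (by omega)), hn j (by omega)] at e'
      cases e'
    rw [this]; rfl

theorem cw_zero (H : Grid) (n : ℕ) (w : Letter) : cw H n 0 w = rows H n 0 n ++ [w] := by
  simp [cw, rows]

/-- All entries lie in the first `n` lines and positions. -/
def Bnd (n : ℕ) (H : Grid) : Prop := ∀ i j, n ≤ i ∨ n ≤ j → H i j = none

theorem rows_extend {H : Grid} {n n' a k : ℕ} (hH : Bnd n H) (h : n ≤ n') :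
    rows H n' a k = rows H n a k := by
  induction k with
  | zero => rfl
  | succ k ih => rw [rows, rows, ih, line_extend h fun j hj => hH _ j (Or.inr hj)]

theorem rows_beyond {H : Grid} {n m a k : ℕ} (hH : Bnd n H) (h : n ≤ a) :
    rows H m a k = [] := by
  rw [List.eq_nil_iff_forall_not_mem]
  intro x hx
  obtain ⟨i, j, h1, h2, h3, e⟩ := mem_rows.1 hx
  rw [hH i j (by omega)] at e; cases e

theorem rows_total {H : Grid} {n n' : ℕ} (hH : Bnd n H) (h : n ≤ n') :
    rows H n' 0 n' = rows H n 0 n := by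
  rw [rows_extend hH h, show n' = n + (n' - n) by omega, rows_append,
    rows_beyond hH (by omega)]
  rfl

theorem cw_extend {H : Grid} {n n' s : ℕ} {w : Letter} (hH : Bnd n H) (h : n ≤ n') (hs : s ≤ n) :
    cw H n' s w = cw H n s w := by
  rw [cw, cw, rows_extend hH h, rows_extend hH h, show n' - s = (n - s) + (n' - n) by omega,
    rows_append, rows_beyond hH (by omega)]
  rfl

/-- Strict increase on a shifted diagram, with no primes on the diagonal. -/
structure Tab (G : Grid) : Prop where
  supp : ∀ i j x, G i j = some x → i ≤ j
  left : ∀ i j x, i ≤ j → G i (j + 1) = some x → ∃ w, G i j = some w ∧ w.ceil < x.ceil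
  down : ∀ i j x, G (i + 1) j = some x → ∃ w, G i j = some w ∧ w.ceil < x.ceil
  diag : ∀ i x, G i i = some x → x.primed = false

theorem Tab.dist {G : Grid} (h : Tab G) {i j a b : ℕ} {y : Letter} (e : G (i + a) (j + b) = some y)
    (hij : i ≤ j) : ∃ x, G i j = some x ∧ x.ceil + a + b ≤ y.ceil := by
  have h1 : ∃ x, G i (j + b) = some x ∧ x.ceil + a ≤ y.ceil := by
    induction a generalizing y with
    | zero => exact ⟨y, e, by simp⟩
    | succ a ih =>
      obtain ⟨w, hw, hlt⟩ := h.down (i + a) _ _ e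
      obtain ⟨x, hx, hle⟩ := ih hw
      exact ⟨x, hx, by push_cast; omega⟩
  obtain ⟨y', h1, h2⟩ := h1
  clear e
  induction b generalizing y' with
  | zero => exact ⟨y', h1, by simpa using h2⟩
  | succ b ih =>
    obtain ⟨w, hw, hlt⟩ := h.left i (j + b) _ (by omega) h1
    obtain ⟨x, hx, hle⟩ := ih w hw (by omega)
    refine ⟨x, hx, ?_⟩
    have : ∀ x, G i j = some x → x.ceil + (b : ℤ) ≤ w.ceil := by
      clear ih hle hx h1 h2
      intro x hx
      induction b generalizing w y' with
      | zero => simp at hw; rw [hw] at hx; cases hx; simp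
      | succ b ih =>
        obtain ⟨w', hw', hlt'⟩ := h.left i (j + b) _ (by omega) hw
        have := ih w w' hw' hlt'
        push_cast; omega
    have := this x hx
    push_cast; omega

theorem Tab.le {G : Grid} (h : Tab G) {i j i' j' : ℕ} {y : Letter} (e : G i' j' = some y)
    (hi : i ≤ i') (hj : j ≤ j') (hij : i ≤ j) :
    ∃ x, G i j = some x ∧ x.ceil + (i' - i : ℕ) + (j' - j : ℕ) ≤ y.ceil :=
  h.dist (by rw [Nat.add_sub_cancel' hi, Nat.add_sub_cancel' hj]; exact e) hij

theorem Tab.lt {G : Grid} (h : Tab G) {i j i' j' : ℕ} {x y : Letter} (ex : G i j = some x)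
    (e : G i' j' = some y) (hi : i ≤ i') (hj : j ≤ j') :
    x.ceil + (i' - i : ℕ) + (j' - j : ℕ) ≤ y.ceil := by
  obtain ⟨x', h1, h2⟩ := h.le e hi hj (h.supp _ _ _ ex)
  rw [ex] at h1; cases h1; exact h2

theorem Tab.row {G : Grid} (h : Tab G) (s : ℕ) : LInc (G s) := fun i j x w hij hx hw => by
  have := h.lt hx hw le_rfl hij.le; omega

theorem Tab.col {G : Grid} (h : Tab G) (s : ℕ) : LInc (tr G s) := fun i j x w hij hx hw => by
  have := h.lt (i := i) (j := s) hx (i' := j) (j' := s) hw hij.le le_rfl; omega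

theorem not_builds_three {a b c : Letter} {r : PWord} {z : ℤ → ℤ}
    (h : Builds (a :: b :: c :: r) z) (e : a.ceil = c.ceil) : False := by
  have h1 := builds_swap _ _ _ _ h
  have h2 : Builds ([⟨b.ceil, false⟩] ++ [⟨a.ceil, b.primed⟩, c] ++ r) z := h1
  exact Red.ne ⟨_, _, z, Or.inl h2⟩ e

theorem builds_four_fwd {x : ℤ} {p : Bool} {r : PWord} {z : ℤ → ℤ}
    (h : Builds (⟨x + 2, false⟩ :: ⟨x + 1, p⟩ :: ⟨x, false⟩ :: ⟨x + 1, false⟩ :: r) z) :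
    p = false ∧
      Builds (⟨x, false⟩ :: ⟨x + 1, false⟩ :: ⟨x + 2, false⟩ :: ⟨x + 1, false⟩ :: r) z := by
  have h1 := builds_swap _ _ _ _ h
  have h2 := ((Eqv.comm [⟨x + 1, false⟩] (⟨x + 1, false⟩ :: r) ⟨x + 2, p⟩ ⟨x, false⟩
    (by simp)).wEq.builds z).1 h1
  have h3 := builds_swap _ _ _ _ h2
  have h4 : Red [⟨x + 1, false⟩, ⟨x + 2, p⟩, ⟨x + 1, false⟩] :=
    ⟨[⟨x, false⟩], r, z, Or.inl h3⟩
  have h5 := h4.mid rfl (Or.inl (by simp; ring))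
  simp only at h5
  subst h5
  exact ⟨rfl, h3⟩

theorem builds_four_bwd {x : ℤ} {p : Bool} {r : PWord} {z : ℤ → ℤ}
    (h : Builds (⟨x, false⟩ :: ⟨x + 1, p⟩ :: ⟨x + 2, false⟩ :: ⟨x + 1, false⟩ :: r) z) :
    p = false ∧
      Builds (⟨x + 2, false⟩ :: ⟨x + 1, false⟩ :: ⟨x, false⟩ :: ⟨x + 1, false⟩ :: r) z := by
  have h1 := builds_swap _ _ _ _ h
  have h2 := ((Eqv.comm [⟨x + 1, false⟩] (⟨x + 1, false⟩ :: r) ⟨x, p⟩ ⟨x + 2, false⟩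
    (by simp)).wEq.builds z).1 h1
  have h3 := builds_swap _ _ _ _ h2
  have h4 : Red [⟨x + 1, false⟩, ⟨x, p⟩, ⟨x + 1, false⟩] :=
    ⟨[⟨x + 2, false⟩], r, z, Or.inl h3⟩
  have h5 := h4.mid rfl (Or.inr rfl)
  simp only at h5
  subst h5
  exact ⟨rfl, h3⟩

/-- Entries of `G` which are strictly comparable in both directions commute. -/
def SepG (G : Grid) : Prop := ∀ i j i' j' x w, i < i' → j < j' → G i j = some x →
  G i' j' = some w → Far x w

theorem Tab.sepG {G : Grid} (h : Tab G) : SepG G := fun i j i' j' x w hi hj hx hw => by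
  have := h.lt hx hw hi.le hj.le
  unfold Far; omega

theorem SepG.erase {G : Grid} (h : SepG G) (i j : ℕ) : SepG (setG G i j none) := by
  intro a b a' b' x w h1 h2 h3 h4
  unfold setG at h3 h4
  split_ifs at h3 h4
  exact h a b a' b' x w h1 h2 h3 h4

theorem line_none {f : ℕ → Option Letter} {n : ℕ} (h : ∀ j < n, f j = none) : line f n = [] := by
  rw [List.eq_nil_iff_forall_not_mem]
  intro x hx
  obtain ⟨j, hj, e⟩ := mem_line.1 hx
  rw [h j hj] at e; cases e

theorem tailLine_none {f : ℕ → Option Letter} {p n : ℕ} (h : ∀ j, p < j → f j = none) :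
    tailLine f p n = [] := by
  rw [List.eq_nil_iff_forall_not_mem]
  intro x hx
  obtain ⟨j, hj, -, e⟩ := mem_tailLine.1 hx
  rw [h j hj] at e; cases e

theorem cw_split {H : Grid} {n s : ℕ} {w : Letter} :
    cw H n (s + 1) w = rows H n (s + 1) (n - (s + 1)) ++ (w :: (line (H s) n ++ rows H n 0 s)) := by
  rw [cw_succ]; simp

theorem rows_split {H : Grid} {n s : ℕ} (hs : s < n) :
    rows H n 0 n = rows H n (s + 1) (n - (s + 1)) ++ (line (H s) n ++ rows H n 0 s) := by
  have h : n = s + (1 + (n - (s + 1))) := by omega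
  rw [show rows H n 0 n = rows H n 0 (s + (1 + (n - (s + 1)))) from by rw [← h],
    rows_append, rows_append, rows_one]
  simp

theorem builds_switch {G : Grid} {n s : ℕ} {x m : ℤ} {p q : Bool} {z : ℤ → ℤ} (hG : Tab G)
    (hs : s < n) (hx : G s s = some ⟨x, false⟩) (hm : x < m)
    (hz : ∀ y, G (s + 1) (s + 1) = some y → m + 2 ≤ y.ceil) :
    Builds (cw (setG G s s (some ⟨x, q⟩)) n (s + 1) ⟨m, p⟩) z ↔
      Builds (cw (tr G) n (s + 1) ⟨m, q⟩).reverse z := by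
  set K := setG G s s none with hK
  have e1 : Eqv (cw (setG G s s (some ⟨x, q⟩)) n (s + 1) ⟨m, p⟩)
      (⟨m, p⟩ :: ⟨x, q⟩ :: rows K n 0 n) := by
    set A := setG G s s (some ⟨x, q⟩) with hA
    have a1 : rows A n (s + 1) (n - (s + 1)) = rows K n (s + 1) (n - (s + 1)) :=
      rows_congr fun i j _ _ _ => by
        rw [hA, hK, setG_of_ne _ (by omega), setG_of_ne _ (by omega)]
    have a2 : rows A n 0 s = rows K n 0 s := rows_congr fun i j _ _ _ => by
        rw [hA, hK, setG_of_ne _ (by omega), setG_of_ne _ (by omega)]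
    have a3 : line (A s) s = [] := line_none fun j hj => by
      rw [hA, setG_of_ne _ (by omega)]
      by_contra hne
      obtain ⟨y, hy⟩ := Option.ne_none_iff_exists'.1 hne
      have := hG.supp _ _ _ hy; omega
    have a4 : line (K s) s = [] := by
      rw [← a3]; exact line_congr fun j hj => by
        rw [hA, hK, setG_of_ne _ (by omega), setG_of_ne _ (by omega)]
    have a5 : tailLine (A s) s n = tailLine (K s) s n := tailLine_congr fun j hj => by
        rw [hA, hK, setG_of_ne _ (by omega), setG_of_ne _ (by omega)]
    have a6 : A s s = some ⟨x, q⟩ := setG_same _ _ _ _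
    have a7 : K s s = none := setG_same _ _ _ _
    rw [cw_split, rows_split hs, a1, a2, line_split (A s) hs, line_split (K s) hs, a3, a4, a5, a6,
      a7]
    have := (eqv_move_list (rows K n (s + 1) (n - (s + 1))) [⟨m, p⟩, ⟨x, q⟩] (by
      intro y hy w hw
      obtain ⟨i, j, h1, h2, h3, e⟩ := mem_rows.1 hw
      rw [hK, setG_of_ne _ (by omega)] at e
      obtain ⟨y1, h4, h5⟩ := hG.le e h1 (h1.trans (hG.supp _ _ _ e)) le_rfl
      have := hz _ h4
      unfold Far
      simp only [List.mem_cons, List.not_mem_nil, or_false] at hy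
      rcases hy with rfl | rfl <;> simp only <;> omega)).append_right
        (tailLine (K s) s n ++ rows K n 0 s)
    simpa using this
  have e2 : Eqv (cw (tr G) n (s + 1) ⟨m, q⟩)
      (rows (tr K) n 0 n ++ [⟨m, q⟩, ⟨x, false⟩]) := by
    have a1 : rows (tr G) n (s + 1) (n - (s + 1)) = rows (tr K) n (s + 1) (n - (s + 1)) :=
      rows_congr fun i j _ _ _ => by
        rw [tr, tr, hK, setG_of_ne _ (by omega)]
    have a2 : rows (tr G) n 0 s = rows (tr K) n 0 s := rows_congr fun i j _ _ _ => by
        rw [tr, tr, hK, setG_of_ne _ (by omega)]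
    have a3 : line (tr G s) s = line (tr K s) s := line_congr fun j hj => by
        rw [tr, tr, hK, setG_of_ne _ (by omega)]
    have a4 : tailLine (tr G s) s n = [] := tailLine_none fun j hj => by
      by_contra hne
      obtain ⟨y, hy⟩ := Option.ne_none_iff_exists'.1 hne
      have := hG.supp _ _ _ hy; omega
    have a5 : tailLine (tr K s) s n = [] := by
      rw [← a4]; exact tailLine_congr fun j hj => by
        rw [tr, tr, hK, setG_of_ne _ (by omega)]
    have a6 : tr G s s = some ⟨x, false⟩ := hx
    have a7 : tr K s s = none := setG_same _ _ _ _
    rw [cw_split, rows_split hs, a1, a2, line_split (tr G s) hs, line_split (tr K s) hs, a3, a4,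
      a5, a6, a7]
    have c1 := (eqv_move_list [⟨m, q⟩] (line (tr K s) s) (by
      intro y hy w hw
      obtain ⟨j, hj, e⟩ := mem_line.1 hy
      rw [tr, hK, setG_of_ne _ (by omega)] at e
      have := hG.lt e hx hj.le le_rfl
      unfold Far
      simp only [List.mem_cons, List.not_mem_nil, or_false] at hw
      subst hw; simp only at this ⊢; omega)).append_right ([⟨x, false⟩] ++ rows (tr K) n 0 s)
    have c2 := (eqv_move_list [⟨m, q⟩, ⟨x, false⟩] (rows (tr K) n 0 s) (by
      intro y hy w hw
      obtain ⟨i, j, h1, h2, h3, e⟩ := mem_rows.1 hy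
      rw [tr, hK, setG_of_ne _ (by omega)] at e
      have := hG.supp _ _ _ e
      have := hG.lt e hx (by omega) (by omega)
      unfold Far
      simp only [List.mem_cons, List.not_mem_nil, or_false] at hw
      rcases hw with rfl | rfl <;> simp only at this ⊢ <;> omega)).append_left (line (tr K s) s)
    have := (c1.trans (by simpa using c2)).append_left (rows (tr K) n (s + 1) (n - (s + 1)))
    simpa using this
  have e3 := rows_tr (G := K) (n := n) (k := n) fun i j i' j' x w h1 h2 _ _ =>
    (hG.sepG.erase s s) i j i' j' x w h1 h2
  have e4 : Eqv (⟨x, false⟩ :: ⟨m, q⟩ :: rows K n 0 n) (cw (tr G) n (s + 1) ⟨m, q⟩).reverse := by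
    have := e2.reverse
    simp only [List.reverse_append, List.reverse_cons, List.reverse_nil, List.nil_append,
      List.cons_append] at this
    exact ((e3.cons _).cons _).trans this.symm
  rw [e1.wEq.builds, ← e4.wEq.builds]
  constructor
  · intro h; exact builds_swap _ _ _ _ h
  · intro h; exact builds_first _ _ _ _ _ (builds_swap _ _ _ _ h)

theorem cw_split₂ {H : Grid} {n s : ℕ} {w : Letter} (hs : s + 1 < n) :
    cw H n (s + 1) w = rows H n (s + 2) (n - (s + 2)) ++ (line (H (s + 1)) n ++
      (w :: (line (H s) n ++ rows H n 0 s))) := by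
  rw [cw_split, show n - (s + 1) = 1 + (n - (s + 2)) by omega, rows_append, rows_one]
  simp [add_assoc]

theorem rows_split₂ {H : Grid} {n s : ℕ} (hs : s + 1 < n) :
    rows H n 0 n = rows H n (s + 2) (n - (s + 2)) ++ (line (H (s + 1)) n ++
      (line (H s) n ++ rows H n 0 s)) := by
  rw [rows_split (show s < n by omega), show n - (s + 1) = 1 + (n - (s + 2)) by omega,
    rows_append, rows_one]
  simp [add_assoc]

theorem Tab.none_of_lt {G : Grid} (h : Tab G) {i j : ℕ} (hij : j < i) : G i j = none := by
  by_contra hne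
  obtain ⟨y, hy⟩ := Option.ne_none_iff_exists'.1 hne
  have := h.supp _ _ _ hy; omega

theorem eqv_hook {G : Grid} {n s : ℕ} {x : ℤ} {p : Bool} (hG : Tab G) (hs : s + 1 < n)
    (h1 : G s s = some ⟨x, false⟩) (h2 : G s (s + 1) = some ⟨x + 1, false⟩)
    (h3 : G (s + 1) (s + 1) = some ⟨x + 2, false⟩) :
    ∃ R, Eqv (cw G n (s + 1) ⟨x + 1, p⟩)
        (⟨x + 2, false⟩ :: ⟨x + 1, p⟩ :: ⟨x, false⟩ :: ⟨x + 1, false⟩ :: R) ∧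
      Eqv (cw (tr G) n (s + 1) ⟨x + 1, p⟩).reverse
        (⟨x, false⟩ :: ⟨x + 1, p⟩ :: ⟨x + 2, false⟩ :: ⟨x + 1, false⟩ :: R) := by
  set K := setG (setG (setG G s s none) s (s + 1) none) (s + 1) (s + 1) none with hK
  have hKG : ∀ i j, (i ≠ s ∨ (j ≠ s ∧ j ≠ s + 1)) → (i ≠ s + 1 ∨ j ≠ s + 1) → K i j = G i j := by
    intro i j _ _
    rw [hK, setG_of_ne _ (by omega), setG_of_ne _ (by omega), setG_of_ne _ (by omega)]
  have k1 : K s s = none := by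
    rw [hK, setG_of_ne _ (by omega), setG_of_ne _ (by omega), setG_same]
  have k2 : K s (s + 1) = none := by rw [hK, setG_of_ne _ (by omega), setG_same]
  have k3 : K (s + 1) (s + 1) = none := setG_same _ _ _ _
  have hsep : SepG K := ((hG.sepG.erase s s).erase s (s + 1)).erase (s + 1) (s + 1)
  refine ⟨rows K n 0 n, ?_, ?_⟩
  · have a1 : rows G n (s + 2) (n - (s + 2)) = rows K n (s + 2) (n - (s + 2)) :=
      rows_congr fun i j _ _ _ => (hKG i j (by omega) (by omega)).symm
    have a2 : rows G n 0 s = rows K n 0 s :=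
      rows_congr fun i j _ _ _ => (hKG i j (by omega) (by omega)).symm
    have a3 : line (G s) s = [] := line_none fun j hj => hG.none_of_lt hj
    have a4 : line (K s) s = [] := by
      rw [← a3]; exact line_congr fun j hj => hKG _ _ (by omega) (by omega)
    have a5 : line (G (s + 1)) (s + 1) = [] := line_none fun j hj => hG.none_of_lt hj
    have a6 : line (K (s + 1)) (s + 1) = [] := by
      rw [← a5]
      exact line_congr fun j hj => hKG _ _ (by omega) (by omega)
    have a7 : tailLine (G s) (s + 1) n = tailLine (K s) (s + 1) n :=
      tailLine_congr fun j hj => (hKG _ _ (by omega) (by omega)).symm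
    have a8 : tailLine (G (s + 1)) (s + 1) n = tailLine (K (s + 1)) (s + 1) n :=
      tailLine_congr fun j hj => (hKG _ _ (by omega) (by omega)).symm
    rw [cw_split₂ hs, rows_split₂ hs, a1, a2, line_split (G s) (show s < n by omega),
      line_split (K s) (show s < n by omega), line_split (G (s + 1)) hs, line_split (K (s + 1)) hs,
      tailLine_head hs, tailLine_head hs, a3, a4, a5, a6, a7, a8, h1, h2, h3, k1, k2, k3]
    have far : ∀ i j w, s + 1 ≤ i → s + 2 ≤ j → G i j = some w → x + 3 ≤ w.ceil := by
      intro i j w hi hj e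
      have := hG.lt h3 e hi (by omega)
      simp only at this; omega
    have c1 := (eqv_move_list (tailLine (K (s + 1)) (s + 1) n)
      [⟨x + 1, p⟩, ⟨x, false⟩, ⟨x + 1, false⟩] (by
        intro y hy w hw
        obtain ⟨j, hj, -, e⟩ := mem_tailLine.1 hw
        rw [hKG _ _ (by omega) (by omega)] at e
        have := far _ _ _ le_rfl hj e
        unfold Far
        simp only [List.mem_cons, List.not_mem_nil, or_false] at hy
        rcases hy with rfl | rfl | rfl <;> simp only <;> omega)).append_right
      (tailLine (K s) (s + 1) n ++ rows K n 0 s)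
    have c2 := (eqv_move_list (rows K n (s + 2) (n - (s + 2)))
      [⟨x + 2, false⟩, ⟨x + 1, p⟩, ⟨x, false⟩, ⟨x + 1, false⟩] (by
        intro y hy w hw
        obtain ⟨i, j, g1, g2, -, e⟩ := mem_rows.1 hw
        rw [hKG _ _ (by omega) (by omega)] at e
        have := hG.supp _ _ _ e
        have := hG.lt h3 e (by omega) (by omega)
        unfold Far
        simp only [List.mem_cons, List.not_mem_nil, or_false] at hy
        rcases hy with rfl | rfl | rfl | rfl <;> simp only at this ⊢ <;> omega)).append_right
      (tailLine (K (s + 1)) (s + 1) n ++ tailLine (K s) (s + 1) n ++ rows K n 0 s)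
    have := (c1.append_left (rows K n (s + 2) (n - (s + 2)) ++ [⟨x + 2, false⟩])).trans
      (by simpa using c2)
    simpa using this
  · have a1 : rows (tr G) n (s + 2) (n - (s + 2)) = rows (tr K) n (s + 2) (n - (s + 2)) :=
      rows_congr fun i j _ _ _ => (hKG j i (by omega) (by omega)).symm
    have a2 : rows (tr G) n 0 s = rows (tr K) n 0 s :=
      rows_congr fun i j _ _ _ => (hKG j i (by omega) (by omega)).symm
    have a3 : line (tr G s) s = line (tr K s) s :=
      line_congr fun j hj => (hKG j s (by omega) (by omega)).symm
    have a5 : line (tr G (s + 1)) s = line (tr K (s + 1)) s :=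
      line_congr fun j hj => (hKG j (s + 1) (by omega) (by omega)).symm
    have a7 : tailLine (tr G s) s n = [] := tailLine_none fun j hj => hG.none_of_lt hj
    have a8 : tailLine (tr G (s + 1)) (s + 1) n = [] :=
      tailLine_none fun j hj => hG.none_of_lt hj
    have a9 : tailLine (tr K s) s n = [] := by
      rw [← a7]; exact tailLine_congr fun j hj => hKG j s (by omega) (by omega)
    have a10 : tailLine (tr K (s + 1)) (s + 1) n = [] := by
      rw [← a8]; exact tailLine_congr fun j hj => hKG j (s + 1) (by omega) (by omega)
    have t1 : tr G s s = some ⟨x, false⟩ := h1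
    have t2 : tr G (s + 1) s = some ⟨x + 1, false⟩ := h2
    have t3 : tr G (s + 1) (s + 1) = some ⟨x + 2, false⟩ := h3
    have t4 : tr K s s = none := k1
    have t5 : tr K (s + 1) s = none := k2
    have t6 : tr K (s + 1) (s + 1) = none := k3
    have c1 := (eqv_move_list [⟨x + 1, false⟩, ⟨x + 2, false⟩, ⟨x + 1, p⟩] (line (tr K s) s) (by
        intro y hy w hw
        obtain ⟨j, hj, e⟩ := mem_line.1 hy
        rw [tr, hKG _ _ (by omega) (by omega)] at e
        have := hG.lt e h1 hj.le le_rfl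
        unfold Far
        simp only [List.mem_cons, List.not_mem_nil, or_false] at hw
        rcases hw with rfl | rfl | rfl <;> simp only at this ⊢ <;> omega)).append_right
      ([⟨x, false⟩] ++ rows (tr K) n 0 s)
    have c2 := (eqv_move_list [⟨x + 1, false⟩, ⟨x + 2, false⟩, ⟨x + 1, p⟩, ⟨x, false⟩]
      (rows (tr K) n 0 s) (by
        intro y hy w hw
        obtain ⟨i, j, g1, g2, -, e⟩ := mem_rows.1 hy
        rw [tr, hKG _ _ (by omega) (by omega)] at e
        have := hG.supp _ _ _ e
        have := hG.lt e h1 (by omega) (by omega)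
        unfold Far
        simp only [List.mem_cons, List.not_mem_nil, or_false] at hw
        rcases hw with rfl | rfl | rfl | rfl <;> simp only at this ⊢ <;> omega)).append_left
      (line (tr K s) s)
    have c3 := (c1.trans (by simpa using c2)).append_left
      (rows (tr K) n (s + 2) (n - (s + 2)) ++ line (tr K (s + 1)) s)
    have c4 : Eqv (cw (tr G) n (s + 1) ⟨x + 1, p⟩)
      (rows (tr K) n 0 n ++ [⟨x + 1, false⟩, ⟨x + 2, false⟩, ⟨x + 1, p⟩, ⟨x, false⟩]) := by
      rw [cw_split₂ hs, rows_split₂ hs, a1, a2, line_split (tr G s) (show s < n by omega),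
        line_split (tr K s) (show s < n by omega), line_split (tr G (s + 1)) hs,
        line_split (tr K (s + 1)) hs, line_succ, line_succ, a3, a5, a7, a8, a9, a10, t1, t2, t3,
        t4, t5, t6]
      simpa using c3
    have c5 := c4.reverse
    have e3 := rows_tr (G := K) (n := n) (k := n) fun i j i' j' x w h1 h2 _ _ =>
      hsep i j i' j' x w h1 h2
    simp only [List.reverse_append, List.reverse_cons, List.reverse_nil, List.nil_append,
      List.cons_append] at c5
    exact c5.trans ((((e3.symm.cons _).cons _).cons _).cons _)

/-- A letter passing through the corner of a hook whose fourth box is absent is impossible. -/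
theorem not_builds_corner {G : Grid} {n s : ℕ} {x : ℤ} {p q r : Bool} {z : ℤ → ℤ} (hG : Tab G)
    (hs : s + 1 < n) (h1 : G s s = some ⟨x, r⟩) (h2 : G s (s + 1) = some ⟨x + 1, q⟩)
    (h3 : ∀ w, G (s + 1) (s + 1) = some w → x + 3 ≤ w.ceil)
    (h : Builds (cw G n (s + 1) ⟨x + 1, p⟩) z) : False := by
  have a3 : line (G s) s = [] := line_none fun j hj => hG.none_of_lt hj
  rw [cw_split, line_split (G s) (show s < n by omega), tailLine_head hs, a3, h1, h2] at h
  have c := (eqv_move_list (rows G n (s + 1) (n - (s + 1)))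
      [⟨x + 1, p⟩, ⟨x, r⟩, ⟨x + 1, q⟩] (by
        intro y hy w hw
        obtain ⟨i, j, g1, g2, -, e⟩ := mem_rows.1 hw
        obtain ⟨v, hv, hle⟩ := hG.le e g1 (g1.trans (hG.supp _ _ _ e)) le_rfl
        have := h3 v hv
        unfold Far
        simp only [List.mem_cons, List.not_mem_nil, or_false] at hy
        rcases hy with rfl | rfl | rfl <;> simp only <;> omega)).append_right
      (tailLine (G s) (s + 1) n ++ rows G n 0 s)
  have h' := (c.wEq.builds z).1 (by simpa using h)
  simp only [List.reverse_append, List.reverse_cons, List.reverse_nil, List.nil_append,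
    List.cons_append, List.append_assoc] at h'
  exact not_builds_three h' rfl

/-- The analogous statement for columns. -/
theorem not_builds_corner_col {G : Grid} {n s : ℕ} {x : ℤ} {p q r : Bool} {z : ℤ → ℤ}
    (hG : Tab G) (hs : s + 1 < n) (h1 : G (s + 1) (s + 1) = some ⟨x + 1, r⟩)
    (h2 : G s (s + 1) = some ⟨x, q⟩)
    (h3 : ∀ w, G s s = some w → w.ceil + 3 ≤ x + 1)
    (h : Builds (cw (tr G) n (s + 2) ⟨x + 1, p⟩).reverse z) : False := by
  have a3 : tailLine (tr G (s + 1)) (s + 1) n = [] :=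
      tailLine_none fun j hj => hG.none_of_lt hj
  have t1 : tr G (s + 1) (s + 1) = some ⟨x + 1, r⟩ := h1
  have t2 : tr G (s + 1) s = some ⟨x, q⟩ := h2
  rw [cw_split, line_split (tr G (s + 1)) hs, line_succ, t1, t2, a3] at h
  have c1 := (eqv_move_list [⟨x + 1, p⟩] (line (tr G (s + 1)) s) (by
        intro y hy w hw
        obtain ⟨j, hj, e⟩ := mem_line.1 hy
        have := hG.lt (i := j) (j := s + 1) e h2 hj.le le_rfl
        have h4 : (tr G (s + 1) j) = some y := e
        obtain ⟨v, hv, hle⟩ := hG.left j s _ (by omega) e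
        obtain ⟨v', hv', hle'⟩ := hG.left s s _ le_rfl h2
        have := hG.lt hv hv' hj.le le_rfl
        have := h3 _ hv'
        unfold Far
        simp only [List.mem_cons, List.not_mem_nil, or_false] at hw
        subst hw
        simp only at *
        omega)).append_right ([⟨x, q⟩, ⟨x + 1, r⟩] ++ rows (tr G) n 0 (s + 1))
  have c2 := (eqv_move_list [⟨x + 1, p⟩, ⟨x, q⟩, ⟨x + 1, r⟩] (rows (tr G) n 0 (s + 1)) (by
        intro y hy w hw
        obtain ⟨i, j, g1, g2, -, e⟩ := mem_rows.1 hy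
        have := hG.supp _ _ _ e
        obtain ⟨v', hv', hle'⟩ := hG.left s s _ le_rfl h2
        have := hG.lt e hv' (by omega) (by omega)
        have := h3 _ hv'
        unfold Far
        simp only [List.mem_cons, List.not_mem_nil, or_false] at hw
        rcases hw with rfl | rfl | rfl <;> simp only at * <;> omega)).append_left
      (line (tr G (s + 1)) s)
  have c3 := ((c1.trans (by simpa using c2)).append_left
      (rows (tr G) n (s + 2) (n - (s + 2)))).reverse
  have h' := (c3.wEq.builds z).1 (by simpa [add_assoc] using h)
  simp only [List.reverse_append, List.reverse_cons, List.reverse_nil, List.nil_append,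
    List.cons_append, List.append_assoc] at h'
  exact not_builds_three h' rfl

theorem tr_setG (G : Grid) (i j : ℕ) (x : Option Letter) : tr (setG G i j x) = setG (tr G) j i x := by
  funext a b; simp only [tr, setG, and_comm]

theorem Tab.set {G : Grid} (h : Tab G) {i j : ℕ} {w : Letter} (hij : i ≤ j)
    (hl : ∀ p, j = p + 1 → i ≤ p → ∃ x, G i p = some x ∧ x.ceil < w.ceil)
    (hd : ∀ r, i = r + 1 → ∃ x, G r j = some x ∧ x.ceil < w.ceil)
    (hr : ∀ y, G i (j + 1) = some y → w.ceil < y.ceil)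
    (hu : ∀ y, G (i + 1) j = some y → w.ceil < y.ceil)
    (hdiag : i = j → w.primed = false) : Tab (setG G i j (some w)) where
  supp a b x e := by
    unfold setG at e; split_ifs at e with hh
    · omega
    · exact h.supp a b x e
  left a b x hab e := by
    unfold setG at e ⊢
    split_ifs at e with hh
    · obtain ⟨y, hy, hlt⟩ := hl b hh.2.symm (by omega)
      rw [if_neg (by omega), hh.1]
      cases e; exact ⟨y, hy, hlt⟩
    · split_ifs with h2
      · refine ⟨w, rfl, hr x ?_⟩; rw [← h2.1, ← h2.2]; exact e
      · exact h.left a b x hab e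
  down a b x e := by
    unfold setG at e ⊢
    split_ifs at e with hh
    · obtain ⟨y, hy, hlt⟩ := hd a hh.1.symm
      rw [if_neg (by omega), hh.2]
      cases e; exact ⟨y, hy, hlt⟩
    · split_ifs with h2
      · refine ⟨w, rfl, hu x ?_⟩; rw [← h2.1, ← h2.2]; exact e
      · exact h.down a b x e
  diag a x e := by
    unfold setG at e; split_ifs at e with hh
    · cases e; exact hdiag (by omega)
    · exact h.diag a x e

theorem Tab.reprime {G G' : Grid} (h : Tab G)
    (hG : ∀ i j, (G' i j).map Letter.ceil = (G i j).map Letter.ceil)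
    (hdiag : ∀ i x, G' i i = some x → x.primed = false) : Tab G' := by
  have fwd : ∀ i j x, G' i j = some x → ∃ y, G i j = some y ∧ y.ceil = x.ceil := by
    intro i j x e
    have := hG i j
    rw [e] at this
    cases hy : G i j with
    | none => rw [hy] at this; cases this
    | some y => rw [hy] at this; exact ⟨y, rfl, by simpa using this.symm⟩
  have bwd : ∀ i j x, G i j = some x → ∃ y, G' i j = some y ∧ y.ceil = x.ceil := by
    intro i j x e
    have := hG i j
    rw [e] at this
    cases hy : G' i j with
    | none => rw [hy] at this; cases this
    | some y => rw [hy] at this; exact ⟨y, rfl, by simpa using this⟩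
  refine ⟨fun i j x e => ?_, fun i j x hij e => ?_, fun i j x e => ?_, hdiag⟩
  · obtain ⟨y, hy, -⟩ := fwd _ _ _ e; exact h.supp _ _ _ hy
  · obtain ⟨y, hy, e1⟩ := fwd _ _ _ e
    obtain ⟨u, hu, hlt⟩ := h.left _ _ _ hij hy
    obtain ⟨v, hv, e2⟩ := bwd _ _ _ hu
    exact ⟨v, hv, by omega⟩
  · obtain ⟨y, hy, e1⟩ := fwd _ _ _ e
    obtain ⟨u, hu, hlt⟩ := h.down _ _ _ hy
    obtain ⟨v, hv, e2⟩ := bwd _ _ _ hu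
    exact ⟨v, hv, by omega⟩

theorem Bnd.set {n : ℕ} {G : Grid} (h : Bnd n G) {i j : ℕ} (hi : i < n) (hj : j < n)
    (x : Option Letter) : Bnd n (setG G i j x) := fun a b hab => by
  rw [setG_of_ne _ (by omega)]; exact h a b hab

theorem Bnd.lt {n : ℕ} {G : Grid} (h : Bnd n G) {i j : ℕ} {x : Letter} (e : G i j = some x) :
    i < n ∧ j < n := by
  by_contra hc
  rw [h i j (by omega)] at e; cases e

theorem Bnd.mono {n m : ℕ} {G : Grid} (h : Bnd n G) (hm : n ≤ m) : Bnd m G :=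
  fun i j hij => h i j (by omega)

theorem Bnd.tr {n : ℕ} {G : Grid} (h : Bnd n G) : Bnd n (tr G) := fun i j hij => h j i hij.symm

/-- The invariant carried by a letter waiting to be inserted in row (`false`) or column
(`true`) `s`. -/
def CfgInv : Bool → Grid → ℕ → Letter → Prop
  | false, _, 0, _ => True
  | false, G, t + 1, w => ∃ p, t + 1 ≤ p ∧
      ((∃ a, G t p = some a ∧ a.ceil < w.ceil ∧ ∀ b, G (t + 1) p = some b → w.ceil < b.ceil) ∨
        ∃ a b, G t (p + 1) = some a ∧ a.ceil = w.ceil ∧ G (t + 1) p = some b ∧ b.ceil = w.ceil)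
  | true, _, 0, _ => False
  | true, G, t + 1, w => ∃ r, r ≤ t ∧
      ((∃ a, G r t = some a ∧ a.ceil < w.ceil ∧ ∀ b, G r (t + 1) = some b → w.ceil < b.ceil) ∨
        (∃ a b, G (r + 1) t = some a ∧ a.ceil = w.ceil ∧
          G r (t + 1) = some b ∧ b.ceil = w.ceil) ∨
        (G t t = some ⟨w.ceil - 1, false⟩ ∧ G t (t + 1) = some ⟨w.ceil, false⟩ ∧
          G (t + 1) (t + 1) = some ⟨w.ceil + 1, false⟩))

/-- The word of a configuration. -/
def CW : Bool → Grid → ℕ → ℕ → Letter → PWord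
  | false, G, n, s, w => cw G n s w
  | true, G, n, s, w => (cw (tr G) n s w).reverse

structure Ok (z : ℤ → ℤ) (n : ℕ) (c : Bool) (G : Grid) (s : ℕ) (w : Letter) : Prop where
  tab : Tab G
  bnd : Bnd n G
  le : s ≤ n
  inv : CfgInv c G s w
  builds : Builds (CW c G n s w) z

/-- One step of the insertion algorithm, leading from line `s` to line `s + 1`. -/
inductive Nx : Bool → Grid → ℕ → Letter → Bool → Grid → Letter → Prop
  | rbump (G : Grid) (s p : ℕ) (w m : Letter) : s < p → G s p = some m → w.ceil < m.ceil →
      (∀ j x, j < p → G s j = some x → x.ceil < w.ceil) →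
      Nx false G s w false (setG G s p (some w)) m
  | rpass (G : Grid) (s p : ℕ) (w : Letter) (a : Bool) : s < p → G s p = some ⟨w.ceil, a⟩ →
      G s (p + 1) = some ⟨w.ceil + 1, false⟩ →
      Nx false G s w false
        (setG (setG G s p (some ⟨w.ceil, false⟩)) s (p + 1) (some ⟨w.ceil + 1, a⟩))
        ⟨w.ceil + 1, w.primed⟩
  | dbump (G : Grid) (s : ℕ) (w m : Letter) : G s s = some m → w.ceil < m.ceil →
      Nx false G s w true (setG G s s (some ⟨w.ceil, false⟩)) ⟨m.ceil, w.primed⟩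
  | dpass (G : Grid) (s : ℕ) (w : Letter) : G s s = some ⟨w.ceil, false⟩ →
      G s (s + 1) = some ⟨w.ceil + 1, false⟩ →
      Nx false G s w true G ⟨w.ceil + 1, w.primed⟩
  | cbump (G : Grid) (s p : ℕ) (w m : Letter) : p < s → G p s = some m → w.ceil < m.ceil →
      (∀ j x, j < p → G j s = some x → x.ceil < w.ceil) →
      Nx true G s w true (setG G p s (some w)) m
  | cpass (G : Grid) (s p : ℕ) (w : Letter) (a : Bool) : p < s → G p s = some ⟨w.ceil, a⟩ →
      G (p + 1) s = some ⟨w.ceil + 1, false⟩ →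
      Nx true G s w true
        (setG (setG G p s (some ⟨w.ceil, false⟩)) (p + 1) s (some ⟨w.ceil + 1, a⟩))
        ⟨w.ceil + 1, w.primed⟩

/-- The last step of the insertion algorithm. The final parameters are the new box and whether
the insertion ends in column insertion. -/
inductive Fin' : Bool → Grid → ℕ → Letter → Grid → ℕ → ℕ → Bool → Prop
  | rend (G : Grid) (s e : ℕ) (w : Letter) : s < e → (∀ j, e ≤ j → G s j = none) →
      (∀ j, s ≤ j → j < e → ∃ x, G s j = some x ∧ x.ceil < w.ceil) →
      Fin' false G s w (setG G s e (some w)) s e false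
  | dend (G : Grid) (s : ℕ) (w : Letter) : (∀ j, s ≤ j → G s j = none) →
      Fin' false G s w (setG G s s (some ⟨w.ceil, false⟩)) s s w.primed
  | cend (G : Grid) (s e : ℕ) (w : Letter) : e < s → (∀ j, e ≤ j → G j s = none) →
      (∀ j, j < e → ∃ x, G j s = some x ∧ x.ceil < w.ceil) →
      Fin' true G s w (setG G e s (some w)) e s true

theorem rbump_builds {z : ℤ → ℤ} {G : Grid} {n s p : ℕ} {w m : Letter} (hT : Tab G) (hB : Bnd n G)
    (hm : G s p = some m) (hw : w.ceil < m.ceil)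
    (hlt : ∀ j x, j < p → G s j = some x → x.ceil < w.ceil) :
    Builds (cw G n s w) z ↔ Builds (cw (setG G s p (some w)) n (s + 1) m) z :=
  (cw_bump (hB.lt hm).1 (hB.lt hm).2 (hT.row s) hm hw hlt).wEq.builds z

theorem cbump_builds {z : ℤ → ℤ} {G : Grid} {n s p : ℕ} {w m : Letter} (hT : Tab G) (hB : Bnd n G)
    (hm : G p s = some m) (hw : w.ceil < m.ceil)
    (hlt : ∀ j x, j < p → G j s = some x → x.ceil < w.ceil) :
    Builds (cw (tr G) n s w).reverse z ↔
      Builds (cw (tr (setG G p s (some w))) n (s + 1) m).reverse z := by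
  rw [tr_setG]
  exact (cw_bump (hB.lt hm).2 (hB.lt hm).1 (hT.col s) hm hw hlt).reverse.wEq.builds z

theorem rpass_builds {z : ℤ → ℤ} {G : Grid} {n s p : ℕ} {w : ℤ} {a q : Bool} (hT : Tab G)
    (hB : Bnd n G) (hm : G s p = some ⟨w, a⟩) (hM : G s (p + 1) = some ⟨w + 1, false⟩) :
    Builds (cw G n s ⟨w, q⟩) z ↔ Builds (cw (setG (setG G s p (some ⟨w, false⟩)) s (p + 1)
      (some ⟨w + 1, a⟩)) n (s + 1) ⟨w + 1, q⟩) z :=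
  (cw_pass (hB.lt hm).1 (hB.lt hM).2 (hT.row s) hm hM).wEq.builds z

theorem cpass_builds {z : ℤ → ℤ} {G : Grid} {n s p : ℕ} {w : ℤ} {a q : Bool} (hT : Tab G)
    (hB : Bnd n G) (hm : G p s = some ⟨w, a⟩) (hM : G (p + 1) s = some ⟨w + 1, false⟩) :
    Builds (cw (tr G) n s ⟨w, q⟩).reverse z ↔ Builds (cw (tr (setG (setG G p s
      (some ⟨w, false⟩)) (p + 1) s (some ⟨w + 1, a⟩))) n (s + 1) ⟨w + 1, q⟩).reverse z := by
  rw [tr_setG, tr_setG]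
  exact (cw_pass (hB.lt hm).2 (hB.lt hM).1 (hT.col s) hm hM).reverse.wEq.builds z

theorem map_pass {G : Grid} {i j i' j' : ℕ} {x y x' y' : Letter} (h : i ≠ i' ∨ j ≠ j')
    (h1 : G i j = some x) (h2 : G i' j' = some y) (e1 : x'.ceil = x.ceil) (e2 : y'.ceil = y.ceil)
    (a b : ℕ) : (setG (setG G i j (some x')) i' j' (some y') a b).map Letter.ceil =
      (G a b).map Letter.ceil := by
  unfold setG
  split_ifs with ha hb
  · rw [ha.1, ha.2, h2]; simp [e2]
  · rw [hb.1, hb.2, h1]; simp [e1]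
  · rfl

theorem nx_ok {z : ℤ → ℤ} {n : ℕ} {c c' : Bool} {G G' : Grid} {s : ℕ} {w w' : Letter}
    (h : Ok z n c G s w) (hn : Nx c G s w c' G' w') : Ok z n c' G' (s + 1) w' := by
  obtain ⟨hT, hB, hle, hI, hb⟩ := h
  cases hn with
  | rbump _ _ p _ m hsp hm hw hlt =>
    have hbd := hB.lt hm
    refine ⟨hT.set hsp.le ?_ ?_ ?_ ?_ (by omega), hB.set hbd.1 hbd.2 _, hbd.1, ?_,
      (rbump_builds hT hB hm hw hlt).1 hb⟩
    · rintro q rfl hq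
      obtain ⟨x, hx, -⟩ := hT.left _ _ _ hq hm
      exact ⟨x, hx, hlt q x (by omega) hx⟩
    · rintro t rfl
      obtain ⟨p0, hp0, ⟨a, ha, haw, hb'⟩ | ⟨a, b, -, -, hb', hbw⟩⟩ := hI
      · have hpp : p ≤ p0 := by
          by_contra hc
          obtain ⟨x, hx, -⟩ := hT.le hm le_rfl (show p0 ≤ p by omega) hp0
          have := hlt p0 x (by omega) hx
          have := hb' x hx
          omega
        obtain ⟨x, hx, hle⟩ := hT.le ha le_rfl hpp (by omega)
        exact ⟨x, hx, by omega⟩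
      · rcases lt_or_ge p0 p with hc | hc
        · have := hlt p0 b hc hb'; omega
        · have := hT.lt hm hb' le_rfl hc; omega
    · intro y hy; have := hT.lt hm hy le_rfl (by omega); omega
    · intro y hy; have := hT.lt hm hy (by omega) le_rfl; omega
    · refine ⟨p, hsp, Or.inl ⟨w, setG_same _ _ _ _, hw, fun b hb' => ?_⟩⟩
      rw [setG_of_ne _ (by omega)] at hb'
      have := hT.lt hm hb' (by omega) le_rfl; omega
  | rpass _ _ p _ a hsp hm hM =>
    have hbd := hB.lt hm
    have hbd' := hB.lt hM
    refine ⟨hT.reprime (map_pass (by omega) hm hM rfl rfl) ?_,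
      (hB.set hbd.1 hbd.2 _).set hbd'.1 hbd'.2 _, hbd.1, ?_, (rpass_builds hT hB hm hM).1 hb⟩
    · intro i x hx
      rw [setG_of_ne _ (by omega), setG_of_ne _ (by omega)] at hx
      exact hT.diag i x hx
    · refine ⟨p, hsp, ?_⟩
      have e1 : G (s + 1) p = setG (setG G s p (some ⟨w.ceil, false⟩)) s (p + 1)
          (some ⟨w.ceil + 1, a⟩) (s + 1) p := by
        rw [setG_of_ne _ (by omega), setG_of_ne _ (by omega)]
      rw [← e1]
      by_cases hc : ∃ b, G (s + 1) p = some b ∧ b.ceil = w.ceil + 1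
      · obtain ⟨b, hb1, hb2⟩ := hc
        exact Or.inr ⟨⟨w.ceil + 1, a⟩, b, setG_same _ _ _ _, rfl, hb1, hb2⟩
      · refine Or.inl ⟨⟨w.ceil, false⟩, ?_, by simp, fun b hb1 => ?_⟩
        · rw [setG_of_ne _ (by omega), setG_same]
        · have h1 := hT.lt hm hb1 (by omega) le_rfl
          have h2 : b.ceil ≠ w.ceil + 1 := fun e => hc ⟨b, hb1, e⟩
          simp only at h1 ⊢; omega
  | dbump _ _ _ m hm hw =>
    have hbd := hB.lt hm
    have hlt : ∀ j x, j < s → G s j = some x → x.ceil < w.ceil := by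
      intro j x hj e; rw [hT.none_of_lt hj] at e; cases e
    have hT' : Tab (setG G s s (some ⟨w.ceil, false⟩)) := by
      refine hT.set le_rfl ?_ ?_ ?_ ?_ (fun _ => rfl)
      · intro q hq hq'; omega
      · rintro t rfl
        obtain ⟨p0, hp0, ⟨a, ha, haw, hb'⟩ | ⟨a, b, -, -, hb', hbw⟩⟩ := hI
        · obtain ⟨x, hx, hle⟩ := hT.le ha le_rfl hp0 (by omega)
          exact ⟨x, hx, by simp only; omega⟩
        · have := hT.lt hm hb' le_rfl hp0; omega
      · intro y hy; have := hT.lt hm hy le_rfl (by omega); simp only; omega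
      · intro y hy; have := hT.supp _ _ _ hy; omega
    refine ⟨hT', hB.set hbd.1 hbd.2 _, hbd.1, ?_, ?_⟩
    · refine ⟨s, le_rfl, Or.inl ⟨_, setG_same _ _ _ _, hw, fun b hb' => ?_⟩⟩
      rw [setG_of_ne _ (by omega)] at hb'
      have := hT.lt hm hb' le_rfl (by omega); simp only; omega
    · have h1 := (rbump_builds hT hB hm hw hlt).1 hb
      have h2 := builds_switch (p := m.primed) (q := w.primed) (z := z) hT' hbd.1
        (setG_same _ _ _ _) hw (fun y hy => by
          rw [setG_of_ne _ (by omega)] at hy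
          have := hT.lt hm hy (by omega) (by omega); omega)
      refine h2.1 ?_
      have h3 : setG (setG G s s (some ⟨w.ceil, false⟩)) s s (some ⟨w.ceil, w.primed⟩) =
          setG G s s (some w) := by
        funext i j; unfold setG; split_ifs <;> rfl
      rw [h3]; exact h1
  | dpass _ _ _ hm hM =>
    have hbd := hB.lt hM
    have h0 : Builds (cw G n (s + 1) ⟨w.ceil + 1, w.primed⟩) z := by
      have h1 := (rpass_builds hT hB hm hM).1 hb
      have h3 : setG (setG G s s (some ⟨w.ceil, false⟩)) s (s + 1)
          (some ⟨w.ceil + 1, false⟩) = G := by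
        funext i j; unfold setG; split_ifs with h1 h2
        · rw [h1.1, h1.2, hM]
        · rw [h2.1, h2.2, hm]
        · rfl
      rwa [h3] at h1
    have hz : G (s + 1) (s + 1) = some ⟨w.ceil + 2, false⟩ := by
      by_contra hc
      refine not_builds_corner hT hbd.2 hm hM (fun v hv => ?_) h0
      have h1 := hT.lt hM hv (by omega) le_rfl
      have h2 := hT.diag _ _ hv
      by_contra h3
      refine hc (hv.trans ?_)
      obtain ⟨vc, vp⟩ := v
      simp only at h1 h2 h3
      have : vc = w.ceil + 2 := by omega
      rw [h2, this]
    obtain ⟨R, e1, e2⟩ := eqv_hook (p := w.primed) hT hbd.2 hm hM hz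
    obtain ⟨hp, h4⟩ := builds_four_fwd ((e1.wEq.builds z).1 h0)
    refine ⟨hT, hB, by omega, ?_, (e2.wEq.builds z).2 (by rw [hp]; exact h4)⟩
    refine ⟨s, le_rfl, Or.inr (Or.inr ⟨?_, hM, ?_⟩)⟩
    · rw [hm]; simp
    · rw [hz]; simp [add_assoc]
  | cbump _ _ p _ m hsp hm hw hlt =>
    have hbd := hB.lt hm
    obtain ⟨t, rfl⟩ : ∃ t, s = t + 1 := ⟨s - 1, by omega⟩
    refine ⟨hT.set hsp.le ?_ ?_ ?_ ?_ (by omega), hB.set hbd.1 hbd.2 _, hbd.2, ?_,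
      (cbump_builds hT hB hm hw hlt).1 hb⟩
    · intro q hq hq'
      obtain rfl : q = t := by omega
      have contra : ∀ r b, G r (q + 1) = some b → b.ceil = w.ceil → False := by
        intro r b hb' hbw
        rcases lt_or_ge r p with hc | hc
        · have := hlt r b hc hb'; omega
        · have := hT.lt hm hb' hc le_rfl; omega
      obtain ⟨r, hr, ⟨a, ha, haw, hb'⟩ | ⟨a, b, -, -, hb', hbw⟩ | ⟨-, hb', -⟩⟩ := hI
      · have hpp : p ≤ r := by
          by_contra hc
          obtain ⟨x, hx, -⟩ := hT.le hm (show r ≤ p by omega) le_rfl (by omega)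
          have := hlt r x (by omega) hx
          have := hb' x hx
          omega
        obtain ⟨x, hx, hle⟩ := hT.le ha hpp le_rfl hq'
        exact ⟨x, hx, by omega⟩
      · exact (contra _ _ hb' hbw).elim
      · exact (contra _ _ hb' rfl).elim
    · rintro q rfl
      obtain ⟨x, hx, -⟩ := hT.down _ _ _ hm
      exact ⟨x, hx, hlt q x (by omega) hx⟩
    · intro y hy; have := hT.lt hm hy le_rfl (by omega); omega
    · intro y hy; have := hT.lt hm hy (by omega) le_rfl; omega
    · refine ⟨p, hsp.le, Or.inl ⟨w, setG_same _ _ _ _, hw, fun b hb' => ?_⟩⟩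
      rw [setG_of_ne _ (by omega)] at hb'
      have := hT.lt hm hb' le_rfl (by omega); omega
  | cpass _ _ p _ a hsp hm hM =>
    have hbd := hB.lt hm
    have hbd' := hB.lt hM
    have hcorner : p + 1 = s → a = false := by
      rintro rfl
      obtain ⟨r, hr, ⟨x, ha, haw, hb'⟩ | ⟨x, b, ha, -, hb', hbw⟩ | ⟨-, hb', -⟩⟩ := hI
      · obtain ⟨y, hy, hle⟩ := hT.le hm hr le_rfl (by omega)
        have := hb' y hy
        simp only at hle; omega
      · have h1 := hT.supp _ _ _ ha
        have h2 := hT.lt hb' hm hr le_rfl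
        simp only at h2; omega
      · rw [hm] at hb'; simpa using hb'
    refine ⟨hT.reprime (map_pass (by omega) hm hM rfl rfl) ?_,
      (hB.set hbd.1 hbd.2 _).set hbd'.1 hbd'.2 _, hbd.2, ?_, (cpass_builds hT hB hm hM).1 hb⟩
    · intro i x hx
      by_cases hi : i = p + 1 ∧ i = s
      · obtain ⟨rfl, rfl⟩ := hi
        rw [setG_same] at hx; cases hx; exact hcorner rfl
      · rw [setG_of_ne _ (by omega), setG_of_ne _ (by omega)] at hx
        exact hT.diag i x hx
    · refine ⟨p, hsp.le, ?_⟩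
      have e1 : G p (s + 1) = setG (setG G p s (some ⟨w.ceil, false⟩)) (p + 1) s
          (some ⟨w.ceil + 1, a⟩) p (s + 1) := by
        rw [setG_of_ne _ (by omega), setG_of_ne _ (by omega)]
      rw [← e1]
      by_cases hc : ∃ b, G p (s + 1) = some b ∧ b.ceil = w.ceil + 1
      · obtain ⟨b, hb1, hb2⟩ := hc
        exact Or.inr (Or.inl ⟨⟨w.ceil + 1, a⟩, b, setG_same _ _ _ _, rfl, hb1, hb2⟩)
      · refine Or.inl ⟨⟨w.ceil, false⟩, ?_, by simp, fun b hb1 => ?_⟩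
        · rw [setG_of_ne _ (by omega), setG_same]
        · have h1 := hT.lt hm hb1 le_rfl (by omega)
          have h2 : b.ceil ≠ w.ceil + 1 := fun e => hc ⟨b, hb1, e⟩
          simp only at h1 ⊢; omega

theorem Ok.extend {z : ℤ → ℤ} {n m : ℕ} {c : Bool} {G : Grid} {s : ℕ} {w : Letter}
    (h : Ok z n c G s w) (hm : n ≤ m) : Ok z m c G s w := by
  obtain ⟨hT, hB, hle, hI, hb⟩ := h
  refine ⟨hT, hB.mono hm, hle.trans hm, hI, ?_⟩
  cases c
  · simp only [CW] at hb ⊢; rwa [cw_extend hB hm hle]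
  · simp only [CW] at hb ⊢; rwa [cw_extend hB.tr hm hle]

theorem Ok.red {z : ℤ → ℤ} {n : ℕ} {c : Bool} {G : Grid} {s : ℕ} {w : Letter}
    (h : Ok z n c G s w) (hs : s < n) :
    Red (line ((if c then tr G else G) s) n ++ [w]) := by
  have hb := h.builds
  cases c <;> simp only [CW] at hb <;> rw [cw_start hs] at hb
  · exact Red.middle _ _ _ ⟨[], [], z, Or.inl (by simpa using hb)⟩
  · exact Red.middle _ _ _ ⟨[], [], z, Or.inr (by simpa using hb)⟩

theorem red_next {H : ℕ → Option Letter} {n p : ℕ} {m w : Letter} (hL : LInc H)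
    (hr : Red (line H n ++ [w])) (hp : p < n) (hm : H p = some m) (e : m.ceil = w.ceil)
    (hn : ∀ j, p < j → H j = none → H (j + 1) = none) : H (p + 1) = some ⟨w.ceil + 1, false⟩ := by
  rw [line_split H hp, hm] at hr
  have hpw : (m :: tailLine H p n).Pairwise (fun a b => a.ceil < b.ceil) := by
    have := hL.pairwise n
    rw [line_split H hp, hm] at this
    exact (List.pairwise_append.1 this).2.1
  obtain ⟨B', hB'⟩ := Red.pass_fwd (A := line H p) (by simpa using hr) e hpw
  have hmem : (⟨w.ceil + 1, false⟩ : Letter) ∈ tailLine H p n := by rw [hB']; simp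
  obtain ⟨j, hj, hjn, -⟩ := mem_tailLine.1 hmem
  rw [tailLine_head (by omega)] at hB'
  cases hh : H (p + 1) with
  | some x =>
    rw [hh] at hB'; simp at hB'; rw [hB'.1]
  | none =>
    have hall : ∀ k, H (p + 1 + k) = none := by
      intro k
      induction k with
      | zero => exact hh
      | succ k ih => exact hn _ (show p < p + 1 + k by omega) ih
    rw [hh, tailLine_none] at hB'
    · simp at hB'
    · intro j hj
      have := hall (j - (p + 1))
      rwa [show p + 1 + (j - (p + 1)) = j by omega] at this

theorem Tab.none_right {G : Grid} (h : Tab G) {s j k : ℕ} (hs : s ≤ j) (hj : G s j = none)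
    (hk : j ≤ k) : G s k = none := by
  by_contra hne
  obtain ⟨y, hy⟩ := Option.ne_none_iff_exists'.1 hne
  obtain ⟨x, hx, -⟩ := h.le hy le_rfl hk hs
  rw [hj] at hx; cases hx

theorem Tab.none_up {G : Grid} (h : Tab G) {s j k : ℕ} (hj : G j s = none)
    (hk : j ≤ k) : G k s = none := by
  by_contra hne
  obtain ⟨y, hy⟩ := Option.ne_none_iff_exists'.1 hne
  obtain ⟨x, hx, -⟩ := h.le hy hk le_rfl (hk.trans (h.supp _ _ _ hy))
  rw [hj] at hx; cases hx

theorem Ok.step {z : ℤ → ℤ} {n : ℕ} {c : Bool} {G : Grid} {s : ℕ} {w : Letter}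
    (h : Ok z n c G s w) : (∃ c' G' w', Nx c G s w c' G' w') ∨
      ∃ G' r q f, Fin' c G s w G' r q f := by
  have h' := h.extend (Nat.le_succ n)
  have hs : s < n + 1 := by have := h.le; omega
  have hr := h'.red hs
  obtain ⟨hT, hB, hle, hI, -⟩ := h'
  classical
  cases c with
  | false =>
    simp only [Bool.false_eq_true, if_false] at hr
    have hex : ∃ j, s ≤ j ∧ ∀ x, G s j = some x → w.ceil ≤ x.ceil :=
      ⟨s + n + 1, by omega, fun x hx => by rw [hB _ _ (by omega)] at hx; cases hx⟩
    obtain ⟨hsp, hp⟩ := Nat.find_spec hex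
    have hmin : ∀ j, s ≤ j → j < Nat.find hex → ∃ x, G s j = some x ∧ x.ceil < w.ceil := by
      intro j hj hj'
      have := Nat.find_min hex hj'
      push Not at this
      exact this hj
    have hlt : ∀ j x, j < Nat.find hex → G s j = some x → x.ceil < w.ceil := by
      intro j x hj hx
      obtain ⟨x', hx', h2⟩ := hmin j (hT.supp _ _ _ hx) hj
      rw [hx] at hx'; cases hx'; exact h2
    generalize Nat.find hex = p at hsp hp hmin hlt
    cases hm : G s p with
    | none =>
      refine Or.inr ?_
      rcases hsp.lt_or_eq with hc | rfl
      · exact ⟨_, _, _, _, Fin'.rend G s p w hc (fun j hj => hT.none_right hsp hm hj) hmin⟩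
      · exact ⟨_, _, _, _, Fin'.dend G s w (fun j hj => hT.none_right hsp hm hj)⟩
    | some m =>
      left
      rcases (hp m hm).lt_or_eq with hc | hc
      · rcases hsp.lt_or_eq with hs' | rfl
        · exact ⟨_, _, _, Nx.rbump G s p w m hs' hm hc hlt⟩
        · exact ⟨_, _, _, Nx.dbump G s w m hm hc⟩
      · have hM := red_next (hT.row s) hr (hB.lt hm).2 hm hc.symm
          (fun j hj hj' => hT.none_right (by omega) hj' (by omega))
        obtain ⟨mc, mp⟩ := m
        simp only at hc; subst hc
        rcases hsp.lt_or_eq with hs' | rfl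
        · exact ⟨_, _, _, Nx.rpass G s p w mp hs' hm hM⟩
        · obtain rfl : mp = false := hT.diag _ _ hm
          exact ⟨_, _, _, Nx.dpass G s w hm hM⟩
  | true =>
    simp only [if_true] at hr
    cases s with
    | zero => exact hI.elim
    | succ t =>
    have hex : ∃ j, j ≤ t ∧ ∀ x, G j (t + 1) = some x → w.ceil ≤ x.ceil := by
      obtain ⟨r, hr, ⟨a, h1, h2, h3⟩ | ⟨a, b, h1, h2, h3, h4⟩ | ⟨h1, h2, h3⟩⟩ := hI
      · exact ⟨r, hr, fun x hx => (h3 x hx).le⟩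
      · exact ⟨r, hr, fun x hx => by rw [h3] at hx; cases hx; omega⟩
      · exact ⟨t, le_rfl, fun x hx => by rw [h2] at hx; cases hx; exact le_rfl⟩
    obtain ⟨hsp, hp⟩ := Nat.find_spec hex
    have hmin : ∀ j, j < Nat.find hex → ∃ x, G j (t + 1) = some x ∧ x.ceil < w.ceil := by
      intro j hj'
      have := Nat.find_min hex hj'
      push Not at this
      exact this (by omega)
    have hlt : ∀ j x, j < Nat.find hex → G j (t + 1) = some x → x.ceil < w.ceil := by
      intro j x hj hx
      obtain ⟨x', hx', h2⟩ := hmin j hj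
      rw [hx] at hx'; cases hx'; exact h2
    generalize Nat.find hex = p at hsp hp hmin hlt
    cases hm : G p (t + 1) with
    | none =>
      exact Or.inr ⟨_, _, _, _, Fin'.cend G (t + 1) p w (by omega)
        (fun j hj => hT.none_up hm hj) hmin⟩
    | some m =>
      left
      rcases (hp m hm).lt_or_eq with hc | hc
      · exact ⟨_, _, _, Nx.cbump G (t + 1) p w m (by omega) hm hc hlt⟩
      · have hM := red_next (hT.col (t + 1)) hr (hB.lt hm).1 hm hc.symm
          (fun j hj hj' => hT.none_up hj' (by omega))
        obtain ⟨mc, mp⟩ := m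
        simp only at hc; subst hc
        exact ⟨_, _, _, Nx.cpass G (t + 1) p w mp (by omega) hm hM⟩

theorem fin_ok {z : ℤ → ℤ} {n : ℕ} {c f : Bool} {G G' : Grid} {s e₁ e : ℕ} {w : Letter}
    (h : Ok z n c G s w) (hf : Fin' c G s w G' e₁ e f) :
    Tab G' ∧ Bnd (n + 1) G' ∧ Builds (rows G' (n + 1) 0 (n + 1)) z := by
  have h' := h.extend (Nat.le_succ n)
  have hs : s < n + 1 := by have := h.le; omega
  have hB0 := h.bnd
  obtain ⟨hT, hB, hle, hI, hb⟩ := h'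
  have hno : ∀ j x, n ≤ j → ∀ i, G i j = some x → False := by
    intro j x hj i hx; rw [hB0 _ _ (by omega)] at hx; cases hx
  cases hf with
  | rend _ _ _ _ hse hn hlt =>
    have hen : e < n + 1 := by
      by_contra hc
      obtain ⟨x, hx, -⟩ := hlt (e - 1) (by omega) (by omega)
      exact hno _ x (by omega) _ hx
    refine ⟨hT.set hse.le ?_ ?_ ?_ ?_ (by omega), hB.set hs hen _, ?_⟩
    · intro k hk hsk; exact hlt k (by omega) (by omega)
    · rintro t rfl
      obtain ⟨p0, hp0, ⟨a, ha, haw, hb'⟩ | ⟨a, b, ha, haw, hb', hbw⟩⟩ := hI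
      · have : e ≤ p0 := by
          by_contra hc
          obtain ⟨x, hx, h1⟩ := hlt p0 hp0 (by omega)
          have := hb' x hx; omega
        obtain ⟨x, hx, hle⟩ := hT.le ha le_rfl this (by omega)
        exact ⟨x, hx, by omega⟩
      · have : p0 < e := by
          by_contra hc
          rw [hn p0 (by omega)] at hb'; cases hb'
        obtain ⟨x, hx, h1⟩ := hlt p0 hp0 this
        rw [hb'] at hx; cases hx; omega
    · intro y hy; rw [hn _ (by omega)] at hy; cases hy
    · intro y hy; have := hT.none_up (hn e le_rfl) (Nat.le_succ s); rw [this] at hy; cases hy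
    · have := cw_end (w := w) hs hen hn
      rw [← this]; exact hb
  | dend _ _ _ hn =>
    refine ⟨hT.set le_rfl ?_ ?_ ?_ ?_ (fun _ => rfl), hB.set hs hs _, ?_⟩
    · intro k hk hsk; omega
    · rintro t rfl
      obtain ⟨p0, hp0, ⟨a, ha, haw, hb'⟩ | ⟨a, b, ha, haw, hb', hbw⟩⟩ := hI
      · obtain ⟨x, hx, hle⟩ := hT.le ha le_rfl hp0 (by omega)
        exact ⟨x, hx, by simp only; omega⟩
      · rw [hn p0 (by omega)] at hb'; cases hb'
    · intro y hy; rw [hn _ (by omega)] at hy; cases hy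
    · intro y hy; have := hT.none_up (hn s le_rfl) (Nat.le_succ s); rw [this] at hy; cases hy
    · have hn0 : ∀ j, 0 ≤ j → G s j = none := fun j _ => by
        rcases lt_or_ge j s with hc | hc
        · exact hT.none_of_lt hc
        · exact hn j hc
      have e1 := cw_end (w := w) hs hs (fun j hj => hn j hj)
      have e2 := cw_end (w := ⟨w.ceil, false⟩) hs hs (fun j hj => hn j hj)
      rw [← e2]
      have hb2 : Builds (cw G (n + 1) s w) z := hb
      have h0 : rows G (n + 1) s (n + 1 - s) = [] := by
        rw [List.eq_nil_iff_forall_not_mem]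
        intro x hx
        obtain ⟨i, j, hi, -, -, hx⟩ := mem_rows.1 hx
        rcases lt_or_ge j s with hc | hc
        · rw [hT.none_of_lt (show j < i by omega)] at hx; cases hx
        · rw [hT.none_up (hn j hc) hi] at hx; cases hx
      rw [cw, h0, List.nil_append] at hb2 ⊢
      exact builds_first w.ceil w.primed _ _ _ hb2
  | cend _ _ _ _ hes hn hlt =>
    have hen : e₁ < n + 1 := by omega
    have hT' : Tab (setG G e₁ s (some w)) := by
      refine hT.set hes.le ?_ ?_ ?_ ?_ (by omega)
      · rintro k rfl hk
        obtain ⟨r, hr, ⟨a, h1, h2, h3⟩ | ⟨a, b, h1, h2, h3, h4⟩ | ⟨h1, h2, h3⟩⟩ := hI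
        · have : e₁ ≤ r := by
            by_contra hc
            obtain ⟨x, hx, h4⟩ := hlt r (by omega)
            have := h3 x hx; omega
          obtain ⟨x, hx, hle⟩ := hT.le h1 this le_rfl (by omega)
          exact ⟨x, hx, by omega⟩
        · have : r < e₁ := by
            by_contra hc
            rw [hn r (by omega)] at h3; cases h3
          obtain ⟨x, hx, h5⟩ := hlt r this
          rw [h3] at hx; cases hx; omega
        · rw [hn (k + 1) (by omega)] at h3; cases h3
      · rintro t rfl; exact hlt t (by omega)
      · intro y hy; have := hT.none_right hes.le (hn e₁ le_rfl) (Nat.le_succ s)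
        rw [this] at hy; cases hy
      · intro y hy; rw [hn _ (by omega)] at hy; cases hy
    refine ⟨hT', hB.set hen hs _, ?_⟩
    have e1 := cw_end (H := tr G) (w := w) hs hen hn
    have hb2 : Builds (cw (tr G) (n + 1) s w).reverse z := hb
    rw [e1, ← tr_setG] at hb2
    exact ((rows_tr fun i j a b x y h1 h2 _ _ hx hy => hT'.sepG i j a b x y h1 h2 hx hy).wEq.builds z).2 hb2

/-- Inversion of `Nx`. -/
inductive Pv : Bool → Grid → ℕ → Letter → Bool → Grid → Letter → Prop
  | rbump (G : Grid) (s p : ℕ) (w m : Letter) : s < p → G s p = some w → w.ceil < m.ceil →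
      (∀ j x, p < j → G s j = some x → m.ceil < x.ceil) →
      Pv false G s m false (setG G s p (some m)) w
  | rpass (G : Grid) (s p : ℕ) (m : Letter) (a : Bool) : s < p →
      G s p = some ⟨m.ceil - 1, false⟩ → G s (p + 1) = some ⟨m.ceil, a⟩ →
      Pv false G s m false
        (setG (setG G s p (some ⟨m.ceil - 1, a⟩)) s (p + 1) (some ⟨m.ceil, false⟩))
        ⟨m.ceil - 1, m.primed⟩
  | dbump (G : Grid) (s : ℕ) (w m : Letter) : G s s = some w → w.ceil < m.ceil →
      (∀ x, G s (s + 1) = some x → m.ceil < x.ceil) →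
      Pv true G s m false (setG G s s (some ⟨m.ceil, false⟩)) ⟨w.ceil, m.primed⟩
  | dpass (G : Grid) (s : ℕ) (m : Letter) : G s s = some ⟨m.ceil - 1, false⟩ →
      G s (s + 1) = some ⟨m.ceil, false⟩ →
      Pv true G s m false G ⟨m.ceil - 1, m.primed⟩
  | cbump (G : Grid) (s p : ℕ) (w m : Letter) : p < s → G p s = some w → w.ceil < m.ceil →
      (∀ j x, p < j → G j s = some x → m.ceil < x.ceil) →
      Pv true G s m true (setG G p s (some m)) w
  | cpass (G : Grid) (s p : ℕ) (m : Letter) (a : Bool) : p < s →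
      G p s = some ⟨m.ceil - 1, false⟩ → G (p + 1) s = some ⟨m.ceil, a⟩ →
      Pv true G s m true
        (setG (setG G p s (some ⟨m.ceil - 1, a⟩)) (p + 1) s (some ⟨m.ceil, false⟩))
        ⟨m.ceil - 1, m.primed⟩

theorem setG_set (G : Grid) (i j : ℕ) (x y : Option Letter) :
    setG (setG G i j x) i j y = setG G i j y := by
  funext a b; unfold setG; split_ifs <;> rfl

theorem setG_self {G : Grid} {i j : ℕ} {x : Option Letter} (h : G i j = x) : setG G i j x = G := by
  funext a b; unfold setG; split_ifs with hh
  · rw [hh.1, hh.2, h]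
  · rfl

theorem setG_comm (G : Grid) {i j k l : ℕ} (x y : Option Letter) (h : i ≠ k ∨ j ≠ l) :
    setG (setG G i j x) k l y = setG (setG G k l y) i j x := by
  funext a b; unfold setG; split_ifs <;> first | rfl | omega

theorem setG_set₂ (G : Grid) {i j k l : ℕ} (x y x' y' : Option Letter) (h : i ≠ k ∨ j ≠ l) :
    setG (setG (setG (setG G i j x) k l y) i j x') k l y' = setG (setG G i j x') k l y' := by
  rw [setG_comm G x y h, setG_set, setG_comm (setG G k l y) x' y' h, setG_set, setG_comm _ _ _ h]

theorem setG_self₂ {G : Grid} {i j k l : ℕ} {x y : Option Letter} (h1 : G i j = x)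
    (h2 : G k l = y) : setG (setG G i j x) k l y = G := by
  rw [setG_self h1, setG_self h2]

theorem nx_pv {c c' : Bool} {G G' : Grid} {s : ℕ} {w w' : Letter} (hT : Tab G)
    (hn : Nx c G s w c' G' w') : Pv c' G' s w' c G w := by
  cases hn with
  | rbump _ _ p _ m hsp hm hw hlt =>
    have := Pv.rbump (setG G s p (some w)) s p w w' hsp (setG_same _ _ _ _) hw (fun j x hj hx => by
        rw [setG_of_ne _ (by omega)] at hx
        have := hT.lt hm hx le_rfl hj.le; omega)
    rwa [setG_set, setG_self hm] at this
  | rpass _ _ p _ a hsp hm hM =>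
    have := Pv.rpass (setG (setG G s p (some ⟨w.ceil, false⟩)) s (p + 1) (some ⟨w.ceil + 1, a⟩))
      s p ⟨w.ceil + 1, w.primed⟩ a hsp
      (by rw [setG_of_ne _ (by omega), setG_same]; simp) (by rw [setG_same])
    rw [setG_set₂ _ _ _ _ _ (by omega)] at this
    simp only [add_sub_cancel_right] at this
    rwa [setG_self₂ hm hM] at this
  | dbump _ _ _ m hm hw =>
    have := Pv.dbump (setG G s s (some ⟨w.ceil, false⟩)) s ⟨w.ceil, false⟩ ⟨m.ceil, w.primed⟩
      (setG_same _ _ _ _) hw (fun x hx => by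
        rw [setG_of_ne _ (by omega)] at hx
        have := hT.lt hm hx le_rfl (by omega)
        simp only; omega)
    have e : (⟨m.ceil, false⟩ : Letter) = m := by
      have := hT.diag _ _ hm; obtain ⟨m, b⟩ := m; simp_all
    rw [setG_set] at this
    simp only [e] at this
    rwa [setG_self hm] at this
  | dpass _ _ _ hm hM =>
    have := Pv.dpass G s ⟨w.ceil + 1, w.primed⟩ (by rw [hm]; simp) hM
    simpa using this
  | cbump _ _ p _ m hsp hm hw hlt =>
    have := Pv.cbump (setG G p s (some w)) s p w w' hsp (setG_same _ _ _ _) hw (fun j x hj hx => by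
        rw [setG_of_ne _ (by omega)] at hx
        have := hT.lt hm hx hj.le le_rfl; omega)
    rwa [setG_set, setG_self hm] at this
  | cpass _ _ p _ a hsp hm hM =>
    have := Pv.cpass (setG (setG G p s (some ⟨w.ceil, false⟩)) (p + 1) s (some ⟨w.ceil + 1, a⟩))
      s p ⟨w.ceil + 1, w.primed⟩ a hsp
      (by rw [setG_of_ne _ (by omega), setG_same]; simp) (by rw [setG_same])
    rw [setG_set₂ _ _ _ _ _ (by omega)] at this
    simp only [add_sub_cancel_right] at this
    rwa [setG_self₂ hm hM] at this

theorem Tab.row_cmp {G : Grid} (h : Tab G) {s i j : ℕ} {x y : Letter} (hx : G s i = some x)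
    (hy : G s j = some y) : (i < j ∧ x.ceil < y.ceil) ∨ (i = j ∧ x = y) ∨
      (j < i ∧ y.ceil < x.ceil) := by
  rcases lt_trichotomy i j with hc | rfl | hc
  · exact Or.inl ⟨hc, h.row s _ _ _ _ hc hx hy⟩
  · rw [hx] at hy; cases hy; exact Or.inr (Or.inl ⟨rfl, rfl⟩)
  · exact Or.inr (Or.inr ⟨hc, h.row s _ _ _ _ hc hy hx⟩)

theorem Tab.col_cmp {G : Grid} (h : Tab G) {s i j : ℕ} {x y : Letter} (hx : G i s = some x)
    (hy : G j s = some y) : (i < j ∧ x.ceil < y.ceil) ∨ (i = j ∧ x = y) ∨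
      (j < i ∧ y.ceil < x.ceil) := by
  rcases lt_trichotomy i j with hc | rfl | hc
  · exact Or.inl ⟨hc, h.col s _ _ _ _ hc hx hy⟩
  · rw [hx] at hy; cases hy; exact Or.inr (Or.inl ⟨rfl, rfl⟩)
  · exact Or.inr (Or.inr ⟨hc, h.col s _ _ _ _ hc hy hx⟩)

theorem pv_det {c c₁ c₂ : Bool} {G G₁ G₂ : Grid} {s : ℕ} {w w₁ w₂ : Letter} (hT : Tab G)
    (h1 : Pv c G s w c₁ G₁ w₁) (h2 : Pv c G s w c₂ G₂ w₂) : c₁ = c₂ ∧ G₁ = G₂ ∧ w₁ = w₂ := by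
  cases h1 with
  | rbump _ _ p a b h1 h2' h3 h4 =>
    cases h2 with
    | rbump _ _ q _ _ k1 k2 k3 k4 =>
      rcases hT.row_cmp h2' k2 with ⟨e, -⟩ | ⟨rfl, rfl⟩ | ⟨e, -⟩
      · have := h4 _ _ e k2; omega
      · exact ⟨rfl, rfl, rfl⟩
      · have := k4 _ _ e h2'; omega
    | rpass _ _ q _ a' k1 k2 k3 =>
      exfalso
      rcases hT.row_cmp h2' k3 with ⟨e, -⟩ | ⟨rfl, rfl⟩ | ⟨e, e'⟩
      · have := h4 _ _ e k3; simp only at this; omega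
      · simp only at h3; omega
      · simp only at e'; omega
  | rpass _ _ q _ a' k1 k2 k3 =>
    cases h2 with
    | rbump _ _ p a b h1 h2' h3 h4 =>
      exfalso
      rcases hT.row_cmp h2' k3 with ⟨e, -⟩ | ⟨rfl, rfl⟩ | ⟨e, e'⟩
      · have := h4 _ _ e k3; simp only at this; omega
      · simp only at h3; omega
      · simp only at e'; omega
    | rpass _ _ q' _ a'' k1' k2' k3' =>
      rcases hT.row_cmp k3 k3' with ⟨e, e'⟩ | ⟨e, e'⟩ | ⟨e, e'⟩
      · simp only at e'; omega
      · cases e'; obtain rfl : q = q' := by omega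
        exact ⟨rfl, rfl, rfl⟩
      · simp only at e'; omega
  | dbump _ _ a b h1 h2' h3 =>
    cases h2 with
    | dbump _ _ a' b' k1 k2 k3 => rw [h1] at k1; cases k1; exact ⟨rfl, rfl, rfl⟩
    | dpass _ _ b' k1 k2 => have := h3 _ k2; simp only at this; omega
    | cbump _ _ q _ _ k1 k2 k3 k4 => have := k4 _ _ k1 h1; omega
    | cpass _ _ q _ a' k1 k2 k3 =>
      have := hT.lt k3 h1 (by omega) le_rfl; simp only at this; omega
  | dpass _ _ b h1 h3 =>
    cases h2 with
    | dbump _ _ a' b' k1 k2 k3 => have := k3 _ h3; simp only at this; omega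
    | dpass _ _ b' k1 k2 => exact ⟨rfl, rfl, rfl⟩
    | cbump _ _ q _ _ k1 k2 k3 k4 => have := k4 _ _ k1 h1; simp only at this; omega
    | cpass _ _ q _ a' k1 k2 k3 =>
      have := hT.lt k3 h1 (by omega) le_rfl; simp only at this; omega
  | cbump _ _ p a b h1 h2' h3 h4 =>
    cases h2 with
    | dbump _ _ a' b' k1 k2 k3 => have := h4 _ _ h1 k1; omega
    | dpass _ _ b' k1 k2 => have := h4 _ _ h1 k1; simp only at this; omega
    | cbump _ _ q _ _ k1 k2 k3 k4 =>
      rcases hT.col_cmp h2' k2 with ⟨e, -⟩ | ⟨rfl, rfl⟩ | ⟨e, -⟩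
      · have := h4 _ _ e k2; omega
      · exact ⟨rfl, rfl, rfl⟩
      · have := k4 _ _ e h2'; omega
    | cpass _ _ q _ a' k1 k2 k3 =>
      exfalso
      rcases hT.col_cmp h2' k3 with ⟨e, -⟩ | ⟨rfl, rfl⟩ | ⟨e, e'⟩
      · have := h4 _ _ e k3; simp only at this; omega
      · simp only at h3; omega
      · simp only at e'; omega
  | cpass _ _ p _ a h1 h2' h3 =>
    cases h2 with
    | dbump _ _ a' b' k1 k2 k3 =>
      have := hT.lt h3 k1 (by omega) le_rfl; simp only at this; omega
    | dpass _ _ b' k1 k2 =>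
      have := hT.lt h3 k1 (by omega) le_rfl; simp only at this; omega
    | cbump _ _ q _ _ k1 k2 k3 k4 =>
      exfalso
      rcases hT.col_cmp k2 h3 with ⟨e, -⟩ | ⟨rfl, rfl⟩ | ⟨e, e'⟩
      · have := k4 _ _ e h3; simp only at this; omega
      · simp only at k3; omega
      · simp only at e'; omega
    | cpass _ _ q _ a' k1 k2 k3 =>
      rcases hT.col_cmp h3 k3 with ⟨e, e'⟩ | ⟨e, e'⟩ | ⟨e, e'⟩
      · simp only at e'; omega
      · cases e'; obtain rfl : p = q := by omega
        exact ⟨rfl, rfl, rfl⟩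
      · simp only at e'; omega

theorem nx_codet {c c₁ c₂ : Bool} {G G₁ G₂ : Grid} {s : ℕ} {w w₁ w₂ : Letter}
    (hT : Tab G) (hT₁ : Tab G₁) (hT₂ : Tab G₂)
    (h1 : Nx c₁ G₁ s w₁ c G w) (h2 : Nx c₂ G₂ s w₂ c G w) : c₁ = c₂ ∧ G₁ = G₂ ∧ w₁ = w₂ :=
  pv_det hT (nx_pv hT₁ h1) (nx_pv hT₂ h2)

theorem fin_codet {c₁ c₂ f f' : Bool} {G G' G₁ G₂ : Grid} {s₁ s₂ r q r' q' : ℕ} {w₁ w₂ : Letter}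
    (h1 : Fin' c₁ G₁ s₁ w₁ G r q f) (h2 : Fin' c₂ G₂ s₂ w₂ G' r' q' f')
    (hG : G = G') (hr : r = r') (hq : q = q') (hf : f = f') :
    c₁ = c₂ ∧ s₁ = s₂ ∧ G₁ = G₂ ∧ w₁ = w₂ := by
  have key : ∀ {G₁ G₂ : Grid} {i j : ℕ} {x y : Option Letter}, G₁ i j = none → G₂ i j = none →
      setG G₁ i j x = setG G₂ i j y → G₁ = G₂ ∧ x = y := by
    intro G₁ G₂ i j x y h1 h2 e
    refine ⟨?_, by have := congrFun (congrFun e i) j; rwa [setG_same, setG_same] at this⟩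
    rw [← setG_self h1, ← setG_set G₁ i j x none, e, setG_set, setG_self h2]
  cases h1 with
  | rend _ _ _ _ hse hn hlt =>
    cases h2 with
    | rend _ _ _ _ hse' hn' hlt' =>
      subst hr hq
      obtain ⟨rfl, e⟩ := key (hn _ le_rfl) (hn' _ le_rfl) hG
      cases e; exact ⟨rfl, rfl, rfl, rfl⟩
    | dend _ _ _ hn' => omega
    | cend _ _ _ _ hse' hn' hlt' => simp at hf
  | dend _ _ _ hn =>
    cases h2 with
    | rend _ _ _ _ hse' hn' hlt' => omega
    | dend _ _ _ hn' =>
      subst hr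
      obtain ⟨rfl, e⟩ := key (hn _ le_rfl) (hn' _ le_rfl) hG
      obtain ⟨a, b⟩ := w₁
      obtain ⟨a', b'⟩ := w₂
      simp only at hf e; cases e; subst hf; exact ⟨rfl, rfl, rfl, rfl⟩
    | cend _ _ _ _ hse' hn' hlt' => omega
  | cend _ _ _ _ hse hn hlt =>
    cases h2 with
    | rend _ _ _ _ hse' hn' hlt' => simp at hf
    | dend _ _ _ hn' => omega
    | cend _ _ _ _ hse' hn' hlt' =>
      subst hr hq
      obtain ⟨rfl, e⟩ := key (hn _ le_rfl) (hn' _ le_rfl) hG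
      cases e; exact ⟨rfl, rfl, rfl, rfl⟩

theorem red_prev {H : ℕ → Option Letter} {n q : ℕ} {m w : Letter} (hL : LInc H)
    (hr : Red (w :: line H n)) (hq : q < n) (hm : H q = some m) (e : m.ceil = w.ceil)
    (hn : ∀ j, j < q → H (q - 1) = none → H j = none) :
    1 ≤ q ∧ H (q - 1) = some ⟨w.ceil - 1, false⟩ := by
  rw [line_split H hq, hm] at hr
  have hpw : (line H q ++ [m]).Pairwise (fun a b => a.ceil < b.ceil) := by
    have := hL.pairwise (q + 1)
    rwa [line_succ, hm] at this
  obtain ⟨A', hA'⟩ := Red.pass_bwd (A := line H q) (by simpa using hr) e hpw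
  have hmem : (⟨w.ceil - 1, false⟩ : Letter) ∈ line H q := by rw [hA']; simp
  obtain ⟨j, hj, hjn⟩ := mem_line.1 hmem
  obtain ⟨q, rfl⟩ : ∃ k, q = k + 1 := ⟨q - 1, by omega⟩
  refine ⟨by omega, ?_⟩
  simp only [Nat.add_sub_cancel] at hn ⊢
  cases hh : H q with
  | none => rw [hn j hj hh] at hjn; cases hjn
  | some x =>
    rw [line_succ, hh] at hA'
    simp only [Option.toList_some] at hA'
    have := List.append_inj_right' hA' rfl
    simp only [List.cons.injEq, and_true] at this; rw [this]

theorem last_below {H : ℕ → Option Letter} {n p : ℕ} {w : ℤ} (hB : ∀ j, n ≤ j → H j = none)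
    (h : ∃ x, H p = some x ∧ x.ceil < w) (hne : ∀ j x, H j = some x → x.ceil ≠ w) :
    ∃ q x, p ≤ q ∧ H q = some x ∧ x.ceil < w ∧ ∀ j y, q < j → H j = some y → w < y.ceil := by
  by_cases hp : ∃ j x, p < j ∧ H j = some x ∧ x.ceil < w
  · obtain ⟨j, x, hj, hx, hlt⟩ := hp
    have hjn : j < n := by
      by_contra hc; rw [hB j (by omega)] at hx; cases hx
    obtain ⟨q, y, hq, h2⟩ := last_below hB ⟨x, hx, hlt⟩ hne
    exact ⟨q, y, by omega, h2⟩
  · push Not at hp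
    obtain ⟨x, hx, hlt⟩ := h
    refine ⟨p, x, le_rfl, hx, hlt, fun j y hj hy => ?_⟩
    have := hp j y hj hy
    have := hne j y hy
    omega
termination_by n - p

theorem Ok.prev_row {z : ℤ → ℤ} {n : ℕ} {G : Grid} {s : ℕ} {w : Letter}
    (h : Ok z n false G (s + 1) w) : ∃ c G₀ w₀, Ok z n c G₀ s w₀ ∧ Nx c G₀ s w₀ false G w := by
  obtain ⟨hT, hB, hle, hI, hb⟩ := h
  have hb' : Builds (cw G n (s + 1) w) z := hb
  have hr : Red (w :: line (G s) n) := by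
    rw [cw_succ] at hb'
    exact Red.middle _ _ _ ⟨[], [], z, Or.inl (by simpa using hb')⟩
  by_cases hq : ∃ q a, G s q = some ⟨w.ceil, a⟩
  · obtain ⟨q, a, hq⟩ := hq
    obtain ⟨hq1, hp⟩ := red_prev (hT.row s) hr (hB.lt hq).2 hq rfl (fun j hj hj' => by
      rcases lt_or_ge j s with hc | hc
      · exact hT.none_of_lt hc
      · obtain ⟨x, hx, -⟩ := hT.le hq (j := q - 1) le_rfl (by omega) (by omega)
        rw [hj'] at hx; cases hx)
    obtain ⟨p, rfl⟩ : ∃ k, q = k + 1 := ⟨q - 1, by omega⟩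
    simp only [Nat.add_sub_cancel] at hp
    have hsp : s < p := by
      obtain ⟨p0, hp0, ⟨x, hx, hxw, -⟩ | ⟨x, b, hx, hxw, -, -⟩⟩ := hI
      · rcases hT.row_cmp hx hq with e | e | e
        · omega
        · rw [e.2] at hxw; simp at hxw
        · simp only at e; omega
      · rcases hT.row_cmp hx hq with e | e | e
        · simp only at e; omega
        · omega
        · simp only at e; omega
    set G₀ := setG (setG G s p (some ⟨w.ceil - 1, a⟩)) s (p + 1) (some ⟨w.ceil, false⟩) with hG₀
    have h1 : G₀ s p = some ⟨w.ceil - 1, a⟩ := by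
      rw [hG₀, setG_of_ne _ (by omega), setG_same]
    have h2 : G₀ s (p + 1) = some ⟨w.ceil - 1 + 1, false⟩ := by
      rw [hG₀, setG_same, sub_add_cancel]
    have hback : setG (setG G₀ s p (some ⟨w.ceil - 1, false⟩)) s (p + 1)
        (some ⟨w.ceil - 1 + 1, a⟩) = G := by
      rw [hG₀, setG_set₂ _ _ _ _ _ (by omega), setG_self₂ hp (by rw [hq, sub_add_cancel])]
    have hT₀ : Tab G₀ := by
      refine hT.reprime (map_pass (by omega) hp hq rfl rfl) fun i x hx => ?_
      rw [hG₀, setG_of_ne _ (by omega), setG_of_ne _ (by omega)] at hx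
      exact hT.diag i x hx
    have hB₀ : Bnd n G₀ := (hB.set (hB.lt hp).1 (hB.lt hp).2 _).set (hB.lt hq).1 (hB.lt hq).2 _
    refine ⟨false, G₀, ⟨w.ceil - 1, w.primed⟩, ⟨hT₀, hB₀, by omega, ?_, ?_⟩, ?_⟩
    · cases s with
      | zero => trivial
      | succ t =>
        obtain ⟨x, hx, hlt⟩ := hT.down _ _ _ hq
        have e1 : G₀ t (p + 1) = some x := by
          rw [hG₀, setG_of_ne _ (by omega), setG_of_ne _ (by omega), hx]
        simp only at hlt
        by_cases hc : x.ceil < w.ceil - 1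
        · refine ⟨p + 1, by omega, Or.inl ⟨x, e1, hc, fun b hb => ?_⟩⟩
          rw [h2] at hb; cases hb; simp
        · exact ⟨p, by omega, Or.inr ⟨x, _, e1, by simp only; omega, h1, rfl⟩⟩
    · have := (rpass_builds (q := w.primed) (z := z) hT₀ hB₀ h1 h2).2
      rw [hback, sub_add_cancel] at this
      exact this hb'
    · have := Nx.rpass G₀ s p ⟨w.ceil - 1, w.primed⟩ a hsp h1 h2
      rw [hback] at this
      simpa using this
  · push Not at hq
    have hne : ∀ j x, G s j = some x → x.ceil ≠ w.ceil := fun j x hx e => by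
      refine hq j x.primed ?_; rw [hx, ← e]
    obtain ⟨p0, hp0, ⟨x, hx, hxw, hup⟩ | ⟨x, b, hx, hxw, -, -⟩⟩ := hI
    swap
    · exact (hne _ _ hx hxw).elim
    obtain ⟨p, m, hpp, hm, hmw, hgt⟩ := last_below (n := n) (fun j hj => hB s j (Or.inr hj))
      ⟨x, hx, hxw⟩ hne
    have hbd := hB.lt hm
    have hT₀ : Tab (setG G s p (some w)) := by
      refine hT.set (by omega) ?_ ?_ ?_ ?_ (by omega)
      · rintro k rfl hk
        obtain ⟨y, hy, hlt⟩ := hT.left _ _ _ hk hm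
        exact ⟨y, hy, by omega⟩
      · rintro t rfl
        obtain ⟨y, hy, hlt⟩ := hT.down _ _ _ hm
        exact ⟨y, hy, by omega⟩
      · intro y hy; exact hgt _ y (by omega) hy
      · intro y hy
        obtain ⟨y', hy', hle'⟩ := hT.le hy le_rfl hpp hp0
        have := hup y' hy'; omega
    have hB₀ := hB.set hbd.1 hbd.2 (some w)
    have hback : setG (setG G s p (some w)) s p (some m) = G := by rw [setG_set, setG_self hm]
    have hlt : ∀ j x, j < p → setG G s p (some w) s j = some x → x.ceil < m.ceil := by
      intro j x hj hx
      rw [setG_of_ne _ (by omega)] at hx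
      exact hT.row s _ _ _ _ hj hx hm
    refine ⟨false, _, m, ⟨hT₀, hB₀, by omega, ?_, ?_⟩, ?_⟩
    · cases s with
      | zero => trivial
      | succ t =>
        obtain ⟨y, hy, hlt⟩ := hT.down _ _ _ hm
        refine ⟨p, by omega, Or.inl ⟨y, ?_, hlt, fun b hb => ?_⟩⟩
        · rw [setG_of_ne _ (by omega), hy]
        · rw [setG_same] at hb; cases hb; exact hmw
    · have := (rbump_builds (z := z) hT₀ hB₀ (setG_same _ _ _ _) hmw hlt).2
      rw [hback] at this
      exact this hb'
    · have := Nx.rbump _ s p m w (by omega) (setG_same G s p (some w)) hmw hlt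
      rwa [hback] at this

theorem Ok.prev_col {z : ℤ → ℤ} {n : ℕ} {G : Grid} {s : ℕ} {w : Letter}
    (h : Ok z n true G (s + 1) w) : ∃ c G₀ w₀, Ok z n c G₀ s w₀ ∧ Nx c G₀ s w₀ true G w := by
  obtain ⟨hT, hB, hle, hI, hb⟩ := h
  have hb' : Builds (cw (tr G) n (s + 1) w).reverse z := hb
  have hr : Red (w :: line (tr G s) n) := by
    rw [cw_succ] at hb'
    exact Red.middle _ _ _ ⟨[], [], z, Or.inr (by simpa using hb')⟩
  by_cases h3 : G s s = some ⟨w.ceil - 1, false⟩ ∧ G s (s + 1) = some ⟨w.ceil, false⟩ ∧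
          G (s + 1) (s + 1) = some ⟨w.ceil + 1, false⟩
  · obtain ⟨h1, h2, h3⟩ := h3
    have h2' : G s (s + 1) = some ⟨w.ceil - 1 + 1, false⟩ := by rw [sub_add_cancel, h2]
    refine ⟨false, G, ⟨w.ceil - 1, w.primed⟩, ⟨hT, hB, by omega, ?_, ?_⟩, ?_⟩
    · cases s with
      | zero => trivial
      | succ t =>
        obtain ⟨x, hx, hlt⟩ := hT.down _ _ _ h2
        simp only at hlt
        by_cases hc : x.ceil < w.ceil - 1
        · refine ⟨t + 1 + 1, by omega, Or.inl ⟨x, hx, hc, fun b hb => ?_⟩⟩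
          rw [h2] at hb; cases hb; simp
        · exact ⟨t + 1, by omega, Or.inr ⟨x, _, hx, by simp only; omega, h1, rfl⟩⟩
    · obtain ⟨R, e1, e2⟩ := eqv_hook (p := w.primed) hT (hB.lt h3).1 h1 h2'
        (by rw [h3]; congr 2; ring)
      rw [show (⟨w.ceil - 1 + 1, w.primed⟩ : Letter) = w by rw [sub_add_cancel]] at e1 e2
      have hb2 := (e2.wEq.builds z).1 hb'
      have e3 : (⟨w.ceil - 1 + 1, w.primed⟩ : Letter) = w := by rw [sub_add_cancel]
      have hb3 := builds_four_bwd (p := w.primed) (by rw [e3]; exact hb2)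
      have hb4 : Builds (cw G n (s + 1) w) z := by
        refine (e1.wEq.builds z).2 ?_
        have := hb3.2
        nth_rewrite 1 [show (⟨w.ceil - 1 + 1, false⟩ : Letter) = w by
          rw [← hb3.1]; exact e3] at this
        exact this
      have := (rpass_builds (q := w.primed) (z := z) hT hB h1 h2').2
      rw [setG_self₂ h1 h2', e3] at this
      exact this hb4
    · have := Nx.dpass G s ⟨w.ceil - 1, w.primed⟩ h1 h2'
      simpa using this
  by_cases hq : ∃ q a, G q s = some ⟨w.ceil, a⟩
  · obtain ⟨q, a, hq⟩ := hq
    have hqs := hT.supp _ _ _ hq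
    obtain ⟨hq1, hp⟩ := red_prev (hT.col s) hr (hB.lt hq).1 hq rfl (fun j hj hj' => by
      obtain ⟨x, hx, -⟩ := hT.le hq (i := q - 1) (j := s) (by omega) le_rfl (by omega)
      rw [tr, hx] at hj'; cases hj')
    obtain ⟨p, rfl⟩ : ∃ k, q = k + 1 := ⟨q - 1, by omega⟩
    obtain ⟨t, rfl⟩ : ∃ k, s = k + 1 := ⟨s - 1, by omega⟩
    simp only [Nat.add_sub_cancel, tr] at hp
    set G₀ := setG (setG G p (t + 1) (some ⟨w.ceil - 1, a⟩)) (p + 1) (t + 1)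
      (some ⟨w.ceil, false⟩) with hG₀
    have h1 : G₀ p (t + 1) = some ⟨w.ceil - 1, a⟩ := by
      rw [hG₀, setG_of_ne _ (by omega), setG_same]
    have h2 : G₀ (p + 1) (t + 1) = some ⟨w.ceil - 1 + 1, false⟩ := by
      rw [hG₀, setG_same, sub_add_cancel]
    have hback : setG (setG G₀ p (t + 1) (some ⟨w.ceil - 1, false⟩)) (p + 1) (t + 1)
        (some ⟨w.ceil - 1 + 1, a⟩) = G := by
      rw [hG₀, setG_set₂ _ _ _ _ _ (by omega), setG_self₂ hp (by rw [hq, sub_add_cancel])]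
    have hT₀ : Tab G₀ := by
      refine hT.reprime (map_pass (by omega) hp hq rfl rfl) fun i x hx => ?_
      rw [hG₀] at hx
      unfold setG at hx
      split_ifs at hx with c1 c2
      · cases hx; rfl
      · omega
      · exact hT.diag i x hx
    have hB₀ : Bnd n G₀ := (hB.set (hB.lt hp).1 (hB.lt hp).2 _).set (hB.lt hq).1 (hB.lt hq).2 _
    refine ⟨true, G₀, ⟨w.ceil - 1, w.primed⟩, ⟨hT₀, hB₀, by omega, ?_, ?_⟩, ?_⟩
    · rcases hqs.lt_or_eq with hc | hc
      · obtain ⟨x, hx, hlt⟩ := hT.left _ t _ (by omega) hq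
        have e1 : G₀ (p + 1) t = some x := by
          rw [hG₀, setG_of_ne _ (by omega), setG_of_ne _ (by omega), hx]
        simp only at hlt
        by_cases hc : x.ceil < w.ceil - 1
        · refine ⟨p + 1, by omega, Or.inl ⟨x, e1, hc, fun b hb => ?_⟩⟩
          rw [h2] at hb; cases hb; simp
        · exact ⟨p, by omega, Or.inr (Or.inl ⟨x, _, e1, by simp only; omega, h1, rfl⟩)⟩
      · obtain rfl : p = t := by omega
        obtain rfl : a = false := hT.diag _ _ hq
        obtain ⟨x, hx, hlt⟩ := hT.left _ p _ le_rfl hp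
        simp only at hlt
        have hx2 : x.ceil = w.ceil - 2 := by
          by_contra hne
          refine not_builds_corner_col (x := w.ceil - 1) (p := w.primed) (z := z) hT (hB.lt hq).1
            (by rw [hq, sub_add_cancel]) hp (fun y hy => ?_) (by rw [sub_add_cancel]; exact hb')
          rw [hx] at hy; cases hy; omega
        refine ⟨p, le_rfl, Or.inr (Or.inr ⟨?_, h1, h2⟩)⟩
        rw [hG₀, setG_of_ne _ (by omega), setG_of_ne _ (by omega), hx]
        have hd := hT.diag _ _ hx
        obtain ⟨x, b⟩ := x
        simp only at hx2 hd; subst hd hx2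
        simp only; congr 2; ring
    · have := (cpass_builds (q := w.primed) (z := z) hT₀ hB₀ h1 h2).2
      rw [hback, sub_add_cancel] at this
      exact this hb'
    · have := Nx.cpass G₀ (t + 1) p ⟨w.ceil - 1, w.primed⟩ a (by omega) h1 h2
      rw [hback] at this
      simpa using this
  · push Not at hq
    have hne : ∀ j x, G j s = some x → x.ceil ≠ w.ceil := fun j x hx e => by
      refine hq j x.primed ?_; rw [hx, ← e]
    obtain ⟨p0, hp0, ⟨x, hx, hxw, hup⟩ | ⟨x, b, hx, hxw, -, -⟩ | h3'⟩ := hI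
    swap
    · exact (hne _ _ hx hxw).elim
    swap
    · exact (h3 h3').elim
    obtain ⟨p, m, hpp, hm, hmw, hgt⟩ := last_below (H := tr G s) (n := n)
      (fun j hj => hB j s (Or.inl hj)) ⟨x, hx, hxw⟩ hne
    change G p s = some m at hm
    replace hgt : ∀ j y, p < j → G j s = some y → w.ceil < y.ceil := hgt
    have hbd := hB.lt hm
    have hps := hT.supp _ _ _ hm
    have hright : ∀ y, G p (s + 1) = some y → w.ceil < y.ceil := by
      intro y hy
      obtain ⟨y', hy', hle'⟩ := hT.le hy hpp le_rfl (by omega)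
      have := hup y' hy'; omega
    rcases hps.lt_or_eq with hps | rfl
    · obtain ⟨t, rfl⟩ : ∃ k, s = k + 1 := ⟨s - 1, by omega⟩
      have hT₀ : Tab (setG G p (t + 1) (some w)) := by
        refine hT.set (by omega) ?_ ?_ hright ?_ (by omega)
        · intro k hk hk'
          obtain rfl : k = t := by omega
          obtain ⟨y, hy, hlt⟩ := hT.left _ _ _ hk' hm
          exact ⟨y, hy, by omega⟩
        · rintro k rfl
          obtain ⟨y, hy, hlt⟩ := hT.down _ _ _ hm
          exact ⟨y, hy, by omega⟩
        · intro y hy; exact hgt _ y (by omega) hy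
      have hB₀ := hB.set hbd.1 hbd.2 (some w)
      have hback : setG (setG G p (t + 1) (some w)) p (t + 1) (some m) = G := by
        rw [setG_set, setG_self hm]
      have hlt : ∀ j x, j < p → setG G p (t + 1) (some w) j (t + 1) = some x →
          x.ceil < m.ceil := by
        intro j x hj hx
        rw [setG_of_ne _ (by omega)] at hx
        exact hT.col _ _ _ _ _ hj hx hm
      refine ⟨true, _, m, ⟨hT₀, hB₀, by omega, ?_, ?_⟩, ?_⟩
      · obtain ⟨y, hy, hlt⟩ := hT.left _ t _ (by omega) hm
        refine ⟨p, by omega, Or.inl ⟨y, ?_, hlt, fun b hb => ?_⟩⟩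
        · rw [setG_of_ne _ (by omega), hy]
        · rw [setG_same] at hb; cases hb; exact hmw
      · have := (cbump_builds (z := z) hT₀ hB₀ (setG_same _ _ _ _) hmw hlt).2
        rw [hback] at this
        exact this hb'
      · have := Nx.cbump _ (t + 1) p m w hps (setG_same G p (t + 1) (some w)) hmw hlt
        rwa [hback] at this
    · obtain ⟨m, mb⟩ := m
      obtain rfl : mb = false := hT.diag _ _ hm
      simp only at hmw
      have hT₀ : Tab (setG G p p (some ⟨w.ceil, false⟩)) := by
        refine hT.set le_rfl ?_ ?_ hright ?_ (fun _ => rfl)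
        · intro k hk hk'; omega
        · rintro k rfl
          obtain ⟨y, hy, hlt⟩ := hT.down _ _ _ hm
          exact ⟨y, hy, by simp only at hlt ⊢; omega⟩
        · intro y hy; exact hgt _ y (by omega) hy
      have hB₀ := hB.set hbd.1 hbd.2 (some ⟨w.ceil, false⟩)
      have hback : ∀ x, setG (setG G p p (some ⟨w.ceil, false⟩)) p p x = setG G p p x := by
        intro x; rw [setG_set]
      have hself : setG G p p (some ⟨m, false⟩) = G := setG_self hm
      have hlt : ∀ j x, j < p → setG G p p (some ⟨w.ceil, false⟩) p j = some x →
          x.ceil < m := by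
        intro j x hj hx
        rw [hT₀.none_of_lt hj] at hx; cases hx
      refine ⟨false, _, ⟨m, w.primed⟩, ⟨hT₀, hB₀, by omega, ?_, ?_⟩, ?_⟩
      · cases p with
        | zero => trivial
        | succ t =>
          obtain ⟨y, hy, hlt⟩ := hT.down _ _ _ hm
          refine ⟨t + 1, le_rfl, Or.inl ⟨y, ?_, hlt, fun b hb => ?_⟩⟩
          · rw [setG_of_ne _ (by omega), hy]
          · rw [setG_same] at hb; cases hb; exact hmw
      · have h4 := (builds_switch (n := n) (m := w.ceil) (p := false) (q := w.primed) (z := z) hT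
          hbd.1 hm hmw (fun y hy => ?_)).2 hb'
        · have := (rbump_builds (w := ⟨m, w.primed⟩) (z := z) hT₀ hB₀ (setG_same _ _ _ _) hmw hlt).2
          rw [hback] at this
          exact this h4
        · obtain ⟨y', hy', hlt'⟩ := hT.down _ _ _ hy
          have := hright y' hy'; omega
      · have := Nx.dbump _ p ⟨m, w.primed⟩ _ (setG_same G p p (some ⟨w.ceil, false⟩)) hmw
        rw [hback] at this
        simp only [hself] at this
        exact this

theorem Ok.prev {z : ℤ → ℤ} {n : ℕ} {c : Bool} {G : Grid} {s : ℕ} {w : Letter}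
    (h : Ok z n c G (s + 1) w) : ∃ c₀ G₀ w₀, Ok z n c₀ G₀ s w₀ ∧ Nx c₀ G₀ s w₀ c G w := by
  cases c
  · exact h.prev_row
  · exact h.prev_col

theorem Tab.erase {G : Grid} (h : Tab G) {r q : ℕ} (hr : G r (q + 1) = none)
    (hu : G (r + 1) q = none) : Tab (setG G r q none) where
  supp a b x e := by
    unfold setG at e; split_ifs at e; exact h.supp a b x e
  left a b x hab e := by
    unfold setG at e
    split_ifs at e with hh
    obtain ⟨w, hw, hlt⟩ := h.left a b x hab e
    refine ⟨w, ?_, hlt⟩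
    rw [setG_of_ne, hw]
    by_contra hc
    obtain ⟨rfl, rfl⟩ : a = r ∧ b = q := by omega
    rw [hr] at e; cases e
  down a b x e := by
    unfold setG at e
    split_ifs at e with hh
    obtain ⟨w, hw, hlt⟩ := h.down a b x e
    refine ⟨w, ?_, hlt⟩
    rw [setG_of_ne, hw]
    by_contra hc
    obtain ⟨rfl, rfl⟩ : a = r ∧ b = q := by omega
    rw [hu] at e; cases e
  diag a x e := by
    unfold setG at e; split_ifs at e; exact h.diag a x e

/-- The box `(r, q)` is a removable box of `G` with entry `x`. -/
structure Corner (G : Grid) (r q : ℕ) (x : Letter) : Prop where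
  eq : G r q = some x
  right : G r (q + 1) = none
  up : G (r + 1) q = none

theorem Corner.fin_prev {z : ℤ → ℤ} {n : ℕ} {G : Grid} {r q : ℕ} {x : Letter}
    (hx : Corner G r q x) (hT : Tab G) (hB : Bnd n G) (hb : Builds (rows G n 0 n) z) (f : Bool) :
    ∃ c G₀ s w, Ok z n c G₀ s w ∧ Fin' c G₀ s w G r q f := by
  obtain ⟨hx, hr, hu⟩ := hx
  have hT₀ := hT.erase hr hu
  have hbd := hB.lt hx
  have hB₀ := hB.set hbd.1 hbd.2 none
  have hrq := hT.supp _ _ _ hx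
  have hback : ∀ y, setG (setG G r q none) r q y = setG G r q y := fun y => setG_set _ _ _ _ _
  have hright : ∀ j, q ≤ j → setG G r q none r j = none := by
    intro j hj
    rcases hj.lt_or_eq with hc | rfl
    · rw [setG_of_ne _ (by omega)]; exact hT.none_right (by omega) hr hc
    · exact setG_same _ _ _ _
  have hup : ∀ j, r ≤ j → setG G r q none j q = none := by
    intro j hj
    rcases hj.lt_or_eq with hc | rfl
    · rw [setG_of_ne _ (by omega)]; exact hT.none_up hu hc
    · exact setG_same _ _ _ _
  have hrow : ∀ w : Letter, w.ceil = x.ceil → CfgInv false (setG G r q none) r w := by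
    intro w hw
    cases r with
    | zero => trivial
    | succ t =>
      obtain ⟨y, hy, hlt⟩ := hT.down _ _ _ hx
      refine ⟨q, hrq, Or.inl ⟨y, ?_, by omega, fun b hb => ?_⟩⟩
      · rw [setG_of_ne _ (by omega), hy]
      · rw [setG_same] at hb; cases hb
  rcases hrq.lt_or_eq with hc | rfl
  · cases f with
    | false =>
      refine ⟨false, setG G r q none, r, x, ⟨hT₀, hB₀, hbd.1.le, hrow x rfl, ?_⟩, ?_⟩
      · change Builds (cw _ _ _ _) _
        rw [cw_end hbd.1 hbd.2 hright, hback, setG_self hx]; exact hb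
      · have := Fin'.rend (setG G r q none) r q x hc hright (fun j hj hj' => by
          obtain ⟨y, hy, hle⟩ := hT.le (j := j) hx le_rfl hj'.le hj
          exact ⟨y, by rw [setG_of_ne _ (by omega), hy], by omega⟩)
        rwa [hback, setG_self hx] at this
    | true =>
      refine ⟨true, setG G r q none, q, x, ⟨hT₀, hB₀, hbd.2.le, ?_, ?_⟩, ?_⟩
      · obtain ⟨t, rfl⟩ : ∃ k, q = k + 1 := ⟨q - 1, by omega⟩
        obtain ⟨y, hy, hlt⟩ := hT.left _ t _ (by omega) hx
        refine ⟨r, by omega, Or.inl ⟨y, ?_, by omega, fun b hb => ?_⟩⟩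
        · rw [setG_of_ne _ (by omega), hy]
        · rw [setG_same] at hb; cases hb
      · change Builds (cw _ _ _ _).reverse _
        rw [cw_end hbd.2 hbd.1 hup, ← tr_setG, hback, setG_self hx]
        exact ((rows_tr fun i j a b x y h1 h2 _ _ hx hy => hT.sepG i j a b x y h1 h2 hx hy).wEq.builds
          z).1 hb
      · have := Fin'.cend (setG G r q none) q r x hc hup (fun j hj' => by
          obtain ⟨y, hy, hle⟩ := hT.le (i := j) hx hj'.le le_rfl (by omega)
          exact ⟨y, by rw [setG_of_ne _ (by omega), hy], by omega⟩)
        rwa [hback, setG_self hx] at this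
  · have hd := hT.diag _ _ hx
    have e : (⟨x.ceil, false⟩ : Letter) = x := by rw [← hd]
    refine ⟨false, setG G r r none, r, ⟨x.ceil, f⟩, ⟨hT₀, hB₀, hbd.1.le, hrow _ rfl, ?_⟩, ?_⟩
    · have h0 : rows (setG G r r none) n r (n - r) = [] := by
        rw [List.eq_nil_iff_forall_not_mem]
        intro y hy
        obtain ⟨i, j, hi, -, -, hy⟩ := mem_rows.1 hy
        rcases lt_or_ge j r with hc | hc
        · rw [hT₀.none_of_lt (show j < i by omega)] at hy; cases hy
        · rw [hT₀.none_up (hright j hc) hi] at hy; cases hy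
      have h1 := cw_end (w := x) hbd.1 hbd.2 hright
      rw [hback, setG_self hx, cw, h0, List.nil_append] at h1
      change Builds (cw _ _ _ _) _
      rw [cw, h0, List.nil_append]
      rw [← h1] at hb
      obtain ⟨xc, xp⟩ := x
      exact builds_first xc xp _ _ _ hb
    · have := Fin'.dend (setG G r r none) r ⟨x.ceil, f⟩ hright
      rw [hback] at this
      simp only [e] at this
      rwa [setG_self hx] at this

theorem Fin'.corner {c f : Bool} {G G' : Grid} {s r q : ℕ} {w : Letter} (hT : Tab G)
    (h : Fin' c G s w G' r q f) : ∃ x, Corner G' r q x ∧ G r q = none ∧ x.ceil = w.ceil ∧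
      G' = setG G r q (some x) := by
  cases h with
  | rend _ _ _ _ hse hn hlt =>
    refine ⟨w, ⟨setG_same _ _ _ _, ?_, ?_⟩, hn _ le_rfl, rfl, rfl⟩
    · rw [setG_of_ne _ (by omega)]; exact hn _ (by omega)
    · rw [setG_of_ne _ (by omega)]; exact hT.none_up (hn _ le_rfl) (by omega)
  | dend _ _ _ hn =>
    refine ⟨⟨w.ceil, false⟩, ⟨setG_same _ _ _ _, ?_, ?_⟩, hn _ le_rfl, rfl, rfl⟩
    · rw [setG_of_ne _ (by omega)]; exact hn _ (by omega)
    · rw [setG_of_ne _ (by omega)]; exact hT.none_up (hn _ le_rfl) (by omega)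
  | cend _ _ _ _ hse hn hlt =>
    refine ⟨w, ⟨setG_same _ _ _ _, ?_, ?_⟩, hn _ le_rfl, rfl, rfl⟩
    · rw [setG_of_ne _ (by omega)]; exact hT.none_right hse.le (hn _ le_rfl) (by omega)
    · rw [setG_of_ne _ (by omega)]; exact hn _ (by omega)

/-- The insertion algorithm, started in an arbitrary line. -/
inductive Run : Bool → Grid → ℕ → Letter → Grid → ℕ → ℕ → Bool → Prop
  | fin {c G s w G' r q f} : Fin' c G s w G' r q f → Run c G s w G' r q f
  | step {c G s w c₁ G₁ w₁ G' r q f} : Nx c G s w c₁ G₁ w₁ → Run c₁ G₁ (s + 1) w₁ G' r q f →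
      Run c G s w G' r q f

/-- The initial part of a run. -/
inductive Reach (G : Grid) (u : Letter) : Bool → Grid → ℕ → Letter → Prop
  | refl : Reach G u false G 0 u
  | step {c H s w c₁ H₁ w₁} : Reach G u c H s w → Nx c H s w c₁ H₁ w₁ →
      Reach G u c₁ H₁ (s + 1) w₁

theorem Reach.run {G : Grid} {u : Letter} {c : Bool} {H : Grid} {s : ℕ} {w : Letter}
    (h : Reach G u c H s w) {G' r q f} (hr : Run c H s w G' r q f) : Run false G 0 u G' r q f := by
  induction h with
  | refl => exact hr
  | step _ hn ih => exact ih (Run.step hn hr)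

theorem Run.reach {c : Bool} {H : Grid} {s : ℕ} {w : Letter} {G' r q f}
    (hr : Run c H s w G' r q f) {G : Grid} {u : Letter}
    (h : Reach G u c H s w) : ∃ c' H' s' w', Reach G u c' H' s' w' ∧ Fin' c' H' s' w' G' r q f := by
  induction hr with
  | fin hf => exact ⟨_, _, _, _, h, hf⟩
  | step hn _ ih => exact ih (h.step hn)

theorem Reach.ok {z : ℤ → ℤ} {n : ℕ} {G : Grid} {u : Letter} (h0 : Ok z n false G 0 u)
    {c : Bool} {H : Grid} {s : ℕ} {w : Letter} (h : Reach G u c H s w) : Ok z n c H s w := by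
  induction h with
  | refl => exact h0
  | step _ hn ih => exact nx_ok ih hn

theorem Ok.reach {z : ℤ → ℤ} {n : ℕ} {s : ℕ} : ∀ {c : Bool} {H : Grid} {w : Letter},
    Ok z n c H s w → ∃ G u, Ok z n false G 0 u ∧ Reach G u c H s w := by
  induction s with
  | zero =>
    intro c H w h
    cases c
    · exact ⟨H, w, h, Reach.refl⟩
    · exact h.inv.elim
  | succ s ih =>
    intro c H w h
    obtain ⟨c₀, G₀, w₀, h0, hn⟩ := h.prev
    obtain ⟨G, u, h1, h2⟩ := ih h0
    exact ⟨G, u, h1, h2.step hn⟩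

theorem Reach.inj {z z' : ℤ → ℤ} {n n' : ℕ} {G G' : Grid} {u u' : Letter}
    (h0 : Ok z n false G 0 u) (h0' : Ok z' n' false G' 0 u') {s : ℕ} :
    ∀ {c : Bool} {H : Grid} {w : Letter}, Reach G u c H s w → Reach G' u' c H s w →
      G = G' ∧ u = u' := by
  induction s with
  | zero =>
    intro c H w h h'
    cases h; cases h'; exact ⟨rfl, rfl⟩
  | succ s ih =>
    intro c H w h h'
    have hT := (h.ok h0).tab
    cases h with
    | step h hn =>
      cases h' with
      | step h' hn' =>
        obtain ⟨rfl, rfl, rfl⟩ := nx_codet hT (h.ok h0).tab (h'.ok h0').tab hn hn'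
        exact ih h h'

theorem Ok.run {z : ℤ → ℤ} {n : ℕ} {s : ℕ} {c : Bool} {H : Grid} {w : Letter}
    (h : Ok z n c H s w) : ∃ G' r q f, Run c H s w G' r q f := by
  rcases h.step with ⟨c', G', w', hn⟩ | ⟨G', r, q, f, hf⟩
  · have h' := nx_ok h hn
    have := h'.le
    obtain ⟨G', r, q, f, hr⟩ := h'.run
    exact ⟨G', r, q, f, Run.step hn hr⟩
  · exact ⟨G', r, q, f, Run.fin hf⟩
termination_by n - s

theorem Run.ok {z : ℤ → ℤ} {n : ℕ} {s : ℕ} {c : Bool} {H : Grid} {w : Letter} {G' r q f}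
    (h : Run c H s w G' r q f) (h0 : Ok z n c H s w) :
    Tab G' ∧ Bnd (n + 1) G' ∧ Builds (rows G' (n + 1) 0 (n + 1)) z := by
  induction h with
  | fin hf => exact fin_ok h0 hf
  | step hn _ ih => exact ih (nx_ok h0 hn)

theorem Nx.isSome {c c' : Bool} {G G' : Grid} {s : ℕ} {w w' : Letter}
    (h : Nx c G s w c' G' w') (a b : ℕ) : (G' a b).isSome = (G a b).isSome := by
  have key : ∀ (G : Grid) {i j : ℕ} {m : Letter} (x : Letter), G i j = some m →
      (setG G i j (some x) a b).isSome = (G a b).isSome := by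
    intro G i j m x e
    unfold setG; split_ifs with hh
    · rw [hh.1, hh.2, e]; rfl
    · rfl
  cases h with
  | rbump _ _ p _ _ h1 h2 => exact key G _ h2
  | rpass _ _ p _ a h1 h2 h3 =>
    rw [key _ _ (by rw [setG_of_ne _ (by omega), h3]), key _ _ h2]
  | dbump _ _ _ _ h2 => exact key G _ h2
  | dpass => rfl
  | cbump _ _ p _ _ h1 h2 => exact key G _ h2
  | cpass _ _ p _ a h1 h2 h3 =>
    rw [key _ _ (by rw [setG_of_ne _ (by omega), h3]), key _ _ h2]

/-- The boxes of the result of an insertion. -/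
theorem Run.shape {z : ℤ → ℤ} {n : ℕ} {s : ℕ} {c : Bool} {H : Grid} {w : Letter} {G' r q f}
    (h : Run c H s w G' r q f) (h0 : Ok z n c H s w) :
    (∃ x, Corner G' r q x) ∧ H r q = none ∧
      ∀ a b, a ≠ r ∨ b ≠ q → (G' a b).isSome = (H a b).isSome := by
  induction h with
  | fin hf =>
    obtain ⟨x, hc, hn, -, e⟩ := hf.corner h0.tab
    refine ⟨⟨x, hc⟩, hn, fun a b hab => ?_⟩
    rw [e, setG_of_ne _ hab]
  | step hn _ ih =>
    obtain ⟨h1, h2, h3⟩ := ih (nx_ok h0 hn)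
    refine ⟨h1, ?_, fun a b hab => (h3 a b hab).trans (hn.isSome a b)⟩
    have := hn.isSome
    rw [← Option.not_isSome_iff_eq_none, ← hn.isSome, h2]; simp

/-- `G` is an increasing tableau whose row reading word builds `z`. -/
def Good (z : ℤ → ℤ) (G : Grid) : Prop := Tab G ∧ ∃ n, Bnd n G ∧ Builds (rows G n 0 n) z

theorem Good.ok {z z' : ℤ → ℤ} {G : Grid} {u : Letter} (h : Good z G)
    (hu : Asc z u) (hz : istep z u.ceil = z') : ∃ n, Ok z' n false G 0 u := by
  obtain ⟨hT, n, hB, hb⟩ := h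
  refine ⟨n, hT, hB, Nat.zero_le _, trivial, ?_⟩
  change Builds (cw _ _ _ _) _
  rw [cw_zero]
  refine ⟨(ascW_append _ _ _).2 ⟨hb.1, ?_⟩, ?_⟩
  · rw [hb.2]; exact ⟨hu, trivial⟩
  · rw [irun_append, hb.2]; exact hz

theorem Ok.good {z : ℤ → ℤ} {n : ℕ} {G : Grid} {u : Letter} (h : Ok z n false G 0 u) :
    ∃ z₀, Good z₀ G ∧ Asc z₀ u ∧ istep z₀ u.ceil = z := by
  have hb : Builds (cw G n 0 u) z := h.builds
  rw [cw_zero] at hb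
  obtain ⟨h1, h2⟩ := hb
  rw [ascW_append] at h1
  rw [irun_append] at h2
  exact ⟨_, ⟨h.tab, n, h.bnd, h1.1, rfl⟩, h1.2.1, h2⟩

/-- Insertion into a tableau. -/
abbrev Ins (G : Grid) (u : Letter) (G' : Grid) (r q : ℕ) (f : Bool) : Prop :=
  Run false G 0 u G' r q f

theorem Good.ins {z z' : ℤ → ℤ} {G : Grid} {u : Letter} (h : Good z G)
    (hu : Asc z u) (hz : istep z u.ceil = z') : ∃ G' r q f, Ins G u G' r q f := by
  obtain ⟨n, hn⟩ := h.ok hu hz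
  exact hn.run

theorem Ins.good {z z' : ℤ → ℤ} {G : Grid} {u : Letter} {G' r q f} (hi : Ins G u G' r q f)
    (h : Good z G) (hu : Asc z u) (hz : istep z u.ceil = z') : Good z' G' := by
  obtain ⟨n, hn⟩ := h.ok hu hz
  obtain ⟨h1, h2, h3⟩ := Run.ok hi hn
  exact ⟨h1, _, h2, h3⟩

theorem Good.uninsert {z : ℤ → ℤ} {G : Grid} {r q : ℕ} {x : Letter} (h : Good z G)
    (hx : Corner G r q x) (f : Bool) : ∃ z₀ G₀ u, Good z₀ G₀ ∧ Asc z₀ u ∧ istep z₀ u.ceil = z ∧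
      Ins G₀ u G r q f := by
  obtain ⟨hT, n, hB, hb⟩ := h
  obtain ⟨c, G₁, s, w, h1, h2⟩ := hx.fin_prev hT hB hb f
  obtain ⟨G₀, u, h3, h4⟩ := h1.reach
  obtain ⟨z₀, h5, h6, h7⟩ := h3.good
  exact ⟨z₀, G₀, u, h5, h6, h7, h4.run (Run.fin h2)⟩

theorem Ins.inj {z z₁ z₂ : ℤ → ℤ} {G₁ G₂ : Grid} {u₁ u₂ : Letter} {G r q f}
    (h1 : Ins G₁ u₁ G r q f) (h2 : Ins G₂ u₂ G r q f)
    (g1 : Good z₁ G₁) (g2 : Good z₂ G₂) (a1 : Asc z₁ u₁) (a2 : Asc z₂ u₂) :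
    G₁ = G₂ ∧ u₁ = u₂ := by
  obtain ⟨n, o1⟩ := g1.ok a1 rfl
  obtain ⟨m, o2⟩ := g2.ok a2 rfl
  obtain ⟨c, H, s, w, r1, f1⟩ := h1.reach Reach.refl
  obtain ⟨c', H', s', w', r2, f2⟩ := h2.reach Reach.refl
  obtain ⟨rfl, rfl, rfl, rfl⟩ := fin_codet f1 f2 rfl rfl rfl rfl
  exact Reach.inj o1 o2 r1 r2

/-- The rounded entries of a grid. -/
def val (G : Grid) (i j : ℕ) : Option ℤ := (G i j).map Letter.ceil

theorem val_some {G : Grid} {i j : ℕ} {a : ℤ} : val G i j = some a ↔ ∃ x, G i j = some x ∧ x.ceil = a := by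
  simp [val]

theorem val_of {G : Grid} {i j : ℕ} {x : Letter} (h : G i j = some x) : val G i j = some x.ceil := by
  simp [val, h]

theorem val_none {G : Grid} {i j : ℕ} : val G i j = none ↔ G i j = none := by simp [val]

theorem val_setG (G : Grid) (i j : ℕ) (x : Letter) (a b : ℕ) :
    val (setG G i j (some x)) a b = if a = i ∧ b = j then some x.ceil else val G a b := by
  unfold val setG; split_ifs <;> rfl

/-- The effect of one insertion step on a line. -/
structure Stp (L L' : ℕ → Option ℤ) (w w' : ℤ) (p : ℕ) : Prop where
  lt : w < w'
  new : L' p = some w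
  oth : ∀ j, j ≠ p → L' j = L j
  old : L p = some w' ∨ (L p = some w ∧ L (p + 1) = some w' ∧ w' = w + 1)
  bef : ∀ j a, j < p → L j = some a → a < w

theorem Tab.vrow {G : Grid} (hT : Tab G) {s j k : ℕ} {a b : ℤ} (hjk : j < k) (ha : val G s j = some a)
    (hb : val G s k = some b) : a < b := by
  obtain ⟨x, hx, rfl⟩ := val_some.1 ha
  obtain ⟨y, hy, rfl⟩ := val_some.1 hb
  have := hT.lt hx hy le_rfl hjk.le
  omega

theorem Tab.vcol {G : Grid} (hT : Tab G) {s j k : ℕ} {a b : ℤ} (hjk : j < k) (ha : val G j s = some a)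
    (hb : val G k s = some b) : a < b := by
  obtain ⟨x, hx, rfl⟩ := val_some.1 ha
  obtain ⟨y, hy, rfl⟩ := val_some.1 hb
  have := hT.lt hx hy hjk.le le_rfl
  omega

theorem Nx.stp_row {H H' : Grid} {s : ℕ} {w w' : Letter} {c' : Bool} (hT : Tab H)
    (h : Nx false H s w c' H' w') : ∃ p, s ≤ p ∧ (c' = true ↔ p = s) ∧
      Stp (val H s) (val H' s) w.ceil w'.ceil p ∧ ∀ i j, i ≠ s → val H' i j = val H i j := by
  cases h with
  | rbump _ _ p _ m hsp hm hlt hb =>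
    refine ⟨p, hsp.le, by simp; omega, ⟨hlt, by simp [val_setG], fun j hj => by simp [val_setG, hj],
      Or.inl (val_of hm), fun j a hj ha => ?_⟩, fun i j hi => by simp [val_setG, hi]⟩
    obtain ⟨x, hx, rfl⟩ := val_some.1 ha
    exact hb j x hj hx
  | rpass _ _ p _ a hsp h1 h2 =>
    have e1 := val_of h1
    have e2 := val_of h2
    refine ⟨p, hsp.le, by simp; omega, ⟨by simp, by simp [val_setG], fun j hj => ?_,
      Or.inr ⟨e1, e2, rfl⟩, fun j a hj ha => hT.vrow hj ha e1⟩,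
      fun i j hi => by simp [val_setG, hi]⟩
    by_cases hjp : j = p + 1
    · subst hjp; simp [val_setG, e2]
    · simp [val_setG, hj, hjp]
  | dbump _ _ _ m hm hlt =>
    refine ⟨s, le_rfl, by simp, ⟨hlt, by simp [val_setG], fun j hj => by simp [val_setG, hj],
      Or.inl (by simp [val, hm]), fun j a hj ha => ?_⟩, fun i j hi => by simp [val_setG, hi]⟩
    rw [val, hT.none_of_lt hj] at ha; cases ha
  | dpass _ _ _ h1 h2 =>
    have e1 := val_of h1
    have e2 := val_of h2
    refine ⟨s, le_rfl, by simp, ⟨by simp, e1, fun j hj => rfl,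
      Or.inr ⟨e1, e2, rfl⟩, fun j a hj ha => ?_⟩, fun i j hi => rfl⟩
    rw [val, hT.none_of_lt hj] at ha; cases ha

theorem Nx.stp_col {H H' : Grid} {s : ℕ} {w w' : Letter} {c' : Bool} (hT : Tab H)
    (h : Nx true H s w c' H' w') : c' = true ∧ ∃ p, p < s ∧
      Stp (fun i => val H i s) (fun i => val H' i s) w.ceil w'.ceil p ∧
      ∀ i j, j ≠ s → val H' i j = val H i j := by
  cases h with
  | cbump _ _ p _ m hsp hm hlt hb =>
    refine ⟨rfl, p, hsp, ⟨hlt, by simp [val_setG], fun j hj => by simp [val_setG, hj],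
      Or.inl (val_of hm), fun j a hj ha => ?_⟩, fun i j hi => by simp [val_setG, hi]⟩
    obtain ⟨x, hx, rfl⟩ := val_some.1 ha
    exact hb j x hj hx
  | cpass _ _ p _ a hsp h1 h2 =>
    have e1 := val_of h1
    have e2 := val_of h2
    refine ⟨rfl, p, hsp, ⟨by simp, by simp [val_setG], fun j hj => ?_,
      Or.inr ⟨e1, e2, rfl⟩, fun j a hj ha => hT.vcol hj ha e1⟩,
      fun i j hi => by simp [val_setG, hi]⟩
    by_cases hjp : j = p + 1
    · subst hjp; simp [val_setG, e2]
    · simp [val_setG, hj, hjp]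

theorem Fin'.row_eq {H G : Grid} {s r q : ℕ} {w : Letter} {f : Bool}
    (h : Fin' false H s w G r q f) : r = s := by
  cases h <;> rfl

theorem Run.col_end {c : Bool} {H : Grid} {s : ℕ} {w : Letter} {G r q f}
    (h : Run c H s w G r q f) (hc : c = true) : f = true ∧ s ≤ q := by
  induction h with
  | fin hf => subst hc; cases hf with | cend => exact ⟨rfl, le_rfl⟩
  | step hn _ ih =>
    subst hc
    have := ih (by cases hn <;> rfl)
    exact ⟨this.1, by omega⟩

theorem Run.row_end {c : Bool} {H : Grid} {s : ℕ} {w : Letter} {G r q f}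
    (h : Run c H s w G r q f) (hc : c = false) : (f = false → s ≤ r) ∧ s ≤ q := by
  induction h with
  | fin hf => subst hc; cases hf with
    | rend => simp; omega
    | dend => simp
  | @step c H s w c₁ H₁ w₁ G' r q f hn hr ih =>
    subst hc
    cases c₁ with
    | false => have := ih rfl; exact ⟨fun hf => by have := this.1 hf; omega, by omega⟩
    | true => have := hr.col_end rfl; exact ⟨fun hf => by simp [this.1] at hf, by omega⟩

/-- `G` arises from `H` by replacing entries by smaller values that are at least `w`. -/
def Low (H G : Grid) (w : ℤ) (i j : ℕ) : Prop :=
  ∃ b, val G i j = some b ∧ w ≤ b ∧ ∀ a, val H i j = some a → b < a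

theorem Run.mono_col {z : ℤ → ℤ} {n : ℕ} {c : Bool} {H : Grid} {s : ℕ} {w : Letter} {G r q f}
    (h : Run c H s w G r q f) (ho : Ok z n c H s w) (hc : c = true) (i j : ℕ) :
    val G i j = val H i j ∨ s ≤ j ∧ Low H G w.ceil i j := by
  induction h generalizing n with
  | @fin c G s w G' r q f hf =>
    obtain ⟨x, -, h0, hx, rfl⟩ := hf.corner ho.tab
    have hq := (Run.fin hf).col_end hc
    by_cases hij : i = r ∧ j = q
    · obtain ⟨rfl, rfl⟩ := hij
      refine Or.inr ⟨hq.2, x.ceil, by simp [val_setG], hx.ge, fun a ha => ?_⟩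
      rw [val, h0] at ha; cases ha
    · left; rw [val_setG, if_neg hij]
  | @step c H s w c₁ H₁ w₁ G' r q f hn hr ih =>
    subst hc
    obtain ⟨rfl, p, hp, hs, ho'⟩ := hn.stp_col ho.tab
    rcases ih (nx_ok ho hn) rfl with h1 | ⟨h1, b, hb, hwb, hlt⟩
    · by_cases hj : j = s
      · subst hj
        by_cases hi : i = p
        · subst hi
          have hnew : val H₁ i j = some w.ceil := hs.new
          rcases hs.old with h2 | h2
          · refine Or.inr ⟨le_rfl, w.ceil, h1.trans hnew, le_rfl, fun a ha => ?_⟩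
            have := hs.lt
            rw [h2] at ha; cases ha; exact this
          · left; rw [h1, hnew]; exact h2.1.symm
        · left; rw [h1]; exact hs.oth i hi
      · left; rw [h1, ho' i j hj]
    · refine Or.inr ⟨by omega, b, hb, by have := hs.lt; omega, fun a ha => hlt a ?_⟩
      rw [ho' i j (by omega), ha]

theorem Run.mono_row {z : ℤ → ℤ} {n : ℕ} {c : Bool} {H : Grid} {s : ℕ} {w : Letter} {G r q f}
    (h : Run c H s w G r q f) (ho : Ok z n c H s w) (hc : c = false) (i j : ℕ) :
    val G i j = val H i j ∨ Low H G (if i < s then w.ceil + 1 else w.ceil) i j := by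
  induction h generalizing n with
  | @fin c G s w G' r q f hf =>
    have hr : s ≤ r := by rw [(show Fin' false G s w G' r q f from hc ▸ hf).row_eq]
    obtain ⟨x, -, h0, hx, rfl⟩ := hf.corner ho.tab
    by_cases hij : i = r ∧ j = q
    · obtain ⟨rfl, rfl⟩ := hij
      refine Or.inr ⟨x.ceil, by simp [val_setG], ?_, fun a ha => ?_⟩
      · rw [if_neg (by omega)]; exact hx.ge
      · rw [val, h0] at ha; cases ha
    · left; rw [val_setG, if_neg hij]
  | @step c H s w c₁ H₁ w₁ G' r q f hn hr ih =>
    subst hc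
    obtain ⟨p, hp, hc₁, hs, ho'⟩ := hn.stp_row ho.tab
    have hlt' := hs.lt
    have key : val G' i j = val H₁ i j ∨ Low H₁ G' w₁.ceil i j := by
      cases c₁ with
      | false =>
        rcases ih (nx_ok ho hn) rfl with h1 | ⟨b, hb, hwb, hlt⟩
        · exact Or.inl h1
        · exact Or.inr ⟨b, hb, by split_ifs at hwb <;> omega, hlt⟩
      | true => exact (hr.mono_col (nx_ok ho hn) rfl i j).imp_right And.right
    rcases key with h1 | ⟨b, hb, hwb, hlt⟩
    · by_cases hi : i = s
      · subst hi
        by_cases hj : j = p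
        · subst hj
          have hnew : val H₁ i j = some w.ceil := hs.new
          rcases hs.old with h2 | h2
          · refine Or.inr ⟨w.ceil, h1.trans hnew, by simp, fun a ha => ?_⟩
            rw [h2] at ha; cases ha; exact hlt'
          · left; rw [h1, hnew]; exact h2.1.symm
        · left; rw [h1]; exact hs.oth j hj
      · left; rw [h1, ho' i j hi]
    · refine Or.inr ⟨b, hb, by split_ifs <;> omega, fun a ha => ?_⟩
      by_cases hi : i = s
      · subst hi
        by_cases hj : j = p
        · subst hj
          have := hlt _ hs.new
          omega
        · exact hlt a ((hs.oth j hj).trans ha)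
      · exact hlt a (by rw [ho' i j hi, ha])

/-- `H` arises from `G` by replacing entries `≤ w` by entries `< w`. -/
def MGrid (G H : Grid) (w : ℤ) : Prop :=
  ∀ i j, val H i j = val G i j ∨ ∃ a b, val G i j = some a ∧ val H i j = some b ∧ a ≤ w ∧ b < w

theorem MGrid.refl (G : Grid) (w : ℤ) : MGrid G G w := fun _ _ => Or.inl rfl

theorem MGrid.get {G H : Grid} {w : ℤ} (h : MGrid G H w) {i j : ℕ} {a : ℤ} (ha : val H i j = some a)
    (hw : w ≤ a) : val G i j = some a := by
  rcases h i j with h | ⟨x, b, -, h2, -, h4⟩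
  · rw [← h, ha]
  · rw [ha] at h2; cases h2; omega

theorem MGrid.get' {G H : Grid} {w : ℤ} (h : MGrid G H w) {i j : ℕ} {a : ℤ} (ha : val G i j = some a)
    (hw : w < a) : val H i j = some a := by
  rcases h i j with h | ⟨x, b, h1, -, h3, -⟩
  · rw [h, ha]
  · rw [ha] at h1; cases h1; omega

theorem MGrid.step {G H H' : Grid} {w w' : Letter} {c c' : Bool} {s : ℕ} (h : MGrid G H w.ceil)
    (hT : Tab H) (hn : Nx c H s w c' H' w') : MGrid G H' w'.ceil := by
  have key : w.ceil < w'.ceil ∧ ∀ i j, val H' i j = val H i j ∨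
      (val H i j = some w'.ceil ∧ val H' i j = some w.ceil) := by
    cases c with
    | false =>
      obtain ⟨p, hp, -, hs, ho⟩ := hn.stp_row hT
      refine ⟨hs.lt, fun i j => ?_⟩
      by_cases hi : i = s
      · subst hi
        by_cases hj : j = p
        · subst hj
          rcases hs.old with h2 | h2
          · exact Or.inr ⟨h2, hs.new⟩
          · exact Or.inl (hs.new.trans h2.1.symm)
        · exact Or.inl (hs.oth j hj)
      · exact Or.inl (ho i j hi)
    | true =>
      obtain ⟨-, p, hp, hs, ho⟩ := hn.stp_col hT
      refine ⟨hs.lt, fun i j => ?_⟩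
      by_cases hi : j = s
      · subst hi
        by_cases hj : i = p
        · subst hj
          rcases hs.old with h2 | h2
          · exact Or.inr ⟨h2, hs.new⟩
          · exact Or.inl (hs.new.trans h2.1.symm)
        · exact Or.inl (hs.oth i hj)
      · exact Or.inl (ho i j hi)
  obtain ⟨hlt, key⟩ := key
  intro i j
  rcases key i j with h1 | ⟨h1, h2⟩
  · rcases h i j with h3 | ⟨a, b, h3, h4, h5, h6⟩
    · exact Or.inl (h1.trans h3)
    · exact Or.inr ⟨a, b, h3, h1.trans h4, by omega, by omega⟩
  · exact Or.inr ⟨_, _, h.get h1 hlt.le, h2, le_rfl, hlt⟩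

theorem Fin'.row_lt {H G : Grid} {s r q : ℕ} {w : Letter} {f : Bool} (hT : Tab H)
    (h : Fin' false H s w G r q f) {j : ℕ} {a : ℤ} (ha : val H s j = some a) : a < w.ceil := by
  obtain ⟨x, hx, rfl⟩ := val_some.1 ha
  have hsj := hT.supp _ _ _ hx
  cases h with
  | rend _ _ e _ hse hn hl =>
    rcases lt_or_ge j q with hc | hc
    · obtain ⟨y, hy, hlt⟩ := hl j hsj hc
      rw [hx] at hy; cases hy; exact hlt
    · rw [hn j hc] at hx; cases hx
  | dend _ _ _ hn => rw [hn j hsj] at hx; cases hx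

theorem Fin'.col_lt {H G : Grid} {s r q : ℕ} {w : Letter} {f : Bool}
    (h : Fin' true H s w G r q f) {j : ℕ} {a : ℤ} (ha : val H j s = some a) : a < w.ceil := by
  obtain ⟨x, hx, rfl⟩ := val_some.1 ha
  cases h with
  | cend _ _ e _ hse hn hl =>
    rcases lt_or_ge j r with hc | hc
    · obtain ⟨y, hy, hlt⟩ := hl j hc
      rw [hx] at hy; cases hy; exact hlt
    · rw [hn j hc] at hx; cases hx

theorem Fin'.new {c : Bool} {H G : Grid} {s r q : ℕ} {w : Letter} {f : Bool} (hT : Tab H)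
    (h : Fin' c H s w G r q f) : val G r q = some w.ceil ∧
      ∀ i j, ¬(i = r ∧ j = q) → val G i j = val H i j := by
  obtain ⟨x, -, h0, hx, rfl⟩ := h.corner hT
  exact ⟨by simp [val_setG, hx], fun i j hij => by rw [val_setG, if_neg hij]⟩

theorem Fin'.row_le {H G : Grid} {s r q : ℕ} {w : Letter} {f : Bool} (hT : Tab H)
    (h : Fin' false H s w G r q f) {j : ℕ} {a : ℤ} (ha : val G s j = some a) : a ≤ w.ceil := by
  have hn := h.new hT
  by_cases hj : s = r ∧ j = q
  · obtain ⟨rfl, rfl⟩ := hj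
    rw [hn.1] at ha; cases ha; exact le_rfl
  · exact (h.row_lt hT ((hn.2 _ _ hj).symm.trans ha)).le

theorem Fin'.col_le {H G : Grid} {s r q : ℕ} {w : Letter} {f : Bool} (hT : Tab H)
    (h : Fin' true H s w G r q f) {j : ℕ} {a : ℤ} (ha : val G j s = some a) : a ≤ w.ceil := by
  have hn := h.new hT
  by_cases hj : j = r ∧ s = q
  · obtain ⟨rfl, rfl⟩ := hj
    rw [hn.1] at ha; cases ha; exact le_rfl
  · exact (h.col_lt ((hn.2 _ _ hj).symm.trans ha)).le

theorem Stp.ge {L L' : ℕ → Option ℤ} {w w' : ℤ} {p : ℕ} (h : Stp L L' w w' p) :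
    ∃ j, p ≤ j ∧ L j = some w' := by
  rcases h.old with h | ⟨-, h, -⟩
  · exact ⟨p, le_rfl, h⟩
  · exact ⟨p + 1, by omega, h⟩

/-- Entries of the line exceeding the inserted value are at least the next inserted value. -/
theorem Stp.le_of_lt {L L' : ℕ → Option ℤ} {w w' : ℤ} {p : ℕ} (h : Stp L L' w w' p)
    (hs : ∀ j k a b, j < k → L j = some a → L k = some b → a < b) {j : ℕ} {a : ℤ}
    (ha : L j = some a) (hw : w < a) : w' ≤ a ∧ p ≤ j := by
  have hpj : p ≤ j := by
    by_contra hc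
    have := h.bef j a (by omega) ha
    omega
  refine ⟨?_, hpj⟩
  rcases h.old with h1 | ⟨h1, h2, rfl⟩
  · rcases hpj.lt_or_eq with hc | rfl
    · exact (hs _ _ _ _ hc h1 ha).le
    · rw [h1] at ha; cases ha; rfl
  · omega

theorem lockstep_col {z z' : ℤ → ℤ} {n n' : ℕ} {c : Bool} {H₁ H₂ G₁ G₂ : Grid} {s : ℕ}
    {p q : Letter} {r₁ q₁ r₂ q₂ : ℕ} {f₁ f₂ : Bool} (h₁ : Run c H₁ s p G₁ r₁ q₁ f₁) (hc : c = true)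
    (h₂ : Run true H₂ s q G₂ r₂ q₂ f₂) (o₁ : Ok z n c H₁ s p) (o₂ : Ok z' n' true H₂ s q)
    (hm : MGrid G₁ H₂ q.ceil) :
    (p.ceil < q.ceil → q₂ ≤ q₁) ∧ (q.ceil < p.ceil → q₁ < q₂) := by
  induction h₁ generalizing n n' H₂ q with
  | @fin c H₁ s p G₁ r₁ q₁ f₁ hf =>
    subst hc
    have hnew := (hf.new o₁.tab).1
    have hcol : q₁ = s := by cases hf; rfl
    subst hcol
    cases h₂ with
    | fin hf₂ =>
      have hcol : q₂ = q₁ := by cases hf₂; rfl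
      subst hcol
      refine ⟨fun _ => le_rfl, fun hqp => ?_⟩
      have := hf₂.col_lt (hm.get' hnew hqp)
      omega
    | step hn hr =>
      have hend := (hr.col_end (by cases hn <;> rfl)).2
      refine ⟨fun hpq => ?_, fun _ => by omega⟩
      obtain ⟨-, k, hk, hs, -⟩ := hn.stp_col o₂.tab
      obtain ⟨j, -, hj⟩ := hs.ge
      have hlt := hs.lt
      have := hf.col_le o₁.tab (hm.get hj hlt.le)
      omega
  | @step c H₁ s p c₁ H₁' p' G₁ r₁ q₁ f₁ hn hr ih =>
    subst hc
    have o₁' := nx_ok o₁ hn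
    obtain ⟨rfl, k, hk, hs, ho⟩ := hn.stp_col o₁.tab
    have hun : ∀ i, val G₁ i s = val H₁' i s := fun i => by
      rcases hr.mono_col o₁' rfl i s with h | h
      · exact h
      · omega
    have hp : val G₁ k s = some p.ceil := (hun k).trans hs.new
    have hend := (hr.col_end rfl).2
    cases h₂ with
    | fin hf₂ =>
      have hcol : q₂ = s := by cases hf₂; rfl
      subst hcol
      refine ⟨fun _ => by omega, fun hqp => ?_⟩
      have := hf₂.col_lt (hm.get' hp hqp)
      omega
    | @step _ _ _ _ c₂ H₂' q' _ _ _ _ hn₂ hr₂ =>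
      have o₂' := nx_ok o₂ hn₂
      have hm' := hm.step o₂.tab hn₂
      obtain ⟨rfl, k₂, hk₂, hs₂, ho₂⟩ := hn₂.stp_col o₂.tab
      have hlt := hs.lt
      have hlt₂ := hs₂.lt
      obtain ⟨i1, i2⟩ := ih rfl hr₂ o₁' o₂' hm'
      refine ⟨fun hpq => i1 ?_, fun hqp => i2 ?_⟩
      · obtain ⟨j, -, hj⟩ := hs₂.ge
        have h3 := (hun j).symm.trans (hm.get hj hlt₂.le)
        have hjk : j ≠ k := by
          rintro rfl
          have := hs.new
          have := Option.some.inj (h3.symm.trans this)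
          omega
        have h4 := (hs.oth j hjk).symm.trans h3
        obtain ⟨h5, h6⟩ := hs.le_of_lt (fun j k a b hjk ha hb => o₁.tab.vcol hjk ha hb) h4 (by omega)
        rcases hs.old with h7 | ⟨-, -, h7⟩
        · have := o₁.tab.vcol (show k < j by omega) h7 h4
          omega
        · omega
      · obtain ⟨h5, h6⟩ := hs₂.le_of_lt (fun j k a b hjk ha hb => o₂.tab.vcol hjk ha hb)
          (hm.get' hp hqp) hqp
        omega

theorem hook_of_diag {H : Grid} {s : ℕ} {p : Letter} (hT : Tab H) (hI : CfgInv true H (s + 1) p)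
    (h1 : val H s (s + 1) = some p.ceil) :
    val H s s = some (p.ceil - 1) := by
  obtain ⟨r, hr, h⟩ := hI
  obtain ⟨x, hx, hxc⟩ := val_some.1 h1
  rcases h with ⟨a, h2, h3, h4⟩ | ⟨a, b, h2, h3, h4, h5⟩ | ⟨h2, -, -⟩
  · obtain ⟨b, hb, -⟩ := hT.le hx hr le_rfl (show r ≤ s + 1 by omega)
    have := h4 b hb
    have := hT.lt hb hx hr le_rfl
    omega
  · rcases hr.lt_or_eq with hc | rfl
    · have := hT.lt h4 hx hr le_rfl
      omega
    · rw [hT.none_of_lt (by omega)] at h2; cases h2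
  · simp [val, h2]

theorem lockstep_mid_lt {z z' : ℤ → ℤ} {n n' : ℕ} {c : Bool} {H₁ H₂ G₁ G₂ : Grid} {s : ℕ}
    {p v : Letter} {r₁ q₁ r₂ q₂ : ℕ} {f₁ f₂ : Bool} (h₁ : Run c H₁ s p G₁ r₁ q₁ f₁) (hc : c = true)
    (h₂ : Run false H₂ s v G₂ r₂ q₂ f₂) (o₁ : Ok z n c H₁ s p) (o₂ : Ok z' n' false H₂ s v)
    (hm : MGrid G₁ H₂ v.ceil) (hrow : ∀ i j, s ≤ i → val H₂ i j = val G₁ i j) {t : ℕ} (ht : s = t + 1)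
    {d : ℤ} (hd : val G₁ t t = some d) (hdv : d + 2 ≤ v.ceil) (hf : f₂ = true) : q₂ ≤ q₁ := by
  induction h₁ generalizing n n' H₂ v t d with
  | @fin c H₁ s p G₁ r₁ q₁ f₁ hf₁ =>
    subst hc
    have hqr : q₁ = s ∧ r₁ < q₁ := by cases hf₁; simp_all
    obtain ⟨rfl, hrq⟩ := hqr
    have hcorner := (hf₁.corner o₁.tab).choose_spec.1
    have hnone : val H₂ q₁ q₁ = none := by
      rw [hrow _ _ le_rfl, val_none]
      cases hf₁ with
      | cend _ _ _ _ h1 h2 h3 => rw [setG_of_ne _ (by omega)]; exact h2 _ hrq.le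
    cases h₂ with
    | fin hf₂ =>
      cases hf₂ with
      | rend => cases hf
      | dend => exact le_rfl
    | step hn hr =>
      obtain ⟨k, hk, -, hs, -⟩ := hn.stp_row o₂.tab
      obtain ⟨j, hkj, hj⟩ := hs.ge
      rw [val, o₂.tab.none_right le_rfl (val_none.1 hnone) (hk.trans hkj)] at hj
      cases hj
  | @step c H₁ s p c₁ H₁' p' G₁ r₁ q₁ f₁ hn hr ih =>
    subst hc
    have o₁' := nx_ok o₁ hn
    obtain ⟨rfl, k, hk, hs, ho⟩ := hn.stp_col o₁.tab
    have hun : ∀ i j, j ≤ s → val G₁ i j = val H₁' i j := fun i j hj => by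
      rcases hr.mono_col o₁' rfl i j with h | h
      · exact h
      · omega
    have hend := (hr.col_end rfl).2
    cases h₂ with
    | fin hf₂ =>
      cases hf₂ with
      | rend => cases hf
      | dend => omega
    | @step _ _ _ _ c₂ H₂' v' _ _ _ _ hn₂ hr₂ =>
      have o₂' := nx_ok o₂ hn₂
      have hm' := hm.step o₂.tab hn₂
      obtain ⟨k₂, hk₂, hc₂, hs₂, ho₂⟩ := hn₂.stp_row o₂.tab
      have hlt := hs.lt
      have hlt₂ := hs₂.lt
      obtain ⟨j, hkj, hj⟩ := hs₂.ge
      obtain ⟨x, hx, hxc⟩ := val_some.1 hj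
      obtain ⟨m, hmm, -⟩ := o₂.tab.le hx le_rfl (hk₂.trans hkj) le_rfl
      have hG₁ : val G₁ s s = some m.ceil := (hrow _ _ le_rfl).symm.trans (val_of hmm)
      cases c₂ with
      | false =>
        have hk₂' : s < k₂ := lt_of_le_of_ne hk₂ fun h => by simp [h] at hc₂
        refine ih rfl hr₂ o₁' o₂' hm' (fun i j hi => ?_) rfl hG₁ ?_
        · rw [ho₂ i j (by omega), hrow i j (by omega)]
        · have := hs₂.bef s m.ceil hk₂' (val_of hmm)
          omega
      | true =>
        obtain rfl : k₂ = s := hc₂.1 rfl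
        refine (lockstep_col hr rfl hr₂ o₁' o₂' hm').1 ?_
        have hH₁ : val H₁ k₂ k₂ = some m.ceil := by
          rw [← hG₁, hun _ _ le_rfl]; exact (hs.oth k₂ (by omega)).symm
        have hv : v.ceil ≤ m.ceil ∧ m.ceil ≤ v'.ceil ∧ (v.ceil = m.ceil → m.ceil < v'.ceil) := by
          have hmv := val_of hmm
          rcases hs₂.old with h1 | ⟨h1, -, h2⟩
          · have := Option.some.inj (h1.symm.trans hmv)
            omega
          · have := Option.some.inj (h1.symm.trans hmv)
            omega
        rcases hs.old with h1 | ⟨h1, h2, h3⟩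
        · have := o₁.tab.vcol hk h1 hH₁
          omega
        · rcases (show k + 1 < k₂ ∨ k + 1 = k₂ by omega) with h4 | rfl
          · have := o₁.tab.vcol h4 h2 hH₁
            omega
          · have h5 := hook_of_diag o₁.tab o₁.inv h1
            have h6 : val G₁ k k = some (p.ceil - 1) := by
              rw [hun _ _ (by omega), ho _ _ (by omega), h5]
            obtain rfl : t = k := by omega
            have h7 := Option.some.inj (h6.symm.trans hd)
            have h8 := Option.some.inj (h2.symm.trans hH₁)
            omega

theorem Run.stay_row {z : ℤ → ℤ} {n : ℕ} {c : Bool} {H G : Grid} {s k : ℕ} {w : Letter} {r q f}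
    (h : Run c H (s + 1) w G r q f) (ho : Ok z n c H (s + 1) w) {a : ℤ} (ha : val H s k = some a)
    (hw : a < w.ceil) : val G s k = some a := by
  have key : val G s k = val H s k ∨ Low H G w.ceil s k := by
    cases c with
    | false =>
      rcases h.mono_row ho rfl s k with h1 | ⟨b, hb, hwb, hlt⟩
      · exact Or.inl h1
      · exact Or.inr ⟨b, hb, by split_ifs at hwb <;> omega, hlt⟩
    | true => exact (h.mono_col ho rfl s k).imp_right And.right
  rcases key with h | ⟨b, hb, h1, h2⟩
  · exact h.trans ha
  · have := h2 _ ha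
    omega

theorem lockstep_mid_gt {z z' : ℤ → ℤ} {n n' : ℕ} {c : Bool} {H₁ H₂ G₁ G₂ : Grid} {s : ℕ}
    {u q : Letter} {r₁ q₁ r₂ q₂ : ℕ} {f₁ f₂ : Bool} (h₁ : Run c H₁ s u G₁ r₁ q₁ f₁) (hc : c = false)
    (h₂ : Run true H₂ s q G₂ r₂ q₂ f₂) (o₁ : Ok z n c H₁ s u) (o₂ : Ok z' n' true H₂ s q)
    (hT : Tab G₁)
    (hm : MGrid G₁ H₂ q.ceil) (hrow : ∀ i j, s ≤ i → val H₂ i j = val G₁ i j)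
    (hf : f₁ = true) : q₁ < q₂ := by
  induction h₁ generalizing n n' H₂ q with
  | @fin c H₁ s u G₁ r₁ q₁ f₁ hf₁ =>
    subst hc
    have hnew := (hf₁.new o₁.tab).1
    cases hf₁ with
    | rend => cases hf
    | dend =>
    cases h₂ with
    | fin hf₂ =>
      have hrs : q₂ = s ∧ r₂ < s ∧ H₂ s s = none := by
        cases hf₂ with
        | cend _ _ _ _ h1 h2 _ => exact ⟨rfl, h1, h2 _ h1.le⟩
      rw [← hrow _ _ le_rfl, val_none.2 hrs.2.2] at hnew; cases hnew
    | step hn hr =>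
      have := (hr.col_end (by cases hn <;> rfl)).2
      omega
  | @step c H₁ s u c₁ H₁' u' G₁ r₁ q₁ f₁ hn hr ih =>
    subst hc
    have o₁' := nx_ok o₁ hn
    obtain ⟨k, hk, hc₁, hs, ho⟩ := hn.stp_row o₁.tab
    have hlt := hs.lt
    have hu := hr.stay_row o₁' hs.new hlt
    obtain ⟨x, hx, hxc⟩ := val_some.1 hu
    obtain ⟨m, hmm, hmle⟩ := hT.le hx le_rfl hk le_rfl
    have hH₂ : val H₂ s s = some m.ceil := (hrow _ _ le_rfl).trans (val_of hmm)
    cases h₂ with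
    | fin hf₂ =>
      cases hf₂ with
      | cend _ _ _ _ h1 h2 _ => rw [val_none.2 (h2 _ h1.le)] at hH₂; cases hH₂
    | @step _ _ _ _ c₂ H₂' q' _ _ _ _ hn₂ hr₂ =>
      have o₂' := nx_ok o₂ hn₂
      have hm' := hm.step o₂.tab hn₂
      obtain ⟨rfl, k₂, hk₂, hs₂, ho₂⟩ := hn₂.stp_col o₂.tab
      cases c₁ with
      | false =>
        refine ih rfl hr₂ o₁' o₂' hT hm' (fun i j hi => ?_) hf
        rw [← hrow i j (by omega)]
        by_cases hj : j = s
        · subst hj; exact hs₂.oth i (by omega)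
        · exact ho₂ i j hj
      | true =>
        obtain rfl : k = s := hc₁.1 rfl
        refine (lockstep_col hr rfl hr₂ o₁' o₂' hm').2 ?_
        have hm1 : m.ceil = u.ceil := Option.some.inj ((val_of hmm).symm.trans hu)
        rcases hs₂.old with h1 | ⟨h1, h2, h3⟩
        · have := o₂.tab.vcol hk₂ h1 hH₂
          omega
        · rcases (show k₂ + 1 < k ∨ k₂ + 1 = k by omega) with h4 | rfl
          · have := o₂.tab.vcol h4 h2 hH₂
            omega
          · have := Option.some.inj (h2.symm.trans hH₂)
            omega

/-- The descent condition on two consecutive recording boxes. -/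
def Des (r₁ q₁ : ℕ) (f₁ : Bool) (r₂ q₂ : ℕ) (f₂ : Bool) : Prop :=
  (f₁ = false ∧ f₂ = true) ∨ (f₁ = false ∧ f₂ = false ∧ r₁ < r₂) ∨
    (f₁ = true ∧ f₂ = true ∧ q₁ < q₂)

theorem lockstep_row {z z' : ℤ → ℤ} {n n' : ℕ} {c : Bool} {H₁ H₂ G₁ G₂ : Grid} {s : ℕ}
    {u v : Letter} {r₁ q₁ r₂ q₂ : ℕ} {f₁ f₂ : Bool} (h₁ : Run c H₁ s u G₁ r₁ q₁ f₁) (hc : c = false)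
    (h₂ : Run false H₂ s v G₂ r₂ q₂ f₂) (o₁ : Ok z n c H₁ s u) (o₂ : Ok z' n' false H₂ s v)
    (hT : Tab G₁) (hm : MGrid G₁ H₂ v.ceil) (hrow : ∀ i j, s ≤ i → val H₂ i j = val G₁ i j) :
    (u.ceil < v.ceil → ¬ Des r₁ q₁ f₁ r₂ q₂ f₂) ∧ (v.ceil < u.ceil → Des r₁ q₁ f₁ r₂ q₂ f₂) := by
  induction h₁ generalizing n n' H₂ v with
  | @fin c H₁ s u G₁ r₁ q₁ f₁ hf₁ =>
    subst hc
    have hnew := (hf₁.new o₁.tab).1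
    obtain rfl := hf₁.row_eq
    have hH₂ := (hrow _ _ le_rfl).trans hnew
    cases h₂ with
    | fin hf₂ =>
      obtain rfl := hf₂.row_eq
      have hlt := hf₂.row_lt o₂.tab hH₂
      refine ⟨fun _ => ?_, fun _ => by omega⟩
      cases hf₂ with
      | rend => simp [Des]
      | dend _ _ _ hn =>
        obtain ⟨x, hx, -⟩ := val_some.1 hH₂
        rw [hn _ (o₂.tab.supp _ _ _ hx)] at hx; cases hx
    | @step _ _ _ _ c₂ H₂' v' _ _ _ _ hn₂ hr₂ =>
      obtain ⟨k, hk, hc₂, hs, -⟩ := hn₂.stp_row o₂.tab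
      have hlt := hs.lt
      obtain ⟨j, hkj, hj⟩ := hs.ge
      refine ⟨fun huv => ?_, fun hvu => ?_⟩
      · have := hf₁.row_le o₁.tab ((hrow _ _ le_rfl).symm.trans hj)
        omega
      · cases c₂ with
        | true =>
          have := hr₂.col_end rfl
          have hq : f₁ = false ∨ q₁ = r₁ := by cases hf₁ <;> simp
          cases f₁ with
          | false => exact Or.inl ⟨rfl, this.1⟩
          | true => exact Or.inr (Or.inr ⟨rfl, this.1, by simp at hq; omega⟩)
        | false =>
          have hkr : r₁ < k := lt_of_le_of_ne hk fun h => by simp [h] at hc₂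
          have := hr₂.row_end rfl
          have hf : f₁ = false := by
            cases hf₁ with
            | rend => rfl
            | dend =>
              have := hs.bef _ _ hkr hH₂
              omega
          cases f₂ with
          | false => exact Or.inr (Or.inl ⟨hf, rfl, by have := this.1 rfl; omega⟩)
          | true => exact Or.inl ⟨hf, rfl⟩
  | @step c H₁ s u c₁ H₁' u' G₁ r₁ q₁ f₁ hn hr ih =>
    subst hc
    have o₁' := nx_ok o₁ hn
    obtain ⟨k, hk, hc₁, hs, ho⟩ := hn.stp_row o₁.tab
    have hlt := hs.lt
    have hu := hr.stay_row o₁' hs.new hlt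
    have hH₂ := (hrow _ _ le_rfl).trans hu
    cases h₂ with
    | fin hf₂ =>
      obtain rfl := hf₂.row_eq
      have hlt := hf₂.row_lt o₂.tab hH₂
      refine ⟨fun _ => ?_, fun _ => by omega⟩
      cases hf₂ with
      | rend =>
        rintro (⟨-, h⟩ | ⟨h1, -, h⟩ | ⟨-, h, -⟩)
        · cases h
        · cases c₁ with
          | false => have := (hr.row_end rfl).1 h1; omega
          | true => have := (hr.col_end rfl).1; simp [h1] at this
        · cases h
      | dend _ _ _ hn =>
        rw [val_none.2 (hn _ hk)] at hH₂; cases hH₂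
    | @step _ _ _ _ c₂ H₂' v' _ _ _ _ hn₂ hr₂ =>
      have o₂' := nx_ok o₂ hn₂
      have hm' := hm.step o₂.tab hn₂
      obtain ⟨k₂, hk₂, hc₂, hs₂, ho₂⟩ := hn₂.stp_row o₂.tab
      have hlt₂ := hs₂.lt
      obtain ⟨j, hkj, hj⟩ := hs₂.ge
      have hrow' : ∀ i j, s + 1 ≤ i → val H₂' i j = val G₁ i j := fun i j hi => by
        rw [ho₂ i j (by omega), hrow i j (by omega)]
      have hgt := fun hvu : v.ceil < u.ceil =>
        hs₂.le_of_lt (fun j k a b hjk ha hb => o₂.tab.vrow hjk ha hb) hH₂ hvu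
      refine ⟨fun huv => ?_, fun hvu => ?_⟩
      · have hk₂' : c₂ = false := by
          cases c₂ with
          | false => rfl
          | true =>
            obtain rfl := hc₂.1 rfl
            have hge : ∀ a, val H₂ k₂ k₂ = some a → v.ceil ≤ a := by
              intro a ha
              rcases hs₂.old with h | h
              · have := Option.some.inj (ha.symm.trans h); omega
              · have := Option.some.inj (ha.symm.trans h.1); omega
            obtain ⟨x, hx, hxc⟩ := val_some.1 hH₂
            obtain ⟨m, hmm, hle⟩ := o₂.tab.le hx le_rfl hk le_rfl
            have := hge _ (val_of hmm)
            omega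
        subst hk₂'
        cases c₁ with
        | true =>
          obtain rfl := hc₁.1 rfl
          have := hr.col_end rfl
          rintro (⟨h, -⟩ | ⟨h, -, -⟩ | ⟨-, h1, h⟩)
          · simp [this.1] at h
          · simp [this.1] at h
          · have := lockstep_mid_lt hr rfl hr₂ o₁' o₂' hm' hrow' rfl hu (by omega) h1
            omega
        | false =>
          refine (ih rfl hr₂ o₁' o₂' hT hm' hrow').1 ?_
          have h1 := (hrow _ _ le_rfl).symm.trans hj
          rcases hr.mono_row o₁' rfl s j with h2 | ⟨b, hb, hwb, -⟩
          · have h3 := h2.symm.trans h1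
            have hjk : j ≠ k := by
              rintro rfl
              have := Option.some.inj (h3.symm.trans hs.new)
              omega
            have h4 := (hs.oth j hjk).symm.trans h3
            obtain ⟨h5, h6⟩ := hs.le_of_lt (fun j k a b hjk ha hb => o₁.tab.vrow hjk ha hb) h4
              (by omega)
            rcases hs.old with h7 | ⟨-, -, h7⟩
            · have := o₁.tab.vrow (show k < j by omega) h7 h4
              omega
            · omega
          · have := Option.some.inj (hb.symm.trans h1)
            rw [if_pos (by omega)] at hwb
            omega
      · obtain ⟨h5, h6⟩ := hgt hvu
        cases c₁ with
        | true =>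
          obtain rfl := hc₁.1 rfl
          have he₁ := hr.col_end rfl
          cases c₂ with
          | false =>
            have : k < k₂ := lt_of_le_of_ne hk₂ fun h => by simp [h] at hc₂
            omega
          | true =>
            have he₂ := hr₂.col_end rfl
            exact Or.inr (Or.inr ⟨he₁.1, he₂.1,
              (lockstep_col hr rfl hr₂ o₁' o₂' hm').2 (by omega)⟩)
        | false =>
          cases c₂ with
          | false => exact (ih rfl hr₂ o₁' o₂' hT hm' hrow').2 (by omega)
          | true =>
            have he₂ := hr₂.col_end rfl
            cases f₁ with
            | false => exact Or.inl ⟨rfl, he₂.1⟩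
            | true => exact Or.inr (Or.inr ⟨rfl, he₂.1,
                lockstep_mid_gt hr rfl hr₂ o₁' o₂' hT hm' hrow' rfl⟩)

theorem istep_not_asc {y : ℤ → ℤ} (hy : IsInv y) {u v : Letter} (hu : Asc y u)
    (hv : Asc (istep y u.ceil) v) : u.ceil ≠ v.ceil :=
  fun h => not_ascW_self y hy u v h ⟨hu, hv, trivial⟩

theorem Good.isInv {z : ℤ → ℤ} {G : Grid} (h : Good z G) : IsInv z := by
  obtain ⟨-, n, -, -, rfl⟩ := h
  exact isInv_id.irun _

theorem Ins.des {z : ℤ → ℤ} {G G₁ G₂ : Grid} {u v : Letter} {r₁ q₁ r₂ q₂ : ℕ} {f₁ f₂ : Bool}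
    (hg : Good z G) (hu : Asc z u) (hv : Asc (istep z u.ceil) v) (h₁ : Ins G u G₁ r₁ q₁ f₁)
    (h₂ : Ins G₁ v G₂ r₂ q₂ f₂) : u.ceil < v.ceil ↔ ¬ Des r₁ q₁ f₁ r₂ q₂ f₂ := by
  have hg₁ := h₁.good hg hu rfl
  obtain ⟨n, o₁⟩ := hg.ok hu rfl
  obtain ⟨m, o₂⟩ := hg₁.ok hv rfl
  have := lockstep_row h₁ rfl h₂ o₁ o₂ hg₁.1 (MGrid.refl _ _) (fun _ _ _ => rfl)
  refine ⟨this.1, fun h => ?_⟩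
  by_contra hc
  have hne := istep_not_asc hg.isInv hu hv
  exact h (this.2 (by omega))

theorem Good.ok_of {z z' : ℤ → ℤ} {G : Grid} {u : Letter} (h : Good z G) {N : ℕ} (hN : Bnd N G)
    (hu : Asc z u) (hz : istep z u.ceil = z') : Ok z' N false G 0 u := by
  obtain ⟨hT, n, hB, hb⟩ := h
  have hb' : Builds (rows G N 0 N) z := by
    rcases le_total n N with h | h
    · rwa [rows_total hB h]
    · rwa [← rows_total hN h]
  refine ⟨hT, hN, Nat.zero_le _, trivial, ?_⟩
  change Builds (cw _ _ _ _) _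
  rw [cw_zero]
  refine ⟨(ascW_append _ _ _).2 ⟨hb'.1, ?_⟩, ?_⟩
  · rw [hb'.2]; exact ⟨hu, trivial⟩
  · rw [irun_append, hb'.2]; exact hz

/-! ### Tableaux as grids -/

def NoEmpty (T : STab) : Prop := ∀ row ∈ T, row ≠ []

theorem entry?_add (T : STab) (r k : ℕ) : entry? T r (r + k) = (T.getD r [])[k]? := by
  unfold entry? entryG?
  rw [if_pos (by omega), List.getD_eq_getElem?_getD]
  cases h : T[r]? <;> simp

theorem entry?_of_lt (T : STab) {r c : ℕ} (h : c < r) : entry? T r c = none := by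
  unfold entry? entryG?
  rw [if_neg (by omega)]

theorem entry?_of_le (T : STab) {r c : ℕ} (h : r ≤ c) : entry? T r c = (T.getD r [])[c - r]? := by
  obtain ⟨k, rfl⟩ := Nat.exists_eq_add_of_le h
  rw [entry?_add, Nat.add_sub_cancel_left]

theorem lt_length_of_entry? {T : STab} {r c : ℕ} {x : Letter} (h : entry? T r c = some x) :
    r < T.length := by
  by_contra hc
  unfold entry? entryG? at h
  rw [List.getElem?_eq_none (by omega)] at h
  simp at h

theorem NoEmpty.diag {T : STab} (h : NoEmpty T) {r : ℕ} (hr : r < T.length) :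
    ∃ x, entry? T r r = some x := by
  have h1 := entry?_add T r 0
  have h2 : T.getD r [] = T[r] := by simp [List.getD_eq_getElem?_getD, hr]
  have h3 := h _ (List.getElem_mem hr)
  rw [h2] at h1
  exact ⟨T[r][0]'(List.length_pos_iff.2 h3), by
    rw [← List.getElem?_eq_getElem]; simpa using h1⟩

theorem entry?_inj {T T' : STab} (h : NoEmpty T) (h' : NoEmpty T')
    (e : entry? T = entry? T') : T = T' := by
  have hl : ∀ {T T' : STab}, NoEmpty T → entry? T = entry? T' → T.length ≤ T'.length := by
    intro T T' h e
    by_contra hc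
    obtain ⟨x, hx⟩ := h.diag (show T'.length < T.length by omega)
    rw [e] at hx
    exact absurd (lt_length_of_entry? hx) (lt_irrefl _)
  have hlen := le_antisymm (hl h e) (hl h' e.symm)
  refine List.ext_getElem hlen fun r h1 h2 => List.ext_getElem? fun k => ?_
  have := entry?_add T r k
  rw [e, entry?_add] at this
  simpa [List.getD_eq_getElem?_getD, h1, h2] using this.symm

theorem NoEmpty.setRowG {T : STab} (h : NoEmpty T) (r : ℕ) {row : List Letter} (hr : row ≠ []) :
    NoEmpty (setRowG T r row) := by
  intro x hx
  unfold _root_.setRowG at hx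
  split_ifs at hx
  · rcases List.mem_or_eq_of_mem_set hx with h1 | rfl
    · exact h x h1
    · exact hr
  · rcases List.mem_append.1 hx with h1 | h1
    · exact h x h1
    · simp at h1; rwa [h1]

theorem getD_setRowG (T : STab) {r : ℕ} (h : r ≤ T.length) (row : List Letter) (i : ℕ) :
    (setRowG T r row).getD i [] = if i = r then row else T.getD i [] := by
  simp only [List.getD_eq_getElem?_getD]
  unfold setRowG
  split_ifs with h1 h2 h2
  · subst h2; simp [h1]
  · rw [List.getElem?_set_ne (by omega)]
  · subst h2
    rw [List.getElem?_append_right (by omega)]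
    simp [show i = T.length by omega]
  · rcases lt_or_ge i T.length with h3 | h3
    · rw [List.getElem?_append_left h3]
    · rw [List.getElem?_append_right h3, List.getElem?_eq_none h3, List.getElem?_eq_none]
      simp; omega

theorem entry?_setRowG (T : STab) {r : ℕ} (h : r ≤ T.length) (row : List Letter) (i j : ℕ) :
    entry? (setRowG T r row) i j =
      if i = r then (if r ≤ j then row[j - r]? else none) else entry? T i j := by
  rcases lt_or_ge j i with hc | hc
  · rw [entry?_of_lt _ hc, entry?_of_lt _ hc]
    split_ifs <;> first | rfl | omega
  · rw [entry?_of_le _ hc, entry?_of_le _ hc, getD_setRowG _ h]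
    split_ifs with h1 h2
    · rw [h1]
    · omega
    · rfl

theorem entry?_setEntryG (T : STab) {r c : ℕ} {y : Letter} (h : entry? T r c = some y) (x : Letter) :
    entry? (setEntryG T r c x) = setG (entry? T) r c (some x) := by
  have hr := lt_length_of_entry? h
  have hrc : r ≤ c := by
    by_contra hc
    rw [entry?_of_lt _ (by omega)] at h; cases h
  have e : setEntryG T r c x = setRowG T r ((T.getD r []).set (c - r) x) := by
    unfold setEntryG setRowG; rw [if_pos hr]
  rw [entry?_of_le _ hrc] at h
  have hlt := (List.getElem?_eq_some_iff.1 h).1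
  funext i j
  rw [e, entry?_setRowG _ hr.le]
  unfold setG
  split_ifs with h1 h2 h3 h3 h3
  · obtain ⟨rfl, rfl⟩ := h3
    rw [List.getElem?_set_self hlt]
  · rw [List.getElem?_set_ne (by omega), h1, entry?_of_le _ h2]
  · omega
  · rw [h1, entry?_of_lt _ (by omega)]
  · omega
  · rfl

theorem NoEmpty.setEntryG {T : STab} (h : NoEmpty T) {r c : ℕ} {y : Letter}
    (hy : entry? T r c = some y) (x : Letter) : NoEmpty (setEntryG T r c x) := by
  have hr := lt_length_of_entry? hy
  have e : _root_.setEntryG T r c x = _root_.setRowG T r ((T.getD r []).set (c - r) x) := by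
    unfold _root_.setEntryG _root_.setRowG; rw [if_pos hr]
  rw [e]
  refine h.setRowG r fun h0 => ?_
  have h0 : T.getD r [] = [] := by simpa using h0
  have hrc : r ≤ c := by
    by_contra hc
    rw [entry?_of_lt _ (by omega)] at hy; cases hy
  rw [entry?_of_le _ hrc, h0] at hy
  simp at hy

theorem findIdx?_of {α : Type*} {l : List α} {P : α → Bool} {p : ℕ} {m : α} (hm : l[p]? = some m)
    (hP : P m = true) (hb : ∀ k x, k < p → l[k]? = some x → P x = false) :
    l.findIdx? P = some p := by
  obtain ⟨hp, e⟩ := List.getElem?_eq_some_iff.1 hm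
  rw [List.findIdx?_eq_some_iff_getElem]
  refine ⟨hp, by rw [e]; exact hP, fun j hj => ?_⟩
  simp [hb j _ hj (List.getElem?_eq_getElem (hj.trans hp))]

theorem findIdx?_none_of {α : Type*} {l : List α} {P : α → Bool}
    (hb : ∀ (k : ℕ) x, l[k]? = some x → P x = false) : l.findIdx? P = none := by
  rw [List.findIdx?_eq_none_iff]
  intro x hx
  obtain ⟨k, hk⟩ := List.mem_iff_getElem?.1 hx
  exact hb k x hk

theorem filterMap_range {α : Type*} (f : ℕ → Option α) (hf : ∀ k, f k = none → f (k + 1) = none)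
    (n : ℕ) : (f n ≠ none → ((List.range (n + 1)).filterMap f).length = n + 1) ∧
      ∀ k, ((List.range (n + 1)).filterMap f)[k]? = if k ≤ n then f k else none := by
  induction n with
  | zero =>
    cases h : f 0 with
    | none =>
      refine ⟨fun h => absurd rfl h, fun k => ?_⟩
      simp [h]; rintro rfl; exact h.symm
    | some a =>
      refine ⟨fun _ => by simp [h], fun k => ?_⟩
      cases k <;> simp [h]
  | succ n ih =>
    rw [List.range_succ, List.filterMap_append]
    cases h : f (n + 1) with
    | none =>
      refine ⟨fun h => absurd rfl h, fun k => ?_⟩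
      simp only [List.filterMap_cons, h, List.filterMap_nil, List.append_nil, ih.2]
      split_ifs with h1 h2 h2
      · rfl
      · omega
      · rw [show k = n + 1 by omega, h]
      · rfl
    | some a =>
      have hl := ih.1 fun h0 => by simp [hf n h0] at h
      refine ⟨fun _ => by simp [h, hl], fun k => ?_⟩
      rcases lt_or_ge k (n + 1) with hk | hk
      · rw [List.getElem?_append_left (by omega), ih.2, if_pos (by omega), if_pos (by omega)]
      · rw [List.getElem?_append_right (by omega), hl]
        rcases hk.lt_or_eq with hk | rfl
        · rw [if_neg (by omega), List.getElem?_eq_none]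
          simp [h]; omega
        · simp [h]

theorem setRowG_set {T : STab} {s : ℕ} (hs : s < T.length) (k : ℕ) (x : Letter) :
    setRowG T s ((T.getD s []).set k x) = setEntryG T s (s + k) x := by
  unfold setRowG setEntryG; rw [if_pos hs, Nat.add_sub_cancel_left]

theorem setRowG_set_set {T : STab} {s : ℕ} (hs : s < T.length) (k l : ℕ) (x y : Letter) :
    setRowG T s (((T.getD s []).set k x).set l y) =
      setEntryG (setEntryG T s (s + k) x) s (s + l) y := by
  unfold setRowG setEntryG
  rw [if_pos hs, Nat.add_sub_cancel_left, Nat.add_sub_cancel_left]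
  simp [List.getD_eq_getElem?_getD, hs]

theorem entry?_append {T : STab} {s e : ℕ} (hs : s ≤ T.length) (he : e = s + (T.getD s []).length)
    (x : Letter) : entry? (setRowG T s (T.getD s [] ++ [x])) = setG (entry? T) s e (some x) := by
  funext i j
  rw [entry?_setRowG _ hs]
  unfold setG
  split_ifs with h1 h2 h3 h3 h3
  · rw [h3.2, he, Nat.add_sub_cancel_left, List.getElem?_append_right le_rfl]; simp
  · subst h1
    rw [entry?_of_le _ h2]
    rcases lt_or_ge (j - i) (T.getD i []).length with h4 | h4
    · rw [List.getElem?_append_left h4]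
    · rw [List.getElem?_append_right h4, List.getElem?_eq_none h4, List.getElem?_eq_none]
      rw [List.length_singleton]; omega
  · omega
  · rw [h1, entry?_of_lt _ (by omega)]
  · omega
  · rfl

theorem switchPrimes_pass (w : ℤ) (a : Bool) :
    switchPrimes ⟨w, a⟩ ⟨w + 1, false⟩ = (⟨w, false⟩, ⟨w + 1, a⟩) := by
  cases a <;> rfl

/-- Either stage of the insertion algorithm. -/
def eg (c : Bool) : ℕ → STab → ℕ → Letter → STab × Bool := if c then egCol else egRow

theorem row_length {T : STab} {s e : ℕ} (hse : s ≤ e) (hn : entry? T s e = none)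
    (hs : ∀ j, s ≤ j → j < e → entry? T s j ≠ none) : e = s + (T.getD s []).length := by
  obtain ⟨k, rfl⟩ := Nat.exists_eq_add_of_le hse
  rw [entry?_add] at hn
  have h1 := List.getElem?_eq_none_iff.1 hn
  by_contra hc
  have := hs (s + (T.getD s []).length) (by omega) (by omega)
  rw [entry?_add] at this
  simp at this

theorem Nx.sim_row {T : STab} {s : ℕ} {w w' : Letter} {c' : Bool} {G' : Grid} (hN : NoEmpty T)
    (hT : Tab (entry? T)) (h : Nx false (entry? T) s w c' G' w') :
    ∃ T', NoEmpty T' ∧ entry? T' = G' ∧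
      ∀ fuel, eg false (fuel + 1) T s w = eg c' fuel T' (s + 1) w' := by
  have hk : ∀ k x, (T.getD s [])[k]? = some x ↔ entry? T s (s + k) = some x := fun k x => by
    rw [entry?_add]
  cases h with
  | rbump _ _ p _ m hsp hm hlt hb =>
    obtain ⟨k, rfl⟩ := Nat.exists_eq_add_of_le hsp.le
    refine ⟨setEntryG T s (s + k) w, hN.setEntryG hm w, entry?_setEntryG T hm w, fun fuel => ?_⟩
    have hk0 : k ≠ 0 := by omega
    have i1 : (T.getD s []).findIdx? (fun x => decide (w.ceil < x.ceil)) = some k :=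
      findIdx?_of ((hk _ _).2 hm) (by simpa using hlt) fun l x hl hx => by
        have := hb (s + l) x (by omega) ((hk _ _).1 hx)
        simp; omega
    have i2 : (T.getD s []).findIdx? (fun x => decide (w.ceil ≤ x.ceil)) = some k :=
      findIdx?_of ((hk _ _).2 hm) (by simpa using hlt.le) fun l x hl hx => by
        have := hb (s + l) x (by omega) ((hk _ _).1 hx)
        simp; omega
    have i3 : (T.getD s []).getD k default = w' := by
      rw [List.getD_eq_getElem?_getD, (hk _ _).2 hm]; rfl
    simp only [eg, Bool.false_eq_true, if_false]
    rw [egRow]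
    simp only [i1, i2, Option.getD_some, i3, if_true, hk0, if_false]
    rw [setRowG_set (lt_length_of_entry? hm)]
  | rpass _ _ p _ a hsp h1 h2 =>
    obtain ⟨k, rfl⟩ := Nat.exists_eq_add_of_le hsp.le
    have h2' : setG (entry? T) s (s + k) (some ⟨w.ceil, false⟩) s (s + k + 1) =
      some ⟨w.ceil + 1, false⟩ := by rw [setG_of_ne _ (by omega)]; exact h2
    have e1 := entry?_setEntryG T h1 ⟨w.ceil, false⟩
    refine ⟨setEntryG (setEntryG T s (s + k) ⟨w.ceil, false⟩) s (s + (k + 1)) ⟨w.ceil + 1, a⟩,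
      (hN.setEntryG h1 _).setEntryG (by rw [e1]; exact h2') _,
      by rw [← add_assoc, entry?_setEntryG _ (by rw [e1]; exact h2'), e1], fun fuel => ?_⟩
    have hk0 : k ≠ 0 := by omega
    have hb : ∀ l x, l < k → (T.getD s [])[l]? = some x → x.ceil < w.ceil := fun l x hl hx => by
      have := hT.lt ((hk _ _).1 hx) h1 le_rfl (by omega)
      simp only at this; omega
    have i1 : (T.getD s []).findIdx? (fun x => decide (w.ceil < x.ceil)) = some (k + 1) :=
      findIdx?_of ((hk _ _).2 h2) (by simp) fun l x hl hx => by
        rcases (show l < k ∨ l = k by omega) with h | rfl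
        · have := hb l x h hx
          simp; omega
        · rw [(hk _ _).2 h1] at hx; cases hx; simp
    have i2 : (T.getD s []).findIdx? (fun x => decide (w.ceil ≤ x.ceil)) = some k :=
      findIdx?_of ((hk _ _).2 h1) (by simp) fun l x hl hx => by
        have := hb l x hl hx
        simp; omega
    have i3 : (T.getD s []).getD k default = ⟨w.ceil, a⟩ := by
      rw [List.getD_eq_getElem?_getD, (hk _ _).2 h1]; rfl
    have i4 : (T.getD s []).getD (k + 1) default = ⟨w.ceil + 1, false⟩ := by
      rw [List.getD_eq_getElem?_getD, (hk _ _).2 h2]; rfl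
    simp only [eg, Bool.false_eq_true, if_false]
    rw [egRow]
    simp only [i1, i2, Option.getD_some, i3, i4, hk0, if_false, switchPrimes_pass,
      show k ≠ k + 1 by omega]
    rw [setRowG_set_set (lt_length_of_entry? h1)]
    rfl
  | dbump _ _ _ m hm hlt =>
    have hm' := (hk 0 m).2 hm
    refine ⟨setEntryG T s s ⟨w.ceil, false⟩, hN.setEntryG hm _, entry?_setEntryG T hm _,
      fun fuel => ?_⟩
    have i1 : (T.getD s []).findIdx? (fun x => decide (w.ceil < x.ceil)) = some 0 :=
      findIdx?_of (hm') (by simpa using hlt) fun l x hl hx => by omega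
    have i2 : (T.getD s []).findIdx? (fun x => decide (w.ceil ≤ x.ceil)) = some 0 :=
      findIdx?_of (hm') (by simpa using hlt.le) fun l x hl hx => by omega
    have i3 : (T.getD s []).getD 0 default = m := by
      rw [List.getD_eq_getElem?_getD, hm']; rfl
    simp only [eg, Bool.false_eq_true, if_false, if_true]
    rw [egRow]
    simp only [i1, i2, Option.getD_some, i3, if_true]
    rw [setRowG_set (lt_length_of_entry? hm)]
    rfl
  | dpass _ _ _ h1 h2 =>
    have h1' := (hk 0 _).2 h1
    have h2' : setG (entry? T) s s (some ⟨w.ceil, false⟩) s (s + 1) =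
      some ⟨w.ceil + 1, false⟩ := by rw [setG_of_ne _ (by omega)]; exact h2
    have e1 := entry?_setEntryG T h1 ⟨w.ceil, false⟩
    refine ⟨setEntryG (setEntryG T s (s + 0) ⟨w.ceil, false⟩) s (s + (0 + 1)) ⟨w.ceil + 1, false⟩,
      (hN.setEntryG h1 _).setEntryG (y := ⟨w.ceil + 1, false⟩) (by rw [← h2', ← e1]) _, ?_, fun fuel => ?_⟩
    · rw [entry?_setEntryG _ (y := ⟨w.ceil + 1, false⟩) (by rw [← h2', ← e1]; rfl), add_zero, e1, setG_self h1, zero_add,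
        setG_self h2]
    have i1 : (T.getD s []).findIdx? (fun x => decide (w.ceil < x.ceil)) = some (0 + 1) :=
      findIdx?_of ((hk _ _).2 h2) (by simp) fun l x hl hx => by
        obtain rfl : l = 0 := by omega
        rw [h1'] at hx; cases hx; simp
    have i2 : (T.getD s []).findIdx? (fun x => decide (w.ceil ≤ x.ceil)) = some 0 :=
      findIdx?_of (h1') (by simp) fun l x hl hx => by omega
    have i3 : (T.getD s []).getD 0 default = ⟨w.ceil, false⟩ := by
      rw [List.getD_eq_getElem?_getD, h1']; rfl
    have i4 : (T.getD s []).getD (0 + 1) default = ⟨w.ceil + 1, false⟩ := by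
      rw [List.getD_eq_getElem?_getD, (hk _ _).2 h2]; rfl
    simp only [eg, Bool.false_eq_true, if_false, if_true]
    rw [egRow]
    simp only [i1, i2, Option.getD_some, i3, i4, if_true, switchPrimes_pass,
      show 0 ≠ 0 + 1 by omega, if_false]
    rw [setRowG_set_set (lt_length_of_entry? h1)]
    rfl

theorem Fin'.sim_row {T : STab} {s r q : ℕ} {w : Letter} {f : Bool} {G' : Grid} (hN : NoEmpty T)
    (hs : s ≤ T.length) (h : Fin' false (entry? T) s w G' r q f) :
    ∃ T', NoEmpty T' ∧ entry? T' = G' ∧ ∀ fuel, eg false (fuel + 1) T s w = (T', f) := by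
  have hk : ∀ k x, (T.getD s [])[k]? = some x ↔ entry? T s (s + k) = some x := fun k x => by
    rw [entry?_add]
  cases h with
  | rend _ _ e _ hse hn hl =>
    have he := row_length hse.le (hn _ le_rfl) fun j h1 h2 => by
      obtain ⟨x, hx, -⟩ := hl j h1 h2
      simp [hx]
    refine ⟨_, hN.setRowG s (by simp), entry?_append hs he w, fun fuel => ?_⟩
    have i1 : (T.getD s []).findIdx? (fun x => decide (w.ceil < x.ceil)) = none :=
      findIdx?_none_of fun k x hx => by
        have hx' := (hk _ _).1 hx
        rcases lt_or_ge (s + k) q with h1 | h1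
        · obtain ⟨y, hy, hlt⟩ := hl _ (by omega) h1
          rw [hx'] at hy; cases hy; simp; omega
        · rw [hn _ h1] at hx'; cases hx'
    have i2 : (T.getD s []).isEmpty = false := by
      rw [List.isEmpty_eq_false_iff, ← List.length_pos_iff]; omega
    simp only [eg, Bool.false_eq_true, if_false]
    rw [egRow]
    simp [i1, i2, -List.getD_eq_getElem?_getD]
  | dend _ _ _ hn =>
    have h0 : T.getD s [] = [] := by
      rw [List.eq_nil_iff_forall_not_mem]
      intro x hx
      obtain ⟨k, hk'⟩ := List.mem_iff_getElem?.1 hx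
      rw [hk, hn _ (by omega)] at hk'; cases hk'
    refine ⟨_, hN.setRowG s (by simp), entry?_append (e := s) hs (by simp [h0, -List.getD_eq_getElem?_getD]) _, fun fuel => ?_⟩
    simp only [eg, Bool.false_eq_true, if_false]
    rw [egRow]
    simp only [h0, List.findIdx?_nil, List.isEmpty_nil, true_and, List.nil_append]
    obtain ⟨wc, wp⟩ := w
    cases wp <;> simp [Letter.unprime]

/-- The list of occupied boxes of a column used by the insertion algorithm. -/
def colOcc (T : STab) (c : ℕ) : List (ℕ × Letter) :=
  (List.range (c + 1)).filterMap (fun r => (entry? T r c).map (fun x => (r, x)))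

theorem colOcc_some {T : STab} (hT : Tab (entry? T)) (c k : ℕ) (y : ℕ × Letter) :
    (colOcc T c)[k]? = some y ↔ y.1 = k ∧ entry? T k c = some y.2 := by
  have h := (filterMap_range (fun r => (entry? T r c).map (fun x => (r, x))) (fun k hk => by
    cases h' : entry? T (k + 1) c with
    | none => rfl
    | some x =>
      obtain ⟨w, hw, -⟩ := hT.down k c x h'
      simp [hw] at hk) c).2 k
  rw [colOcc, h]
  obtain ⟨a, y⟩ := y
  constructor
  · intro e
    split_ifs at e with h1
    cases h2 : entry? T k c with
    | none => simp [h2] at e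
    | some x => simp [h2] at e; exact ⟨e.1.symm, by simp [e.2]⟩
  · rintro ⟨rfl, h2⟩
    rw [if_pos (hT.supp _ _ _ h2)]; simp [h2]

theorem Nx.sim_col {T : STab} {s : ℕ} {w w' : Letter} {c' : Bool} {G' : Grid} (hN : NoEmpty T)
    (hT : Tab (entry? T)) (h : Nx true (entry? T) s w c' G' w') :
    ∃ T', NoEmpty T' ∧ entry? T' = G' ∧
      ∀ fuel, eg true (fuel + 1) T s w = eg c' fuel T' (s + 1) w' := by
  have hk := colOcc_some hT s
  cases h with
  | cbump _ _ p _ m hps hm hlt hb =>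
    refine ⟨setEntryG T p s w, hN.setEntryG hm w, entry?_setEntryG T hm w, fun fuel => ?_⟩
    have hm' := (hk p (p, w')).2 ⟨rfl, hm⟩
    have i1 : (colOcc T s).findIdx? (fun x => decide (w.ceil < x.2.ceil)) = some p :=
      findIdx?_of hm' (by simpa using hlt) fun l x hl hx => by
        have := hb l _ hl ((hk _ _).1 hx).2
        simp; omega
    have i2 : (colOcc T s).findIdx? (fun x => decide (w.ceil ≤ x.2.ceil)) = some p :=
      findIdx?_of hm' (by simpa using hlt.le) fun l x hl hx => by
        have := hb l _ hl ((hk _ _).1 hx).2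
        simp; omega
    have i3 : (colOcc T s).getD p (0, default) = (p, w') := by
      rw [List.getD_eq_getElem?_getD, hm']; rfl
    rw [colOcc] at i1 i2 i3
    simp only [eg, if_true]
    rw [egCol]
    simp only [i1, i2, Option.getD_some, i3, if_true, hps.ne, if_false]
  | cpass _ _ p _ a hps h1 h2 =>
    have h2' : setG (entry? T) p s (some ⟨w.ceil, false⟩) (p + 1) s =
      some ⟨w.ceil + 1, false⟩ := by rw [setG_of_ne _ (by omega)]; exact h2
    have e1 := entry?_setEntryG T h1 ⟨w.ceil, false⟩
    refine ⟨setEntryG (setEntryG T p s ⟨w.ceil, false⟩) (p + 1) s ⟨w.ceil + 1, a⟩,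
      (hN.setEntryG h1 _).setEntryG (by rw [e1]; exact h2') _,
      by rw [entry?_setEntryG _ (by rw [e1]; exact h2'), e1], fun fuel => ?_⟩
    have m1 := (hk p (p, _)).2 ⟨rfl, h1⟩
    have m2 := (hk (p + 1) (p + 1, _)).2 ⟨rfl, h2⟩
    have hb : ∀ l x, l < p → (colOcc T s)[l]? = some x → x.2.ceil < w.ceil := fun l x hl hx => by
      have := hT.lt ((hk _ _).1 hx).2 h1 hl.le (by omega)
      simp only at this; omega
    have i1 : (colOcc T s).findIdx? (fun x => decide (w.ceil < x.2.ceil)) = some (p + 1) :=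
      findIdx?_of m2 (by simp) fun l x hl hx => by
        rcases (show l < p ∨ l = p by omega) with h | rfl
        · have := hb l x h hx
          simp; omega
        · rw [m1] at hx; cases hx; simp
    have i2 : (colOcc T s).findIdx? (fun x => decide (w.ceil ≤ x.2.ceil)) = some p :=
      findIdx?_of m1 (by simp) fun l x hl hx => by
        have := hb l x hl hx
        simp; omega
    have i3 : (colOcc T s).getD p (0, default) = (p, ⟨w.ceil, a⟩) := by
      rw [List.getD_eq_getElem?_getD, m1]; rfl
    have i4 : (colOcc T s).getD (p + 1) (0, default) = (p + 1, ⟨w.ceil + 1, false⟩) := by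
      rw [List.getD_eq_getElem?_getD, m2]; rfl
    rw [colOcc] at i1 i2 i3 i4
    simp only [eg, if_true]
    rw [egCol]
    simp only [i1, i2, Option.getD_some, i3, i4, hps.ne, if_false, switchPrimes_pass,
      show p ≠ p + 1 by omega]
    rfl

theorem Fin'.sim_col {T : STab} {s r q : ℕ} {w : Letter} {f : Bool} {G' : Grid} (hN : NoEmpty T)
    (hT : Tab (entry? T)) (hs : 0 < s) (hr : r ≤ T.length)
    (hv : ∀ j, r ≤ j → j < s → entry? T r j ≠ none)
    (h : Fin' true (entry? T) s w G' r q f) :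
    ∃ T', NoEmpty T' ∧ entry? T' = G' ∧ ∀ fuel, eg true (fuel + 1) T s w = (T', f) := by
  have hk := colOcc_some hT s
  cases h with
  | cend _ _ e _ hse hn hl =>
    have he := row_length hse.le (hn _ le_rfl) hv
    refine ⟨_, hN.setRowG r (by simp), entry?_append hr he w, fun fuel => ?_⟩
    have i1 : (colOcc T s).findIdx? (fun x => decide (w.ceil < x.2.ceil)) = none :=
      findIdx?_none_of fun k x hx => by
        have hx' := ((hk _ _).1 hx).2
        rcases lt_or_ge k r with h1 | h1
        · obtain ⟨y, hy, hlt⟩ := hl _ h1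
          rw [hx'] at hy; cases hy; simp; omega
        · rw [hn _ h1] at hx'; cases hx'
    have i2 : (colOcc T s).length = r := by
      apply le_antisymm
      · by_contra hc
        have h1 := List.getElem?_eq_getElem (l := colOcc T s) (i := r) (by omega)
        have := ((hk _ _).1 h1).2
        rw [hn _ le_rfl] at this; cases this
      · by_contra hc
        obtain ⟨x, hx, -⟩ := hl (colOcc T s).length (by omega)
        have := (hk _ (_, x)).2 ⟨rfl, hx⟩
        simp at this
    rw [colOcc] at i1 i2
    simp only [eg, if_true]
    rw [egCol]
    simp only [i1, i2, hse.ne, if_false, false_and]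

theorem Run.sim {z : ℤ → ℤ} {n s r q : ℕ} {c f : Bool} {w : Letter} {H G' : Grid}
    (h : Run c H s w G' r q f) {T : STab} (hN : NoEmpty T) (hH : entry? T = H)
    (h0 : Ok z n c H s w) {fuel : ℕ} (hf : n + 1 ≤ fuel + s) :
    ∃ T', NoEmpty T' ∧ entry? T' = G' ∧ eg c fuel T s w = (T', f) := by
  induction h generalizing T fuel with
  | @fin c G s w G' r q f hfin =>
    subst hH
    obtain ⟨fuel, rfl⟩ : ∃ k, fuel = k + 1 :=
      ⟨fuel - 1, by have := h0.le; omega⟩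
    have hI := h0.inv
    cases c with
    | false =>
      have hs : s ≤ T.length := by
        cases s with
        | zero => omega
        | succ t =>
          obtain ⟨p, -, ⟨a, h1, -⟩ | ⟨a, b, h1, -⟩⟩ := hI
          · exact lt_length_of_entry? h1
          · exact lt_length_of_entry? h1
      obtain ⟨T', h1, h2, h3⟩ := hfin.sim_row hN hs
      exact ⟨T', h1, h2, h3 fuel⟩
    | true =>
      have key : r ≤ T.length ∧ 0 < s ∧ ∀ j, r ≤ j → j < s → entry? T r j ≠ none := by
        cases hfin with
        | cend _ _ e _ hse hn hl =>
          cases s with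
          | zero => exact hI.elim
          | succ t =>
            obtain ⟨p, hp, ⟨a, h1, h2, h3⟩ | ⟨a, b, h1, h2, h3, h4⟩ | ⟨h1, h2, h3⟩⟩ := hI
            · have hrp : r ≤ p := by
                by_contra hc
                obtain ⟨x, hx, hlt⟩ := hl p (by omega)
                have := h3 x hx
                omega
              have := lt_length_of_entry? h1
              refine ⟨by omega, by omega, fun j h4 h5 => ?_⟩
              obtain ⟨x, hx, -⟩ := h0.tab.le h1 hrp (show j ≤ t by omega) h4
              simp [hx]
            · exfalso
              rcases lt_or_ge p r with hc | hc
              · obtain ⟨x, hx, hlt⟩ := hl p hc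
                rw [h3] at hx; cases hx; omega
              · rw [hn p hc] at h3; cases h3
            · exfalso
              rcases lt_or_ge t r with hc | hc
              · obtain ⟨x, hx, hlt⟩ := hl t hc
                rw [h2] at hx; cases hx; simp at hlt
              · rw [hn t hc] at h2; cases h2
      obtain ⟨T', h1, h2, h3⟩ := hfin.sim_col hN h0.tab key.2.1 key.1 key.2.2
      exact ⟨T', h1, h2, h3 fuel⟩
  | @step c G s w c₁ G₁ w₁ G' r q f hn hr ih =>
    subst hH
    obtain ⟨fuel, rfl⟩ : ∃ k, fuel = k + 1 :=
      ⟨fuel - 1, by have := h0.le; omega⟩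
    have h1 := nx_ok h0 hn
    have : ∃ T', NoEmpty T' ∧ entry? T' = G₁ ∧
        ∀ fuel, eg c (fuel + 1) T s w = eg c₁ fuel T' (s + 1) w₁ := by
      cases c with
      | false => exact hn.sim_row hN h0.tab
      | true => exact hn.sim_col hN h0.tab
    obtain ⟨T', a1, a2, a3⟩ := this
    obtain ⟨T'', b1, b2, b3⟩ := ih a1 a2 h1 (fuel := fuel) (by omega)
    exact ⟨T'', b1, b2, by rw [a3, b3]⟩

theorem bnd_entry? (T : STab) : Bnd (T.flatten.length + T.length) (entry? T) := by
  intro i j h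
  by_contra hc
  obtain ⟨x, hx⟩ := Option.ne_none_iff_exists'.1 hc
  have h1 := lt_length_of_entry? hx
  have h2 : i ≤ j := by
    by_contra h2
    rw [entry?_of_lt _ (by omega)] at hx; cases hx
  rw [entry?_of_le _ h2] at hx
  obtain ⟨h3, -⟩ := List.getElem?_eq_some_iff.1 hx
  have h4 : (T.getD i []).length ≤ T.flatten.length := by
    rw [List.getD_eq_getElem _ _ h1]
    exact (List.sublist_flatten_of_mem (List.getElem_mem h1)).length_le
  omega

/-- The insertion relation determines the output of the insertion algorithm. -/
theorem Ins.egInsert {z : ℤ → ℤ} {u : Letter} {G' : Grid} {r q : ℕ} {f : Bool} {T : STab}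
    (h : Ins (entry? T) u G' r q f) (hN : NoEmpty T) (hg : Good z (entry? T)) (hu : Asc z u) :
    NoEmpty (egInsert T u).1 ∧ entry? (egInsert T u).1 = G' ∧ (egInsert T u).2 = f := by
  have h0 := hg.ok_of (bnd_entry? T) hu rfl
  obtain ⟨T', h1, h2, h3⟩ := Run.sim h hN rfl h0
    (fuel := T.flatten.length + T.length + 2) (by omega)
  have : _root_.egInsert T u = (T', f) := by
    rw [← h3]; rfl
  rw [this]
  exact ⟨h1, h2, rfl⟩

theorem Letter.le_iff (a b : Letter) : a ≤ b ↔
    a.ceil < b.ceil ∨ (a.ceil = b.ceil ∧ (a.primed = true ∨ b.primed = false)) := by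
  change toLex (a.ceil, !a.primed) ≤ toLex (b.ceil, !b.primed) ↔ _
  rw [Prod.Lex.toLex_le_toLex]
  cases a.primed <;> cases b.primed <;> simp

theorem Letter.lt_iff (a b : Letter) : a < b ↔
    a.ceil < b.ceil ∨ (a.ceil = b.ceil ∧ a.primed = true ∧ b.primed = false) := by
  change toLex (a.ceil, !a.primed) < toLex (b.ceil, !b.primed) ↔ _
  rw [Prod.Lex.toLex_lt_toLex]
  cases a.primed <;> cases b.primed <;> simp

/-- Semistandardness of a grid. -/
structure Semi (S : Grid) : Prop where
  pos : ∀ r c x, S r c = some x → 0 < x.ceil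
  row : ∀ r c x y, S r c = some x → S r (c + 1) = some y → x ≤ y
  col : ∀ r c x y, S r c = some x → S (r + 1) c = some y → x ≤ y
  row_rep : ∀ r c c' x, c < c' → S r c = some x → S r c' = some x → x.primed = false
  col_rep : ∀ r r' c x, r < r' → S r c = some x → S r' c = some x → x.primed = true

/-- The entry `x` of `S` in box `(r, q)` is the last one in the standardization order. -/
structure Last (S : Grid) (r q : ℕ) (x : Letter) : Prop where
  eq : S r q = some x
  max : ∀ a b y, S a b = some y → (a ≠ r ∨ b ≠ q) →
    y < x ∨ (y = x ∧ (x.primed = false → b < q) ∧ (x.primed = true → a < r))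

theorem Last.unique {S : Grid} {r q r' q' : ℕ} {x x' : Letter} (h : Last S r q x)
    (h' : Last S r' q' x') : r = r' ∧ q = q' ∧ x = x' := by
  have hb : r = r' ∧ q = q' := by
    by_contra hc
    rcases h.max _ _ _ h'.eq (by omega) with h1 | ⟨h1, h2, h3⟩ <;>
      rcases h'.max _ _ _ h.eq (by omega) with h4 | ⟨h4, h5, h6⟩
    · exact lt_asymm h1 h4
    · exact h1.ne h4.symm
    · exact h4.ne h1.symm
    · subst h1
      cases hp : x'.primed with
      | false => have := h2 hp; have := h5 hp; omega
      | true => have := h3 hp; have := h6 hp; omega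
  obtain ⟨rfl, rfl⟩ := hb
  exact ⟨rfl, rfl, Option.some.inj (h.eq.symm.trans h'.eq)⟩

theorem Semi.erase {S : Grid} (h : Semi S) (r q : ℕ) : Semi (setG S r q none) := by
  have key : ∀ a b x, setG S r q none a b = some x → S a b = some x := by
    intro a b x e
    unfold setG at e; split_ifs at e; exact e
  exact ⟨fun a c x e => h.pos a c x (key _ _ _ e),
    fun a c x y e e' => h.row a c x y (key _ _ _ e) (key _ _ _ e'),
    fun a c x y e e' => h.col a c x y (key _ _ _ e) (key _ _ _ e'),
    fun a c c' x hc e e' => h.row_rep a c c' x hc (key _ _ _ e) (key _ _ _ e'),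
    fun a c c' x hc e e' => h.col_rep a c c' x hc (key _ _ _ e) (key _ _ _ e')⟩

theorem Last.le {S : Grid} {r q a b : ℕ} {x y : Letter} (hl : Last S r q x)
    (e : S a b = some y) : y ≤ x := by
  by_cases hc : a ≠ r ∨ b ≠ q
  · rcases hl.max _ _ _ e hc with h | ⟨h, -⟩
    · exact h.le
    · exact h.le
  · obtain ⟨rfl, rfl⟩ : a = r ∧ b = q := by omega
    rw [hl.eq] at e; cases e; exact le_rfl

theorem Semi.add {S : Grid} {r q : ℕ} {x : Letter} (h : Semi S) (hx : 0 < x.ceil)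
    (hn : S r q = none) (hr : S r (q + 1) = none) (hu : S (r + 1) q = none)
    (hl : Last (setG S r q (some x)) r q x) : Semi (setG S r q (some x)) := by
  have key : ∀ a b y, setG S r q (some x) a b = some y →
      (a = r ∧ b = q ∧ y = x) ∨ ((a ≠ r ∨ b ≠ q) ∧ S a b = some y) := by
    intro a b y e
    by_cases hc : a = r ∧ b = q
    · rw [hc.1, hc.2, setG_same] at e; cases e; exact Or.inl ⟨hc.1, hc.2, rfl⟩
    · have hc' : a ≠ r ∨ b ≠ q := by omega
      rw [setG_of_ne _ hc'] at e; exact Or.inr ⟨hc', e⟩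
  refine ⟨fun a c y e => ?_, fun a c y y' e e' => ?_, fun a c y y' e e' => ?_,
    fun a c c' y hc e e' => ?_, fun a a' c y hc e e' => ?_⟩
  · rcases key _ _ _ e with ⟨-, -, rfl⟩ | ⟨-, e1⟩
    · exact hx
    · exact h.pos _ _ _ e1
  · rcases key _ _ _ e' with ⟨-, -, rfl⟩ | ⟨-, e2⟩
    · exact hl.le e
    · rcases key _ _ _ e with ⟨rfl, rfl, rfl⟩ | ⟨-, e1⟩
      · rw [hr] at e2; cases e2
      · exact h.row _ _ _ _ e1 e2
  · rcases key _ _ _ e' with ⟨-, -, rfl⟩ | ⟨-, e2⟩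
    · exact hl.le e
    · rcases key _ _ _ e with ⟨rfl, rfl, rfl⟩ | ⟨-, e1⟩
      · rw [hu] at e2; cases e2
      · exact h.col _ _ _ _ e1 e2
  · rcases key _ _ _ e' with ⟨ha, hc', rfl⟩ | ⟨h2, e2⟩
    · rcases hl.max _ _ _ e (by omega) with h1 | ⟨-, -, h1⟩
      · exact absurd rfl h1.ne
      · cases hp : y.primed with
        | false => rfl
        | true => have := h1 hp; omega
    · rcases key _ _ _ e with ⟨ha, hc', rfl⟩ | ⟨-, e1⟩
      · rcases hl.max _ _ _ e' h2 with h1 | ⟨-, h3, h1⟩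
        · exact absurd rfl h1.ne
        · cases hp : y.primed with
          | false => rfl
          | true => have := h1 hp; omega
      · exact h.row_rep _ _ _ _ hc e1 e2
  · rcases key _ _ _ e' with ⟨ha, hc', rfl⟩ | ⟨h2, e2⟩
    · rcases hl.max _ _ _ e (by omega) with h1 | ⟨-, h1, -⟩
      · exact absurd rfl h1.ne
      · cases hp : y.primed with
        | true => rfl
        | false => have := h1 hp; omega
    · rcases key _ _ _ e with ⟨ha, hc', rfl⟩ | ⟨-, e1⟩
      · rcases hl.max _ _ _ e' h2 with h1 | ⟨-, h1, h3⟩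
        · exact absurd rfl h1.ne
        · cases hp : y.primed with
          | true => rfl
          | false => have := h1 hp; omega
      · exact h.col_rep _ _ _ _ hc e1 e2

/-- The boxes added by two consecutive insertions are in different rows and columns or ordered. -/
theorem corner_order {G₁ G₂ : Grid} {r₁ q₁ r₂ q₂ : ℕ} {x₁ x₂ : Letter} (h₁ : Tab G₁) (h₂ : Tab G₂)
    (c₁ : Corner G₁ r₁ q₁ x₁) (c₂ : Corner G₂ r₂ q₂ x₂) (hn : G₁ r₂ q₂ = none)
    (hs : ∀ a b, a ≠ r₂ ∨ b ≠ q₂ → (G₂ a b).isSome = (G₁ a b).isSome) :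
    (r₂ ≤ r₁ ∧ q₁ < q₂) ∨ (r₁ < r₂ ∧ q₂ ≤ q₁) := by
  have hrq := h₂.supp _ _ _ c₂.eq
  have hrq₁ := h₁.supp _ _ _ c₁.eq
  by_contra hc
  rcases le_or_gt r₂ r₁ with h | h
  · obtain ⟨y, hy, -⟩ := h₁.le c₁.eq h (show q₂ ≤ q₁ by omega) hrq
    rw [hn] at hy; cases hy
  · obtain ⟨y, hy, -⟩ := h₂.le c₂.eq h.le (show q₁ + 1 ≤ q₂ by omega) (by omega)
    have := hs r₁ (q₁ + 1) (by omega)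
    rw [hy, c₁.right] at this; cases this

/-- Biwords, insertion tableaux and recording tableaux. -/
inductive Rec : (ℤ → ℤ) → List (ℤ × Letter) → Grid → Grid → Prop
  | nil : Rec id [] (fun _ _ => none) (fun _ _ => none)
  | snoc {z z' : ℤ → ℤ} {b b' : List (ℤ × Letter)} {G S S' G' : Grid} {i : ℤ} {u : Letter}
      {r q : ℕ} {f : Bool} : Rec z b G S → 1 ≤ i →
      (∀ p ∈ b.getLast?, p.1 < i ∨ (p.1 = i ∧ p.2.ceil < u.ceil)) → Asc z u →
      Ins G u G' r q f → z' = istep z u.ceil → b' = b ++ [(i, u)] →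
      S' = setG S r q (some ⟨i, f⟩) → Rec z' b' G' S'

theorem good_nil : Good id (fun _ _ => none) :=
  ⟨⟨by simp, by simp, by simp, by simp⟩, 0, fun _ _ _ => rfl, trivial, rfl⟩

theorem Good.shape {z : ℤ → ℤ} {G G' : Grid} {u : Letter} {r q : ℕ} {f : Bool} (h : Good z G)
    (hu : Asc z u) (hi : Ins G u G' r q f) : (∃ x, Corner G' r q x) ∧ G r q = none ∧
      ∀ a b, a ≠ r ∨ b ≠ q → (G' a b).isSome = (G a b).isSome := by
  obtain ⟨n, hn⟩ := h.ok hu rfl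
  exact Run.shape hi hn

theorem Rec.good {z : ℤ → ℤ} {b : List (ℤ × Letter)} {G S : Grid} (h : Rec z b G S) :
    Good z G ∧ ∀ a c, (S a c).isSome = (G a c).isSome := by
  induction h with
  | nil => exact ⟨good_nil, fun _ _ => rfl⟩
  | snoc _ _ _ hu hi hz hb hS ih =>
    subst hz hb hS
    refine ⟨hi.good ih.1 hu rfl, fun a c => ?_⟩
    obtain ⟨⟨x, hc⟩, -, hs⟩ := ih.1.shape hu hi
    unfold setG
    split_ifs with h1
    · rw [h1.1, h1.2, hc.eq]; rfl
    · rw [hs a c (by omega), ih.2]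

theorem isSome_none {G S : Grid} (h : ∀ a c, (S a c).isSome = (G a c).isSome) {a c : ℕ}
    (e : G a c = none) : S a c = none := by
  have := h a c
  rw [e] at this
  simpa using this

theorem setG_new {S : Grid} {r q : ℕ} (x : Option Letter) (h : S r q = none) :
    setG (setG S r q x) r q none = S := by
  funext a c
  unfold setG
  split_ifs with h1
  · rw [h1.1, h1.2, h]
  · rfl

theorem Rec.inv {z : ℤ → ℤ} {b : List (ℤ × Letter)} {G S : Grid} (h : Rec z b G S) :
    Semi S ∧ ∀ p ∈ b.getLast?, ∃ r q f, Last S r q ⟨p.1, f⟩ ∧ ∃ z₀ b₀ G₀,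
      Rec z₀ b₀ G₀ (setG S r q none) ∧ Asc z₀ p.2 ∧ Ins G₀ p.2 G r q f ∧
      z = istep z₀ p.2.ceil ∧ b = b₀ ++ [p] := by
  induction h with
  | nil => exact ⟨⟨by simp, by simp, by simp, by simp, by simp⟩, by simp⟩
  | @snoc z z' b b' G S S' G' i u r q f h0 hi0 hp hu hi hz hb hS ih =>
    subst hz hb hS
    obtain ⟨hg, hs⟩ := h0.good
    obtain ⟨⟨x, hc⟩, hn, hs'⟩ := hg.shape hu hi
    have hg' := hi.good hg hu rfl
    have hl : Last (setG S r q (some ⟨i, f⟩)) r q ⟨i, f⟩ := by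
      refine ⟨setG_same _ _ _ _, fun a c y e hac => ?_⟩
      rw [setG_of_ne _ hac] at e
      cases hbl : b.getLast? with
      | none =>
        obtain rfl : b = [] := by simpa using hbl
        cases h0 with
        | nil => cases e
        | snoc _ _ _ _ _ _ hb => simp at hb
      | some p =>
        obtain ⟨r₁, q₁, f₁, hl₁, z₀, b₀, G₀, hr₀, hu₀, hi₀, rfl, -⟩ := ih.2 p hbl
        have hg₀ := hr₀.good.1
        have hyx : y < ⟨p.1, f₁⟩ ∨ (y = ⟨p.1, f₁⟩ ∧ (f₁ = false → c ≤ q₁) ∧ (f₁ = true → a ≤ r₁)) := by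
          by_cases hac₁ : a ≠ r₁ ∨ c ≠ q₁
          · rcases hl₁.max _ _ _ e hac₁ with h1 | ⟨h1, h2, h3⟩
            · exact Or.inl h1
            · exact Or.inr ⟨h1, fun h => (h2 h).le, fun h => (h3 h).le⟩
          · obtain ⟨rfl, rfl⟩ : a = r₁ ∧ c = q₁ := by omega
            rw [hl₁.eq] at e; cases e; exact Or.inr ⟨rfl, fun _ => le_rfl, fun _ => le_rfl⟩
        have hx : (⟨p.1, f₁⟩ : Letter) < ⟨i, f⟩ ∨ (p.1 = i ∧ f₁ = f ∧ (f₁ = false → q₁ < q) ∧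
            (f₁ = true → r₁ < r)) := by
          rcases hp p hbl with h1 | ⟨h1, h2⟩
          · left; rw [Letter.lt_iff]; exact Or.inl h1
          · have hd := (Ins.des hg₀ hu₀ hu hi₀ hi).1 h2
            obtain ⟨⟨x₁, hc₁⟩, -⟩ := hg₀.shape hu₀ hi₀
            have ho := corner_order hg.1 hg'.1 hc₁ hc hn hs'
            unfold Des at hd
            rw [Letter.lt_iff]
            cases f₁ <;> cases f <;> simp at hd ⊢ <;> omega
        rcases hyx with h1 | ⟨rfl, h2, h3⟩ <;> rcases hx with h4 | ⟨rfl, rfl, h5, h6⟩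
        · exact Or.inl (h1.trans h4)
        · exact Or.inl h1
        · exact Or.inl h4
        · exact Or.inr ⟨rfl, fun h => (h2 h).trans_lt (h5 h), fun h => (h3 h).trans_lt (h6 h)⟩
    refine ⟨ih.1.add (by simp only; omega) (isSome_none hs hn) ?_ ?_ hl, ?_⟩
    · have := hs' r (q + 1) (by omega)
      rw [hc.right] at this
      exact isSome_none hs (by simpa using this)
    · have := hs' (r + 1) q (by omega)
      rw [hc.up] at this
      exact isSome_none hs (by simpa using this)
    · intro p hp'
      simp at hp'
      subst hp'
      refine ⟨r, q, f, hl, z, b, G, ?_, hu, hi, rfl, rfl⟩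
      rw [setG_new _ (isSome_none hs hn)]
      exact h0

/-- Ordering condition for biwords. -/
structure BiOrd (b : List (ℤ × Letter)) : Prop where
  pos : ∀ p ∈ b, 1 ≤ p.1
  chain : b.IsChain (fun p p' => p.1 < p'.1 ∨ (p.1 = p'.1 ∧ p.2.ceil < p'.2.ceil))

theorem Rec.builds {z : ℤ → ℤ} {b : List (ℤ × Letter)} {G S : Grid} (h : Rec z b G S) :
    Builds (b.map Prod.snd) z ∧ BiOrd b := by
  induction h with
  | nil => exact ⟨⟨trivial, rfl⟩, by simp, by simp⟩
  | @snoc z z' b b' G S S' G' i u r q f h0 hi0 hp hu hi hz hb hS ih =>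
    subst hz hb hS
    obtain ⟨⟨h1, h2⟩, h3, h4⟩ := ih
    refine ⟨⟨?_, ?_⟩, ?_, ?_⟩
    · rw [List.map_append, ascW_append, h2]
      exact ⟨h1, hu, trivial⟩
    · rw [List.map_append, irun_append, h2]; rfl
    · intro p hp'
      rcases List.mem_append.1 hp' with h | h
      · exact h3 p h
      · rw [List.mem_singleton] at h; subst h; exact hi0
    · rw [List.isChain_append]
      refine ⟨h4, by simp, fun x hx y hy => ?_⟩
      simp at hy; subst hy
      exact hp x hx

theorem Rec.of_builds (b : List (ℤ × Letter)) (hb : AscW id (b.map Prod.snd)) (ho : BiOrd b) :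
    ∃ G S, Rec (irun id (b.map Prod.snd)) b G S := by
  induction b using List.reverseRecOn with
  | nil => exact ⟨_, _, Rec.nil⟩
  | append_singleton b p ih =>
    rw [List.map_append, ascW_append] at hb
    have hc := List.isChain_append.1 ho.chain
    obtain ⟨G, S, h⟩ := ih hb.1 ⟨fun p hp => ho.pos p (List.mem_append_left _ hp), hc.1⟩
    obtain ⟨G', r, q, f, hi⟩ := h.good.1.ins hb.2.1 rfl
    refine ⟨G', _, Rec.snoc h (ho.pos p (by simp)) (fun p' hp' => hc.2.2 p' hp' p (by simp)) hb.2.1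
      hi ?_ rfl rfl⟩
    rw [List.map_append, irun_append]; rfl

theorem PEG_append (a : PWord) (u : Letter) : PEG (a ++ [u]) = (egInsert (PEG a) u).1 := by
  unfold PEG; rw [List.foldl_append]; rfl

theorem Rec.peg {z : ℤ → ℤ} {b : List (ℤ × Letter)} {G S : Grid} (h : Rec z b G S) :
    NoEmpty (PEG (b.map Prod.snd)) ∧ entry? (PEG (b.map Prod.snd)) = G := by
  induction h with
  | nil =>
    refine ⟨by simp [NoEmpty, PEG], ?_⟩
    funext i j
    simp [PEG, entry?, entryG?]
  | @snoc z z' b b' G S S' G' i u r q f h0 hi0 hp hu hi hz hb hS ih =>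
    subst hz hb hS
    rw [List.map_append, List.map_singleton, PEG_append]
    obtain ⟨h1, rfl⟩ := ih
    have := hi.egInsert h1 h0.good.1 hu
    exact ⟨this.1, this.2.1⟩

theorem Rec.fwd_unique {z z' : ℤ → ℤ} {b : List (ℤ × Letter)} {G S G' S' : Grid} (h : Rec z b G S)
    (h' : Rec z' b G' S') : z = z' ∧ G = G' ∧ S = S' := by
  refine ⟨h.builds.1.2.symm.trans h'.builds.1.2, h.peg.2.symm.trans h'.peg.2, ?_⟩
  induction h generalizing z' G' S' with
  | nil =>
    cases h' with
    | nil => rfl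
    | snoc _ _ _ _ _ _ hb => simp at hb
  | @snoc z z₁ b b' G S S₁ G₁ i u r q f h0 hi0 hp hu hi hz hb hS ih =>
    cases h' with
    | nil => simp at hb
    | @snoc z₂ _ b₂ _ G₂ S₂ _ _ i₂ u₂ r₂ q₂ f₂ h2 hi2 hp2 hu2 hii2 hz2 hb2 hS2 =>
      rw [hb] at hb2
      obtain ⟨rfl, e⟩ := List.append_inj' hb2 rfl
      simp at e
      obtain ⟨rfl, rfl⟩ := e
      have e1 := ih h2
      subst e1
      have eG : G = G₂ := h0.peg.2.symm.trans h2.peg.2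
      subst eG
      have ez : z = z₂ := h0.builds.1.2.symm.trans h2.builds.1.2
      subst ez
      have hg := h0.good.1
      obtain ⟨hN, hT⟩ := h0.peg
      subst hT
      have a1 := hi.egInsert hN hg hu
      have a2 := hii2.egInsert hN hg hu
      have ef : f = f₂ := a1.2.2.symm.trans a2.2.2
      have eG' : G₁ = G' := a1.2.1.symm.trans a2.2.1
      subst ef eG'
      obtain ⟨⟨x, hc⟩, hn, hs⟩ := hg.shape hu hi
      obtain ⟨⟨x2, hc2⟩, hn2, hs2⟩ := hg.shape hu hii2
      have : r = r₂ ∧ q = q₂ := by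
        by_contra hcon
        have := hs2 r q (by omega)
        rw [hc.eq, hn] at this; cases this
      rw [hS, hS2, this.1, this.2]

theorem Corner.shape {G S : Grid} {r q : ℕ} {x : Letter} (h : ∀ a c, (S a c).isSome = (G a c).isSome)
    (hc : Corner S r q x) : ∃ y, Corner G r q y := by
  have h1 := h r q
  rw [hc.eq] at h1
  obtain ⟨y, hy⟩ := Option.isSome_iff_exists.1 h1.symm
  exact ⟨y, hy, isSome_none (fun a c => (h a c).symm) hc.right,
    isSome_none (fun a c => (h a c).symm) hc.up⟩

theorem Rec.bwd_unique {z z' : ℤ → ℤ} {b b' : List (ℤ × Letter)} {G S : Grid} (h : Rec z b G S)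
    (h' : Rec z' b' G S) : b = b' := by
  induction hn : b.length generalizing z z' b b' G S with
  | zero =>
    obtain rfl : b = [] := by simpa using hn
    rcases List.eq_nil_or_concat b' with rfl | ⟨b₁, p, rfl⟩
    · rfl
    · obtain ⟨r, q, f, hl, -⟩ := h'.inv.2 p (by simp)
      cases h with
      | nil => cases hl.eq
      | snoc _ _ _ _ _ _ hb => simp at hb
  | succ n ih =>
    rcases List.eq_nil_or_concat b with rfl | ⟨b₁, p, rfl⟩
    · simp at hn
    obtain ⟨r, q, f, hl, z₀, b₀, G₀, hr, hu, hi, rfl, hb⟩ := h.inv.2 p (by simp)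
    rcases List.eq_nil_or_concat b' with rfl | ⟨b₂, p', rfl⟩
    · cases h' with
      | nil => cases hl.eq
      | snoc _ _ _ _ _ _ hb => simp at hb
    obtain ⟨r', q', f', hl', z₀', b₀', G₀', hr', hu', hi', rfl, hb'⟩ := h'.inv.2 p' (by simp)
    obtain ⟨rfl, rfl, e⟩ := hl.unique hl'
    simp only [Letter.mk.injEq] at e
    obtain ⟨e, rfl⟩ := e
    obtain ⟨rfl, e'⟩ := Ins.inj (z := id) hi hi' hr.good.1 hr'.good.1 hu hu'
    have hlen : b₀.length = n := by rw [hb] at hn; simpa using hn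
    rw [hb, hb', ih hr hr' hlen, show p = p' from Prod.ext e e']

theorem Semi.exists_last {S : Grid} {n : ℕ} (hS : Semi S) (hB : Bnd n S)
    (he : ∃ a c, S a c ≠ none) : ∃ r q x, Last S r q x ∧ Corner S r q x := by
  classical
  obtain ⟨a, c, hac⟩ := he
  let F : Finset (ℕ × ℕ) := (Finset.range n ×ˢ Finset.range n).filter (fun p => S p.1 p.2 ≠ none)
  have hF : ∀ p, p ∈ F ↔ S p.1 p.2 ≠ none := fun p => by
    simp only [F, Finset.mem_filter, Finset.mem_product, Finset.mem_range, and_iff_right_iff_imp]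
    intro h
    by_contra hc
    exact h (hB _ _ (by omega))
  obtain ⟨p, hp, hmax⟩ := F.exists_max_image (fun p => (S p.1 p.2).getD default) ⟨(a, c), (hF _).2 hac⟩
  obtain ⟨x, hx⟩ := Option.ne_none_iff_exists'.1 ((hF p).1 hp)
  have hle : ∀ a c y, S a c = some y → y ≤ x := fun a c y e => by
    have := hmax (a, c) ((hF _).2 (by simp [e]))
    simpa [e, hx] using this
  let E := F.filter (fun p => S p.1 p.2 = some x)
  have hE : ∀ p, p ∈ E ↔ S p.1 p.2 = some x := fun p => by
    simp only [E, Finset.mem_filter, hF, and_iff_right_iff_imp]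
    intro h; simp [h]
  obtain ⟨k, hk, hkmax⟩ := E.exists_max_image (fun p => if x.primed then p.1 else p.2) ⟨p, (hE p).2 hx⟩
  obtain ⟨r, q⟩ := k
  have hrq := (hE _).1 hk
  simp only at hrq
  have key : ∀ a b, S a b = some x → (a ≠ r ∨ b ≠ q) → (x.primed = false → b < q) ∧
      (x.primed = true → a < r) := by
    intro a b e hab
    have := hkmax (a, b) ((hE _).2 e)
    refine ⟨fun hp => ?_, fun hp => ?_⟩ <;> simp only [hp, if_true, Bool.false_eq_true, if_false] at this
    · rcases this.lt_or_eq with h | rfl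
      · exact h
      · exfalso
        rcases lt_or_gt_of_ne (show a ≠ r by omega) with h | h
        · have := hS.col_rep _ _ _ _ h e hrq; simp [hp] at this
        · have := hS.col_rep _ _ _ _ h hrq e; simp [hp] at this
    · rcases this.lt_or_eq with h | rfl
      · exact h
      · exfalso
        rcases lt_or_gt_of_ne (show b ≠ q by omega) with h | h
        · have := hS.row_rep _ _ _ _ h e hrq; simp [hp] at this
        · have := hS.row_rep _ _ _ _ h hrq e; simp [hp] at this
  refine ⟨r, q, x, ⟨hrq, fun a b y e hab => ?_⟩, hrq, ?_, ?_⟩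
  · rcases (hle a b y e).lt_or_eq with h | rfl
    · exact Or.inl h
    · exact Or.inr ⟨rfl, key a b e hab⟩
  · by_contra hc
    obtain ⟨y, hy⟩ := Option.ne_none_iff_exists'.1 hc
    obtain rfl := le_antisymm (hle _ _ _ hy) (hS.row _ _ _ _ hrq hy)
    have h1 := hS.row_rep _ _ _ _ (Nat.lt_succ_self q) hrq hy
    have := (key _ _ hy (by omega)).1 h1
    omega
  · by_contra hc
    obtain ⟨y, hy⟩ := Option.ne_none_iff_exists'.1 hc
    obtain rfl := le_antisymm (hle _ _ _ hy) (hS.col _ _ _ _ hrq hy)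
    have h1 := hS.col_rep _ _ _ _ (Nat.lt_succ_self r) hrq hy
    have := (key _ _ hy (by omega)).2 h1
    omega

theorem Good.eq_nil {z : ℤ → ℤ} {G : Grid} (h : Good z G) (he : ∀ a c, G a c = none) :
    z = id ∧ G = fun _ _ => none := by
  have e : G = fun _ _ => none := by funext a c; exact he a c
  obtain ⟨-, n, -, hb⟩ := h
  refine ⟨?_, e⟩
  have : rows G n 0 n = [] := by
    rw [List.eq_nil_iff_forall_not_mem]
    intro x hx
    obtain ⟨i, j, -, -, -, hij⟩ := mem_rows.1 hx
    rw [he] at hij; cases hij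
  rw [this] at hb
  exact hb.2.symm

theorem Rec.exists_of_semi {z : ℤ → ℤ} {G S : Grid} (hg : Good z G) (hS : Semi S)
    (hs : ∀ a c, (S a c).isSome = (G a c).isSome) : ∃ b, Rec z b G S := by
  obtain ⟨k, hk⟩ : ∃ k, Set.ncard {p : ℕ × ℕ | S p.1 p.2 ≠ none} = k := ⟨_, rfl⟩
  obtain ⟨n, hB, -⟩ := hg.2
  have hBS : Bnd n S := fun i j h => isSome_none hs (hB i j h)
  induction k using Nat.strong_induction_on generalizing z G S n with
  | _ k ih =>
  by_cases he : ∃ a c, S a c ≠ none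
  · obtain ⟨r, q, x, hl, hc⟩ := hS.exists_last hBS he
    obtain ⟨y, hcG⟩ := hc.shape hs
    obtain ⟨z₀, G₀, u, hg₀, hu, hz, hi⟩ := hg.uninsert hcG x.primed
    obtain ⟨-, hn, hsh⟩ := hg₀.shape hu hi
    have hs₀ : ∀ a c, (setG S r q none a c).isSome = (G₀ a c).isSome := fun a c => by
      unfold setG
      split_ifs with h1
      · rw [h1.1, h1.2, hn]
      · rw [hs, hsh a c (by omega)]
    obtain ⟨n₀, hB₀, -⟩ := hg₀.2
    have hfin : {p : ℕ × ℕ | S p.1 p.2 ≠ none}.Finite :=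
      (Finset.finite_toSet (Finset.range n ×ˢ Finset.range n)).subset fun p hp => by
        simp only [Finset.coe_product, Finset.coe_range, Set.mem_prod, Set.mem_Iio]
        by_contra hcon
        exact hp (hBS _ _ (by omega))
    have hlt : Set.ncard {p : ℕ × ℕ | setG S r q none p.1 p.2 ≠ none} < k := by
      rw [← hk]
      apply Set.ncard_lt_ncard _ hfin
      rw [Set.ssubset_iff_of_subset]
      · exact ⟨(r, q), by simp [hc.eq], by simp [setG_same]⟩
      · intro p hp
        simp only [Set.mem_setOf_eq] at hp ⊢
        unfold setG at hp
        split_ifs at hp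
        · exact absurd rfl hp
        · exact hp
    obtain ⟨b, hb⟩ := ih _ hlt hg₀ (hS.erase r q) hs₀ rfl n₀ hB₀
      (fun i j h => isSome_none hs₀ (hB₀ i j h))
    refine ⟨b ++ [(x.ceil, u)], Rec.snoc hb (hS.pos _ _ _ hc.eq) ?_ hu hi hz.symm rfl ?_⟩
    · intro p hp
      obtain ⟨r₁, q₁, f₁, hl₁, z₁, b₁, G₁, hr₁, hu₁, hi₁, rfl, -⟩ := hb.inv.2 p hp
      have h1 := hl₁.eq
      unfold setG at h1
      split_ifs at h1 with h2
      have h3 := hl.max _ _ _ h1 (by omega)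
      obtain ⟨⟨x₁, hc₁⟩, -⟩ := hr₁.good.1.shape hu₁ hi₁
      have ho := corner_order hg₀.1 hg.1 hc₁ hcG hn hsh
      have hd := Ins.des hr₁.good.1 hu₁ hu hi₁ hi
      rw [Letter.lt_iff] at h3
      obtain ⟨i, f⟩ := x
      simp only [Letter.mk.injEq] at h3 hd ⊢
      rcases lt_or_ge p.1 i with h4 | h4
      · exact Or.inl h4
      · refine Or.inr ⟨by omega, hd.2 ?_⟩
        unfold Des
        cases f₁ <;> cases f <;> simp at h3 ⊢ <;> omega
    · funext a c
      unfold setG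
      split_ifs with h1
      · rw [h1.1, h1.2, hc.eq]
      · rfl
  · push Not at he
    obtain ⟨rfl, rfl⟩ := hg.eq_nil fun a c => isSome_none (fun a c => (hs a c).symm) (he a c)
    obtain rfl : S = fun _ _ => none := by funext a c; exact he a c
    exact ⟨[], Rec.nil⟩

theorem countP_setRowG {T : STab} {r : ℕ} (hr : r ≤ T.length) (x : Letter) (P : Letter → Bool) :
    (setRowG T r (T.getD r [] ++ [x])).flatten.countP P = T.flatten.countP P + [x].countP P := by
  unfold setRowG
  split_ifs with h
  · have e : T = T.take r ++ T[r] :: T.drop (r + 1) := by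
      rw [List.getElem_cons_drop h, List.take_append_drop]
    rw [List.set_eq_take_append_cons_drop, if_pos h]
    conv_rhs => rw [e]
    simp only [List.flatten_append, List.flatten_cons, List.countP_append, List.getD_eq_getElem?_getD,
      List.getElem?_eq_getElem h, Option.getD_some]
    omega
  · rw [List.getD_eq_default _ _ (by omega)]
    simp

theorem Rec.content {z : ℤ → ℤ} {b : List (ℤ × Letter)} {G S : Grid} (h : Rec z b G S) :
    ∃ T, NoEmpty T ∧ entry? T = S ∧ T.flatten.length = b.length ∧
      ∀ i : ℤ, T.flatten.countP (fun x => decide (x.ceil = i)) =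
        b.countP (fun p => decide (p.1 = i)) := by
  induction h with
  | nil => exact ⟨[], by simp [NoEmpty], by funext r c; simp [entry?, entryG?], rfl, by simp⟩
  | @snoc z z' b b' G S S' G' i u r q f h0 hi0 hp hu hi hz hb hS ih =>
    obtain ⟨T, hN, rfl, hl, hc⟩ := ih
    obtain ⟨hg, hs⟩ := h0.good
    obtain ⟨⟨x, hx⟩, hn, hsh⟩ := hg.shape hu hi
    have hT' := (hi.good hg hu rfl).1
    have hrq := hT'.supp _ _ _ hx.eq
    have hsome : ∀ a c, a ≤ r → a ≤ c → c ≤ q → (a ≠ r ∨ c ≠ q) → entry? T a c ≠ none := by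
      intro a c h1 h2 h3 h4 h5
      obtain ⟨y, hy, -⟩ := hT'.le hx.eq h1 h3 h2
      have := hsh a c h4
      rw [← hs, hy, h5] at this
      cases this
    have hlen : r ≤ T.length := by
      rcases r with _ | r
      · omega
      · have := hsome r q (by omega) (by omega) le_rfl (by omega)
        obtain ⟨y, hy⟩ := Option.ne_none_iff_exists'.1 this
        exact lt_length_of_entry? hy
    have hq := row_length hrq (isSome_none hs hn)
      (fun j h1 h2 => hsome r j le_rfl h1 h2.le (by omega))
    refine ⟨setRowG T r (T.getD r [] ++ [⟨i, f⟩]), hN.setRowG _ (by simp), ?_, ?_, ?_⟩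
    · rw [hS, entry?_append hlen hq]
    · have := countP_setRowG hlen ⟨i, f⟩ fun _ => true
      simp only [List.countP_true] at this
      rw [this, hl, hb, List.length_append]
      rfl
    · intro k
      rw [countP_setRowG hlen, hc, hb, List.countP_append]
      simp [List.countP_cons]

theorem sPerm_apply (i x : ℤ) : sPerm i x = sw i x := by
  unfold sPerm sw; rw [Equiv.swap_apply_def]

theorem sPerm_inv (i : ℤ) : (sPerm i)⁻¹ = sPerm i := Equiv.swap_inv _ _

/-- Right Demazure multiplication by a simple transposition. -/
def rDem (j : ℤ) (σ : Equiv.Perm ℤ) : Equiv.Perm ℤ := if σ j < σ (j + 1) then σ * sPerm j else σ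

/-- Left Demazure multiplication by a simple transposition. -/
def lDem (i : ℤ) (σ : Equiv.Perm ℤ) : Equiv.Perm ℤ :=
  if σ⁻¹ i < σ⁻¹ (i + 1) then sPerm i * σ else σ

theorem sw_lt_iff {j p q : ℤ} (h : ¬ (p = j ∧ q = j + 1)) (h' : ¬ (p = j + 1 ∧ q = j)) :
    sw j p < sw j q ↔ p < q := by
  unfold sw; split_ifs <;> omega

theorem lDem_rDem (i j : ℤ) (σ : Equiv.Perm ℤ) : lDem i (rDem j σ) = rDem j (lDem i σ) := by
  have e1 : ∀ x, (σ * sPerm j)⁻¹ x = sw j (σ⁻¹ x) := fun x => by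
    rw [mul_inv_rev, sPerm_inv, Equiv.Perm.mul_apply, sPerm_apply]
  have e2 : ∀ x, (sPerm i * σ) x = sw i (σ x) := fun x => by
    rw [Equiv.Perm.mul_apply, sPerm_apply]
  by_cases h : (σ⁻¹ i = j ∧ σ⁻¹ (i + 1) = j + 1)
  · have f1 : σ j = i := by rw [← h.1]; simp
    have f2 : σ (j + 1) = i + 1 := by rw [← h.2]; simp
    have e : σ * sPerm j = sPerm i * σ := by
      ext x
      rw [e2, Equiv.Perm.mul_apply, sPerm_apply]
      unfold sw
      by_cases hx : x = j
      · simp [hx, f1, f2]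
      by_cases hx' : x = j + 1
      · simp [hx', f1, f2]
      · rw [if_neg hx, if_neg hx', if_neg, if_neg]
        · rw [← f2]; exact fun h => hx' (σ.injective h)
        · rw [← f1]; exact fun h => hx (σ.injective h)
    have r1 : rDem j σ = σ * sPerm j := if_pos (by rw [f1, f2]; omega)
    have l1 : lDem i σ = sPerm i * σ := if_pos (by rw [h.1, h.2]; omega)
    rw [r1, l1, lDem, rDem, e1, e1, e2, e2, h.1, h.2, f1, f2, if_neg, if_neg, e]
    · simp only [sw_left, sw_right]; omega
    · simp only [sw_left, sw_right]; omega
  by_cases h' : (σ⁻¹ i = j + 1 ∧ σ⁻¹ (i + 1) = j)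
  · have f1 : σ (j + 1) = i := by rw [← h'.1]; simp
    have f2 : σ j = i + 1 := by rw [← h'.2]; simp
    have r1 : rDem j σ = σ := if_neg (by rw [f1, f2]; omega)
    have l1 : lDem i σ = σ := if_neg (by rw [h'.1, h'.2]; omega)
    rw [r1, l1, r1]
  · have k : ¬ (σ j = i ∧ σ (j + 1) = i + 1) := fun k => h
      ⟨by rw [← k.1]; simp, by rw [← k.2]; simp⟩
    have k' : ¬ (σ j = i + 1 ∧ σ (j + 1) = i) := fun k => h'
      ⟨by rw [← k.2]; simp, by rw [← k.1]; simp⟩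
    have c1 : sw j (σ⁻¹ i) < sw j (σ⁻¹ (i + 1)) ↔ σ⁻¹ i < σ⁻¹ (i + 1) := sw_lt_iff h h'
    have c2 : sw i (σ j) < sw i (σ (j + 1)) ↔ σ j < σ (j + 1) := sw_lt_iff k k'
    unfold rDem lDem
    split_ifs with a b c d a b <;> simp only [e1, e2, c1, c2] at * <;> first
      | contradiction
      | rw [mul_assoc]
      | rfl

theorem heckeProd_append (w : List ℤ) (i : ℤ) : heckeProd (w ++ [i]) = rDem i (heckeProd w) := by
  unfold heckeProd; rw [List.foldl_append]; rfl

theorem heckeProd_cons (i : ℤ) (w : List ℤ) : heckeProd (i :: w) = lDem i (heckeProd w) := by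
  induction w using List.reverseRecOn with
  | nil => simp [heckeProd, lDem]
  | append_singleton w j ih =>
    rw [← List.cons_append, heckeProd_append, heckeProd_append, ih, lDem_rDem]

open Classical in
/-- Demazure conjugation of an involution by a simple transposition. -/
noncomputable def dstep (y : ℤ → ℤ) (i : ℤ) : ℤ → ℤ := if y i < y (i + 1) then istep y i else y

theorem IsInv.dstep {y : ℤ → ℤ} (h : IsInv y) (i : ℤ) : IsInv (dstep y i) := by
  unfold _root_.dstep; split_ifs
  · exact h.istep i
  · exact h

theorem lDem_rDem_self {i : ℤ} {σ : Equiv.Perm ℤ} (h : IsInv σ) :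
    ⇑(lDem i (rDem i σ)) = dstep σ i := by
  have hs : σ⁻¹ = σ := by
    ext x; rw [Equiv.Perm.inv_eq_iff_eq]; exact (h x).symm
  unfold rDem dstep
  split_ifs with ha
  · have e1 : ∀ x, (σ * sPerm i)⁻¹ x = sw i (σ x) := fun x => by
      rw [mul_inv_rev, sPerm_inv, Equiv.Perm.mul_apply, sPerm_apply, hs]
    funext x
    rw [lDem, e1, e1, istep_apply]
    by_cases hf : Fix2 σ i
    · rw [if_pos hf, if_neg, Equiv.Perm.mul_apply, sPerm_apply]
      rw [hf.1, hf.2, sw_left, sw_right]; omega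
    · rw [if_neg hf, if_pos, Equiv.Perm.mul_apply, Equiv.Perm.mul_apply, sPerm_apply, sPerm_apply]
      rw [sw_lt_iff hf (by omega)]; exact ha
  · rw [lDem, hs, if_neg ha]

theorem invHecke_foldl (a : List ℤ) : IsInv (invHecke a) ∧ ⇑(invHecke a) = a.foldl dstep id := by
  induction a using List.reverseRecOn with
  | nil => exact ⟨fun x => rfl, rfl⟩
  | append_singleton a i ih =>
    obtain ⟨h1, h2⟩ := ih
    have key : ⇑(invHecke (a ++ [i])) = dstep (invHecke a) i := by
      rcases a with _ | ⟨j, a⟩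
      · have hd : dstep (invHecke []) i = istep id i := if_pos (by change i < i + 1; omega)
        rw [hd]
        have e : invHecke ([] ++ [i]) = sPerm i := by
          change heckeProd [i] = _
          rw [heckeProd_cons]
          change (if i < i + 1 then sPerm i * 1 else 1) = _
          rw [if_pos (by omega), mul_one]
        rw [e]
        funext x
        rw [istep_fix (fix2_id i), sPerm_apply]; rfl
      · rw [← lDem_rDem_self h1]
        congr 1
        have e : (j :: a ++ [i]).reverse ++ (j :: a ++ [i]).tail =
            i :: (((j :: a).reverse ++ (j :: a).tail) ++ [i]) := by simp
        rw [invHecke, e, heckeProd_cons, heckeProd_append]; rfl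
    rw [key, List.foldl_append, ← h2]
    exact ⟨h1.dstep i, rfl⟩

theorem AscW.foldl {y : ℤ → ℤ} {a : PWord} (h : AscW y a) :
    (unprimeWord a).foldl dstep y = irun y a := by
  induction a generalizing y with
  | nil => rfl
  | cons x a ih =>
    have e : dstep y x.ceil = istep y x.ceil := if_pos h.1.1
    change (unprimeWord a).foldl dstep (dstep y x.ceil) = irun (istep y x.ceil) a
    rw [e, ih h.2]

theorem unprimeWord_append (a b : PWord) : unprimeWord (a ++ b) = unprimeWord a ++ unprimeWord b :=
  List.map_append

theorem builds_of_mem {z : Equiv.Perm ℤ} {a : PWord} (h : a ∈ RinvPlus z) : Builds a z := by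
  obtain ⟨⟨hz, hmin⟩, hc⟩ := h
  have key : ∀ b c, a = b ++ c → AscW id b := by
    intro b
    induction b using List.reverseRecOn with
    | nil => exact fun _ _ => trivial
    | append_singleton b x ih =>
      intro c e
      have hb := ih (x :: c) (by simpa using e)
      have hf := hb.foldl
      rw [ascW_append]
      refine ⟨hb, ⟨?_, fun hp => ?_⟩, trivial⟩
      · by_contra hn
        have := hmin (unprimeWord (b ++ c)) (by
          rw [← hz]
          apply DFunLike.coe_injective
          rw [(invHecke_foldl _).2, (invHecke_foldl _).2, e]
          simp only [unprimeWord_append, List.foldl_append, hf]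
          congr 1
          exact (if_neg hn).symm)
        rw [e] at this
        simp [unprimeWord] at this
      · have h1 : a[b.length]? = some x := by rw [e]; simp
        have h2 : (unprimeWord a)[b.length]? = some x.ceil := by
          unfold unprimeWord; rw [List.getElem?_map, h1]; rfl
        have h3 : (unprimeWord a).take b.length = unprimeWord b := by
          rw [e, List.append_assoc, unprimeWord_append]
          have : b.length = (unprimeWord b).length := by simp [unprimeWord]
          rw [this, List.take_left]
        obtain ⟨y, hy, hy1, hy2⟩ := hc _ _ h1 hp
        rw [h2] at hy; cases hy
        rw [h3, (invHecke_foldl _).2, hf] at hy1 hy2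
        exact ⟨hy1, hy2⟩
  have ha := key a [] (by simp)
  refine ⟨ha, ?_⟩
  rw [← ha.foldl, ← (invHecke_foldl _).2, hz]

theorem Builds.invHecke {z : Equiv.Perm ℤ} {a : PWord} (h : Builds a z) :
    invHecke (unprimeWord a) = z := by
  apply DFunLike.coe_injective
  rw [(invHecke_foldl _).2, h.1.foldl, h.2]

/-- If all words building `z` have the same length then they are the primed involution words. -/
theorem mem_of_builds {z : Equiv.Perm ℤ} (hl : ∀ a b, Builds a z → Builds b z → a.length = b.length)
    {a : PWord} (h : Builds a z) : a ∈ RinvPlus z := by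
  have hs : ∃ n, ∃ b, _root_.invHecke b = z ∧ b.length = n := ⟨_, _, h.invHecke, rfl⟩
  classical
  obtain ⟨b, hb, hn⟩ := Nat.find_spec hs
  have hmin : ∀ c, _root_.invHecke c = z → b.length ≤ c.length := fun c hc => by
    rw [hn]; exact Nat.find_min' hs ⟨c, hc, rfl⟩
  have hu : unprimeWord (b.map fun i => ⟨i, false⟩) = b := by
    simp [unprimeWord, Function.comp_def]
  have hbb : (b.map fun i => (⟨i, false⟩ : Letter)) ∈ RinvPlus z := by
    refine ⟨by rw [hu]; exact ⟨hb, hmin⟩, fun k x hk hx => ?_⟩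
    rw [List.getElem?_map] at hk
    cases hbk : b[k]? with
    | none => rw [hbk] at hk; cases hk
    | some i => rw [hbk] at hk; cases hk; cases hx
  have hlen := hl _ _ h (builds_of_mem hbb)
  refine ⟨⟨h.invHecke, fun c hc => ?_⟩, fun k x hk hx => ?_⟩
  · have := hmin c hc
    simp only [unprimeWord, List.length_map] at hlen ⊢
    omega
  · obtain ⟨hka, e⟩ := List.getElem?_eq_some_iff.1 hk
    have es : a = a.take k ++ x :: a.drop (k + 1) := by
      rw [← e, List.getElem_cons_drop hka, List.take_append_drop]
    have hA := h.1
    rw [es, ascW_append] at hA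
    have hf := hA.2.1.2 hx
    have h3 : (unprimeWord a).take k = unprimeWord (a.take k) := by simp [unprimeWord, List.map_take]
    refine ⟨x.ceil, by unfold unprimeWord; rw [List.getElem?_map, hk]; rfl, ?_⟩
    rw [h3, (invHecke_foldl _).2, hA.1.foldl]
    exact hf

theorem irun_fix_lt {a : PWord} {y : ℤ → ℤ} {M : ℤ} (ha : ∀ x ∈ a, M ≤ x.ceil)
    (hy : ∀ x < M, y x = x) : ∀ x < M, irun y a x = x := by
  induction a generalizing y with
  | nil => exact hy
  | cons u a ih =>
    refine ih (fun x hx => ha x (by simp [hx])) fun x hx => ?_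
    have hu := ha u (by simp)
    have e : sw u.ceil x = x := sw_eq_self (by omega) (by omega)
    rw [istep_apply, e, hy x hx, e, ite_self]

theorem istep_descent {y : ℤ → ℤ} (hy : IsInv y) {i : ℤ} (h : y i < y (i + 1)) :
    istep y i (i + 1) < istep y i i := by
  by_contra hc
  have hne : istep y i i ≠ istep y i (i + 1) := fun e => by
    have := (hy.istep i).inj e; omega
  exact not_ascW_self y hy ⟨i, false⟩ ⟨i, false⟩ rfl
    ⟨⟨h, by simp⟩, ⟨by change istep y i i < istep y i (i + 1); omega, by simp⟩, trivial⟩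

theorem irun_far {w : PWord} {y : ℤ → ℤ} {a b : ℤ} (hw : ∀ x ∈ w, a < x.ceil ∧ b < x.ceil)
    (hy : y a = b) : irun y w a = b := by
  induction w generalizing y with
  | nil => exact hy
  | cons u w ih =>
    refine ih (fun x hx => hw x (by simp [hx])) ?_
    have hu := hw u (by simp)
    rw [istep_apply, sw_eq_self (x := a) (by omega) (by omega), hy,
      sw_eq_self (x := b) (by omega) (by omega), ite_self]

theorem irun_last_descent {w : PWord} {y : ℤ → ℤ} (hy : IsInv y) (hw : AscW y w) (hn : w ≠ []) :
    ∃ x ∈ w, irun y w (x.ceil + 1) < irun y w x.ceil := by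
  rcases List.eq_nil_or_concat w with rfl | ⟨w₀, p, rfl⟩
  · exact absurd rfl hn
  · refine ⟨p, by simp, ?_⟩
    rw [List.concat_eq_append, ascW_append] at hw
    rw [List.concat_eq_append, irun_append]
    exact istep_descent (hy.irun _) hw.2.1.1

/-- The inverse of the cycle `m + 1 ↦ m + j`, `x ↦ x - 1`. -/
def cyc (m j x : ℤ) : ℤ := if x = m + j then m + 1 else if m < x ∧ x < m + j then x + 1 else x

/-- The result of acting on `y` by the word with letters `m, m + 1, …, m + j - 1`. -/
structure FirstRow (m : ℤ) (y : ℤ → ℤ) (j : ℤ) (u : ℤ → ℤ) : Prop where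
  inv : IsInv u
  left : u m = m + j
  right : u (m + j) = m
  conj : ∀ x, x ≠ m → x ≠ m + j → cyc m j (u x) = y (cyc m j x)

theorem FirstRow.start {y : ℤ → ℤ} {m : ℤ} (hy : IsInv y) (h0 : y m = m) (h1 : y (m + 1) = m + 1) :
    FirstRow m y 1 (istep y m) where
  inv := hy.istep m
  left := by rw [istep_fix ⟨h0, h1⟩, sw_left, h1]
  right := by rw [istep_fix ⟨h0, h1⟩, sw_right, h0]
  conj x hx hx' := by
    have c : ∀ x, cyc m 1 x = x := fun x => by unfold cyc; split_ifs <;> omega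
    rw [istep_fix ⟨h0, h1⟩, sw_eq_self hx hx', c, c]

theorem FirstRow.next {y u : ℤ → ℤ} {m j : ℤ} (h : FirstRow m y j u) (hj : 1 ≤ j) :
    FirstRow m y (j + 1) (istep u (m + j)) := by
  have hf : ¬ Fix2 u (m + j) := fun hf => by have := hf.1; rw [h.right] at this; omega
  have hc : ∀ x, x ≠ m → cyc m (j + 1) (sw (m + j) x) = cyc m j x := fun x hx => by
    unfold cyc sw; split_ifs <;> omega
  have hm : sw (m + j) m = m := sw_eq_self (by omega) (by omega)
  refine ⟨h.inv.istep _, ?_, ?_, fun x hx hx' => ?_⟩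
  · rw [istep_nfix hf, hm, h.left, sw_left]; ring
  · rw [istep_nfix hf, ← add_assoc, sw_right, h.right, hm]
  · have k1 : sw (m + j) x ≠ m := by unfold sw; split_ifs <;> omega
    have k2 : sw (m + j) x ≠ m + j := by unfold sw; split_ifs <;> omega
    have k3 : u (sw (m + j) x) ≠ m := fun e => k2 (h.inv.inj (e.trans h.right.symm))
    rw [istep_nfix hf, hc _ k3, h.conj _ k1 k2, ← hc _ k1, sw_sw]

theorem FirstRow.run {y : ℤ → ℤ} {m : ℤ} {w : PWord} {j : ℕ} {u : ℤ → ℤ} (h : FirstRow m y j u)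
    (hj : 1 ≤ j) (hw : AscW u w) (hs : (w.map Letter.ceil).Pairwise (· < ·))
    (hge : ∀ x ∈ w, m + j ≤ x.ceil) :
    (∃ k : ℕ, j ≤ k ∧ FirstRow m y k (irun u w) ∧
      w = (List.range' j (k - j)).map fun i => ⟨m + i, false⟩) ∨
    ∃ a k : ℤ, j ≤ k ∧ m + k < a ∧ irun u w m = m + k ∧ irun u w (a + 1) < irun u w a := by
  induction w generalizing j u with
  | nil => exact Or.inl ⟨j, le_rfl, h, by simp⟩
  | cons x w ih =>
    have hx := hge x (by simp)
    simp only [List.map_cons, List.pairwise_cons, List.mem_map, forall_exists_index, and_imp,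
      forall_apply_eq_imp_iff₂] at hs
    rcases eq_or_lt_of_le hx with e | e
    · have hf : ¬ Fix2 u (m + j) := fun hf => by have := hf.1; rw [h.right] at this; omega
      have hp : x = ⟨m + j, false⟩ := by
        obtain ⟨c, p⟩ := x
        simp only at e; subst e
        cases p
        · rfl
        · exact absurd (hw.1.2 rfl) hf
      subst hp
      have hn := h.next (by omega)
      have hn' : FirstRow m y ((j + 1 : ℕ) : ℤ) (istep u (m + j)) := by push_cast; exact hn
      rcases ih hn' (by omega) hw.2 hs.2 (fun v hv => by have := hs.1 v hv; push_cast; omega) with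
        ⟨k, hk, h1, h2⟩ | h1
      · refine Or.inl ⟨k, by omega, h1, ?_⟩
        rw [h2, show k - j = (k - (j + 1)) + 1 by omega, List.range'_succ]
        rfl
      · obtain ⟨a, l, h2, h3⟩ := h1
        exact Or.inr ⟨a, l, by omega, h3⟩
    · right
      have hall : ∀ v ∈ x :: w, m + j < v.ceil := by
        intro v hv
        rcases List.mem_cons.1 hv with rfl | hv
        · exact e
        · have := hs.1 v hv; omega
      obtain ⟨v, hv, hd⟩ := irun_last_descent h.inv hw (by simp)
      exact ⟨v.ceil, j, le_rfl, hall v hv, irun_far (fun v hv => by have := hall v hv; omega) h.left, hd⟩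

/-- The involution Rothe diagram of `z` is a translate of the transposed shifted diagram of `sh`. -/
def Dominant (t : ℤ) (sh : List ℕ) (z : ℤ → ℤ) : Prop :=
  ∀ i j : ℤ, (j < z i ∧ j ≤ i ∧ i < z j) ↔
    ∃ r : ℕ, j = t + 1 + r ∧ j ≤ i ∧ i < j + (sh.getD r 0 : ℕ)

/-- The tableau of shape `sh` with entry `t + i + j - 1` in box `(i, j)`. -/
def stair (t : ℤ) (sh : List ℕ) : Grid := fun r c =>
  if r ≤ c ∧ c < r + sh.getD r 0 then some ⟨t + r + c + 1, false⟩ else none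

theorem IsStrictPartition.getD_le {k : ℕ} {l : List ℕ} (h : IsStrictPartition (k :: l)) (r : ℕ) :
    r + 1 + l.getD r 0 ≤ k ∨ l.getD r 0 = 0 := by
  induction r generalizing k l with
  | zero =>
    rcases l with _ | ⟨a, l⟩
    · simp
    · have hc : List.IsChain (fun a b => b < a) (k :: a :: l) := h.1
      rw [List.isChain_cons_cons] at hc
      simp only [List.getD_cons_zero]; omega
  | succ r ih =>
    rcases l with _ | ⟨a, l⟩
    · simp
    · have hc : List.IsChain (fun a b => b < a) (k :: a :: l) := h.1
      rw [List.isChain_cons_cons] at hc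
      have := ih (k := a) (l := l) ⟨hc.2, fun m hm => h.2 m (by simp [hm])⟩
      simp only [List.getD_cons_succ]; omega

theorem IsStrictPartition.tail {k : ℕ} {l : List ℕ} (h : IsStrictPartition (k :: l)) :
    IsStrictPartition l :=
  ⟨h.1.tail, fun m hm => h.2 m (by simp [hm])⟩

theorem Dominant.min {t m : ℤ} {sh : List ℕ} {z : ℤ → ℤ} (h : Dominant t sh z)
    (hlt : ∀ x < m, z x = x) (hm : m < z m) (hpos : 0 < sh.getD 0 0) : m = t + 1 := by
  obtain ⟨r, h1, -⟩ := (h m m).1 ⟨hm, le_rfl, hm⟩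
  have h2 := (h (t + 1) (t + 1)).2 ⟨0, by simp, le_rfl, by omega⟩
  by_contra hc
  have := hlt (t + 1) (by omega)
  omega

theorem Dominant.apply_min {m : ℤ} {sh : List ℕ} {z : ℤ → ℤ} (h : Dominant (m - 1) sh z)
    (hz : IsInv z) (hlt : ∀ x < m, z x = x) (hm : m < z m) : z m = m + (sh.getD 0 0 : ℕ) := by
  have key : ∀ i, (m < z i ∧ m ≤ i ∧ i < z m) ↔ (m ≤ i ∧ i < m + (sh.getD 0 0 : ℕ)) := by
    intro i
    rw [h i m]
    constructor
    · rintro ⟨r, h1, h2, h3⟩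
      obtain rfl : r = 0 := by omega
      exact ⟨h2, h3⟩
    · exact fun h => ⟨0, by simp, h⟩
  have h1 : m < z (z m - 1) := by
    by_contra hc
    rcases eq_or_lt_of_le (not_lt.1 hc) with e | e
    · have := hz (z m - 1); rw [e] at this; omega
    · have := hlt _ e
      rw [hz] at this; omega
  have h2 := (key (z m - 1)).1 ⟨h1, by omega, by omega⟩
  have h3 := (key m).1 ⟨hm, le_rfl, hm⟩
  have h4 := (key (m + (sh.getD 0 0 : ℕ) - 1)).2 ⟨by omega, by omega⟩
  omega

theorem Dominant.no_descent {m k a : ℤ} {sh : List ℕ} {z : ℤ → ℤ} (h : Dominant (m - 1) sh z)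
    (hsh : IsStrictPartition sh) (hz : IsInv z) (hk : z m = m + (sh.getD 0 0 : ℕ)) (hk' : z m = m + k)
    (ha : m + k < a) : z a ≤ z (a + 1) := by
  have key : ∀ i j, j < z i → j ≤ i → i < z j → i < m + k := by
    intro i j h1 h2 h3
    obtain ⟨r, h4, h5, h6⟩ := (h i j).1 ⟨h1, h2, h3⟩
    rcases sh with _ | ⟨b, l⟩
    · simp at h6; omega
    rcases r with _ | r
    · simp only [List.getD_cons_zero] at hk h6; simp at h4; omega
    · have := hsh.getD_le r
      simp only [List.getD_cons_zero, List.getD_cons_succ] at hk h6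
      push_cast at h4; omega
  by_contra hc
  rcases le_or_gt (z (a + 1)) a with h1 | h1
  · have := key a (z (a + 1)) (by omega) h1 (by rw [hz]; omega); omega
  · have := key (a + 1) a h1 (by omega) (by omega); omega

theorem Dominant.tail {m : ℤ} {k : ℕ} {l : List ℕ} {y z : ℤ → ℤ} (h : Dominant (m - 1) (k :: l) z)
    (hsh : IsStrictPartition (k :: l)) (hf : FirstRow m y k z) (hy : ∀ x ≤ m + 1, y x = x) :
    Dominant (m + 1) l y := by
  have hz := hf.inv
  have hk : 0 < k := hsh.2 k (by simp)
  have core : ∀ i j, i ≠ m → i ≠ m + k → j ≠ m → j ≠ m + k →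
      ((cyc m k j < y (cyc m k i) ∧ cyc m k j ≤ cyc m k i ∧ cyc m k i < y (cyc m k j)) ↔
        (j < z i ∧ j ≤ i ∧ i < z j)) := by
    intro i j i1 i2 j1 j2
    have zi1 : z i ≠ m := fun e => i2 (hz.inj (e.trans hf.right.symm))
    have zj1 : z j ≠ m := fun e => j2 (hz.inj (e.trans hf.right.symm))
    have zi2 : z i ≠ m + k := fun e => i1 (hz.inj (e.trans hf.left.symm))
    have zj2 : z j ≠ m + k := fun e => j1 (hz.inj (e.trans hf.left.symm))
    rw [← hf.conj i i1 i2, ← hf.conj j j1 j2]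
    have mono : ∀ a b, a ≠ m → a ≠ m + k → b ≠ m → b ≠ m + k → (cyc m k a < cyc m k b ↔ a < b) := by
      intro a b a1 a2 b1 b2
      unfold cyc; split_ifs <;> omega
    rw [mono _ _ j1 j2 zi1 zi2, mono _ _ i1 i2 zj1 zj2, ← not_lt, mono _ _ i1 i2 j1 j2, not_lt]
  have surj : ∀ i, m + 2 ≤ i → ∃ i', m < i' ∧ i' ≠ m + k ∧ cyc m k i' = i := by
    intro i hi
    rcases le_or_gt i (m + k) with h1 | h1
    · exact ⟨i - 1, by omega, by omega, by unfold cyc; split_ifs <;> omega⟩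
    · exact ⟨i, by omega, by omega, by unfold cyc; split_ifs <;> omega⟩
  intro i j
  constructor
  · rintro ⟨h1, h2, h3⟩
    have hj : m + 2 ≤ j := by
      by_contra hc
      have := hy j (by omega); omega
    obtain ⟨i', i1, i2, rfl⟩ := surj i (by omega)
    obtain ⟨j', j1, j2, rfl⟩ := surj j hj
    obtain ⟨r, e1, e2, e3⟩ := (h i' j').1 ((core i' j' i1.ne' i2 j1.ne' j2).1 ⟨h1, h2, h3⟩)
    rcases r with _ | r
    · simp at e1; omega
    have hb := hsh.getD_le r
    simp only [List.getD_cons_succ] at e3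
    push_cast at e1
    have ei : cyc m k i' = i' + 1 := by unfold cyc; split_ifs <;> omega
    have ej : cyc m k j' = j' + 1 := by unfold cyc; split_ifs <;> omega
    exact ⟨r, by omega, by omega, by omega⟩
  · rintro ⟨r, e1, e2, e3⟩
    have hb := hsh.getD_le r
    have ei : cyc m k (i - 1) = i := by unfold cyc; split_ifs <;> omega
    have ej : cyc m k (j - 1) = j := by unfold cyc; split_ifs <;> omega
    have := (core (i - 1) (j - 1) (by omega) (by omega) (by omega) (by omega)).2
      ((h (i - 1) (j - 1)).2 ⟨r + 1, by push_cast; omega, by omega, by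
        simp only [List.getD_cons_succ]; omega⟩)
    rw [ei, ej] at this
    exact this

theorem line_shift {f : ℕ → Option Letter} (h : f 0 = none) (n : ℕ) :
    line f (n + 1) = line (fun j => f (j + 1)) n := by
  unfold line
  rw [List.range_succ_eq_map, List.filterMap_cons, h, List.filterMap_map]
  rfl

theorem rows_shift {G : Grid} (h : ∀ i, G (i + 1) 0 = none) (n k : ℕ) :
    rows G (n + 1) 1 k = rows (fun r c => G (r + 1) (c + 1)) n 0 k := by
  induction k with
  | zero => rfl
  | succ k ih =>
    rw [rows, rows, ih, show 1 + k = k + 1 by omega, line_shift (h k), zero_add]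

theorem Tab.shift {G : Grid} (h : Tab G) : Tab fun r c => G (r + 1) (c + 1) where
  supp i j x e := by have := h.supp _ _ _ e; omega
  left i j x hij e := h.left _ _ x (by omega) e
  down i j x e := h.down _ _ x e
  diag i x e := h.diag _ x e

/-- A reading word splits into the reading word of the rows after the first one and the first row. -/
theorem Good.split {z : ℤ → ℤ} {G : Grid} {m : ℤ} (h : Good z G) (hm : G 0 0 = some ⟨m, false⟩) :
    ∃ (y : ℤ → ℤ) (w : PWord), Good y (fun r c => G (r + 1) (c + 1)) ∧ (∀ x < m + 2, y x = x) ∧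
      AscW y (⟨m, false⟩ :: w) ∧ irun y (⟨m, false⟩ :: w) = z ∧
      ((⟨m, false⟩ :: w).Pairwise fun a b => a.ceil < b.ceil) ∧
      ∀ c, (⟨m, false⟩ :: w : PWord)[c]? = G 0 c := by
  obtain ⟨hT, n, hB, hb⟩ := h
  have hB2 : Bnd (n + 1 + 1) G := fun i j h => hB i j (by omega)
  rw [← rows_total hB (show n ≤ n + 1 + 1 by omega), rows_split (by omega : 0 < n + 1 + 1)] at hb
  simp only [zero_add, Nat.add_sub_cancel, show rows G (n + 1 + 1) 0 0 = [] from rfl,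
    List.append_nil] at hb
  rw [rows_shift (fun i => hT.none_of_lt (by omega))] at hb
  have hl : ∀ c, G 0 c = none → G 0 (c + 1) = none := fun c e => by
    by_contra hne
    obtain ⟨x, hx⟩ := Option.ne_none_iff_exists'.1 hne
    obtain ⟨w, hw, -⟩ := hT.left 0 c x (by omega) hx
    rw [e] at hw; cases hw
  have hg := (filterMap_range (G 0) hl (n + 1)).2
  have hline : line (G 0) (n + 1 + 1) = ⟨m, false⟩ :: line (fun j => G 0 (j + 1)) (n + 1) := by
    unfold line
    rw [List.range_succ_eq_map, List.filterMap_cons, hm, List.filterMap_map]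
    rfl
  have hp := (hT.row 0).pairwise (n + 1 + 1)
  have hb' := hb
  rw [hline] at hp
  change ∀ k, (line (G 0) (n + 1 + 1))[k]? = _ at hg
  rw [hline] at hg hb
  set w := line (fun j => G 0 (j + 1)) (n + 1)
  refine ⟨irun id (rows (fun r c => G (r + 1) (c + 1)) (n + 1) 0 (n + 1)), w,
    ⟨hT.shift, n + 1, fun i j h => hB _ _ (by omega), (ascW_append _ _ _).1 hb.1 |>.1, rfl⟩, ?_,
    ((ascW_append _ _ _).1 hb.1).2, by rw [← hb.2, irun_append], hp, fun c => ?_⟩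
  · refine irun_fix_lt (fun x hx => ?_) fun x _ => rfl
    obtain ⟨i, j, -, -, -, e⟩ := mem_rows.1 hx
    have h1 := hT.supp _ _ _ e
    have := hT.lt hm e (by omega) (by omega)
    simp only at this; omega
  · rw [hg c]
    split_ifs with hc
    · rfl
    · exact (hB 0 c (by omega)).symm

theorem Tab.eq_none {G : Grid} (h : Tab G) (h0 : G 0 0 = none) (a c : ℕ) : G a c = none := by
  by_contra hne
  obtain ⟨y, hy⟩ := Option.ne_none_iff_exists'.1 hne
  obtain ⟨x, hx, -⟩ := h.le hy (i := 0) (j := 0) (by omega) (by omega) le_rfl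
  rw [h0] at hx; cases hx

theorem Tab.diag_mk {G : Grid} (h : Tab G) {i : ℕ} {x : Letter} (e : G i i = some x) :
    G i i = some ⟨x.ceil, false⟩ := by
  have := h.diag _ _ e
  rw [e, ← this]

theorem Good.first {z : ℤ → ℤ} {G : Grid} {m : ℤ} (h : Good z G) (hm : G 0 0 = some ⟨m, false⟩) :
    m < z m ∧ (∀ x < m, z x = x) ∧
      ((∃ (y : ℤ → ℤ) (k : ℕ), Good y (fun r c => G (r + 1) (c + 1)) ∧ (∀ x ≤ m + 1, y x = x) ∧
        FirstRow m y k z ∧ ∀ c, G 0 c = if c < k then some ⟨m + c, false⟩ else none) ∨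
      ∃ a k : ℤ, m + k < a ∧ z m = m + k ∧ z (a + 1) < z a) := by
  obtain ⟨y, w, hg, hy, hw, hz, hp, hl⟩ := h.split hm
  have hlt : ∀ x < m, z x = x := by
    rw [← hz]
    refine irun_fix_lt (fun x hx => ?_) fun x hx => hy x (by omega)
    rcases List.mem_cons.1 hx with rfl | hx
    · exact le_rfl
    · exact ((List.pairwise_cons.1 hp).1 x hx).le
  obtain ⟨-, hw⟩ := hw
  have hf := FirstRow.start hg.isInv (hy m (by omega)) (hy (m + 1) (by omega))
  change irun (istep y m) w = z at hz
  change AscW (istep y m) w at hw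
  have hf' : FirstRow m y (1 : ℕ) (istep y m) := by simpa using hf
  rw [List.pairwise_cons] at hp
  rcases hf'.run le_rfl hw (List.pairwise_map.2 hp.2)
    (fun x hx => by have := hp.1 x hx; simp only at this; push_cast; omega) with
    ⟨k, hk, hr, he⟩ | ⟨a, k, hk, h1, h2, h3⟩
  · rw [hz] at hr
    refine ⟨by rw [hr.left]; omega, hlt, Or.inl ⟨y, k, hg, fun x hx => hy x (by omega), hr, fun c => ?_⟩⟩
    rw [← hl c, he]
    rcases c with _ | c
    · simp [show 0 < k by omega]
    · by_cases hc : c + 1 < k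
      · simp [hc, show c < k - 1 by omega, add_comm]
      · simp [hc, show k - 1 ≤ c by omega]
  · rw [hz] at h2 h3
    exact ⟨by push_cast at hk; omega, hlt, Or.inr ⟨a, k, h1, h2, h3⟩⟩

/-- The involution with a dominant diagram has a unique increasing tableau. -/
theorem Good.eq_stair {sh : List ℕ} (hsh : IsStrictPartition sh) {t : ℤ} {z : ℤ → ℤ} {G : Grid}
    (h : Good z G) (hd : Dominant t sh z) : G = stair t sh := by
  induction sh generalizing t z G with
  | nil =>
    have he : ∀ a c, G a c = none := by
      refine h.1.eq_none ?_
      by_contra hne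
      obtain ⟨x, hx⟩ := Option.ne_none_iff_exists'.1 hne
      obtain ⟨hm, -⟩ := h.first (h.1.diag_mk hx)
      obtain ⟨r, h1, h2, h3⟩ := (hd _ _).1 ⟨hm, le_rfl, hm⟩
      simp at h3
    funext a c
    simp [he, stair]
  | cons k l ih =>
    have hk : 0 < k := hsh.2 k (by simp)
    rcases h0 : G 0 0 with _ | x
    · obtain ⟨rfl, -⟩ := h.eq_nil (h.1.eq_none h0)
      have := (hd (t + 1) (t + 1)).2 ⟨0, by simp, le_rfl, by simpa using hk⟩
      simp at this
    · obtain ⟨hm, hlt, hc⟩ := h.first (h.1.diag_mk h0)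
      have hmt := hd.min hlt hm (by simpa using hk)
      rw [show t = x.ceil - 1 by omega] at hd
      have hzm := hd.apply_min h.isInv hlt hm
      rcases hc with ⟨y, k', hg, hy, hf, hr⟩ | ⟨a, k', h1, h2, h3⟩
      · have hl := hf.left
        rw [hzm] at hl
        obtain rfl : k = k' := by simp at hl; omega
        have hG := ih hsh.tail hg (hd.tail hsh hf hy)
        funext r c
        rcases r with _ | r
        · rw [hr c, hmt]
          simp only [stair, zero_le, true_and, List.getD_cons_zero, zero_add]
          split_ifs
          · congr 2; push_cast; ring
          · rfl
        · rcases c with _ | c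
          · rw [h.1.none_of_lt (by omega)]; simp [stair]
          · rw [show G (r + 1) (c + 1) = stair (x.ceil + 1) l r c from congrFun (congrFun hG r) c]
            simp only [stair, List.getD_cons_succ, hmt]
            congr 1
            · rw [eq_iff_iff]; omega
            · congr 2; push_cast; ring
      · have := hd.no_descent hsh h.isInv hzm h2 h1
        omega

def inversions (z : ℤ → ℤ) : Set (ℤ × ℤ) := {p | p.1 < p.2 ∧ z p.2 < z p.1}

theorem inversions_finite {z : ℤ → ℤ} (hz : IsInv z) (hf : {x | z x ≠ x}.Finite) :
    (inversions z).Finite := by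
  obtain ⟨u, hu⟩ := hf.bddAbove
  obtain ⟨l, hl⟩ := hf.bddBelow
  have key : ∀ x, z x = x ∨ (l ≤ x ∧ x ≤ u ∧ l ≤ z x ∧ z x ≤ u) := fun x => by
    by_cases h : z x = x
    · exact Or.inl h
    · have h' : z (z x) ≠ z x := by rw [hz]; exact fun e => h e.symm
      exact Or.inr ⟨hl h, hu h, hl h', hu h'⟩
  refine ((Set.finite_Icc l u).prod (Set.finite_Icc l u)).subset ?_
  rintro ⟨a, b⟩ ⟨h1, h2⟩
  simp only at h1 h2
  have ha := key a
  have hb := key b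
  simp only [Set.mem_prod, Set.mem_Icc]
  omega

theorem exists_descent {z : ℤ → ℤ} (hz : IsInv z) (hne : z ≠ id) : ∃ i, z (i + 1) < z i := by
  by_contra hc
  push Not at hc
  have hm := monotone_int_of_le_succ hc
  refine hne (funext fun x => ?_)
  rcases lt_trichotomy (z x) x with h | h | h
  · have := hm h.le; rw [hz] at this; exact le_antisymm h.le this
  · exact h
  · have := hm h.le; rw [hz] at this; exact le_antisymm this h.le

/-- Every descent of an involution is the last letter of an involution word. -/
theorem exists_istep {z : ℤ → ℤ} (hz : IsInv z) {i : ℤ} (hi : z (i + 1) < z i) :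
    ∃ y, IsInv y ∧ Asc y ⟨i, false⟩ ∧ istep y i = z ∧
      ∀ p ∈ inversions y, (sw i p.1, sw i p.2) ∈ inversions z \ {(i, i + 1)} := by
  by_cases h : z i = i + 1
  · have h' : z (i + 1) = i := by rw [← h, hz]
    have hs : ∀ x, sw i (z x) = z (sw i x) := fun x => by
      by_cases h1 : x = i
      · subst h1; rw [sw_left, h, sw_right, h']
      by_cases h2 : x = i + 1
      · subst h2; rw [sw_right, h', sw_left, h]
      · rw [sw_eq_self h1 h2]
        exact sw_eq_self (fun e => h2 (hz.inj (e.trans h'.symm))) (fun e => h1 (hz.inj (e.trans h.symm)))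
    have hf : Fix2 (fun x => z (sw i x)) i := ⟨by simp [sw_left, h'], by simp [sw_right, h]⟩
    refine ⟨fun x => z (sw i x), fun x => by simp only [← hs, hz x, hz (sw i x), sw_sw],
      ⟨by simp only [hf.1, hf.2]; omega, by simp⟩, by funext x; rw [istep_fix hf]; simp [sw_sw], ?_⟩
    rintro ⟨a, b⟩ ⟨h1, h2⟩
    simp only at h1 h2
    have hab : ¬ (a = i ∧ b = i + 1) := by
      rintro ⟨rfl, rfl⟩
      rw [sw_right, sw_left] at h2; omega
    refine ⟨⟨?_, h2⟩, ?_⟩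
    · simp only; unfold sw; split_ifs <;> omega
    · simp only [Set.mem_singleton_iff, Prod.mk.injEq]
      unfold sw; split_ifs <;> omega
  · have h' : z (i + 1) ≠ i := fun e => h (by rw [← hz (i + 1), e])
    have hasc : sw i (z (i + 1)) < sw i (z i) := by
      unfold sw; split_ifs <;> omega
    have hf : ¬ Fix2 (fun x => sw i (z (sw i x))) i := by
      rintro ⟨h1, h2⟩
      simp only [sw_left, sw_right] at h1 h2
      rw [h1, h2] at hasc
      rw [← sw_sw i (z (i + 1)), h1, sw_left, ← sw_sw i (z i), h2, sw_right] at hi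
      omega
    refine ⟨fun x => sw i (z (sw i x)), fun x => by simp only [sw_sw, hz (sw i x)],
      ⟨by simp only [sw_left, sw_right]; exact hasc, by simp⟩,
      by funext x; rw [istep_nfix hf]; simp [sw_sw], ?_⟩
    rintro ⟨a, b⟩ ⟨h1, h2⟩
    simp only at h1 h2
    have hab : ¬ (a = i ∧ b = i + 1) := by
      rintro ⟨rfl, rfl⟩
      rw [sw_right, sw_left] at h2; omega
    have hlt : sw i a < sw i b := by unfold sw; split_ifs <;> omega
    refine ⟨⟨hlt, ?_⟩, ?_⟩
    · simp only
      have hab' : ¬ (z (sw i a) = i ∧ z (sw i b) = i + 1) := by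
        rintro ⟨e1, e2⟩
        rw [← hz (sw i a), ← hz (sw i b), e1, e2] at hlt
        omega
      have hne : z (sw i a) ≠ z (sw i b) := fun e => by have := hz.inj e; omega
      revert h2 hab' hne
      generalize z (sw i a) = p
      generalize z (sw i b) = q
      unfold sw; split_ifs <;> omega
    · simp only [Set.mem_singleton_iff, Prod.mk.injEq]
      unfold sw; split_ifs <;> omega

theorem exists_builds {z : ℤ → ℤ} (hz : IsInv z) (hf : (inversions z).Finite) : ∃ a, Builds a z := by
  induction hn : (inversions z).ncard using Nat.strong_induction_on generalizing z with
  | _ n ih =>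
    by_cases hid : z = id
    · exact ⟨[], trivial, hid.symm⟩
    · obtain ⟨i, hi⟩ := exists_descent hz hid
      obtain ⟨y, hy, ha, he, hm⟩ := exists_istep hz hi
      have hinj : Set.InjOn (fun p : ℤ × ℤ => (sw i p.1, sw i p.2)) (inversions y) := by
        rintro ⟨a, b⟩ - ⟨c, d⟩ - e
        simp only [Prod.mk.injEq] at e ⊢
        rw [← sw_sw i a, e.1, sw_sw, ← sw_sw i b, e.2, sw_sw]
        exact ⟨rfl, rfl⟩
      have hfy : (inversions y).Finite :=
        Set.Finite.of_injOn (fun p hp => (hm p hp).1) hinj hf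
      have h1 := Set.ncard_le_ncard_of_injOn _ hm hinj (hf.subset Set.diff_subset)
      have h2 := Set.ncard_diff_singleton_lt_of_mem (show (i, i + 1) ∈ inversions z from
        ⟨by simp, hi⟩) hf
      obtain ⟨a, hb⟩ := ih _ (by omega) hy hfy rfl
      refine ⟨a ++ [⟨i, false⟩], (ascW_append _ _ _).2 ⟨hb.1, by rw [hb.2]; exact ⟨ha, trivial⟩⟩, ?_⟩
      rw [irun_append, hb.2]
      exact he

theorem isSome_entry? (T : STab) (r c : ℕ) :
    (entry? T r c).isSome = decide (r ≤ c ∧ c < r + (shapeOf T).getD r 0) := by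
  have e : (shapeOf T).getD r 0 = (T.getD r []).length := by
    unfold shapeOf
    simp only [List.getD_eq_getElem?_getD, List.getElem?_map]
    cases T[r]? <;> simp
  rw [e]
  rcases lt_or_ge c r with h | h
  · rw [entry?_of_lt _ h]; simp; omega
  · rw [entry?_of_le _ h, Bool.eq_iff_iff]
    simp; omega

theorem eq_of_getD_eq {l l' : List ℕ} (h : ∀ m ∈ l, 0 < m) (h' : ∀ m ∈ l', 0 < m)
    (e : ∀ r, l.getD r 0 = l'.getD r 0) : l = l' := by
  refine List.ext_getElem? fun r => ?_
  have := e r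
  simp only [List.getD_eq_getElem?_getD] at this
  rcases h1 : l[r]? with _ | m <;> rcases h2 : l'[r]? with _ | m' <;>
    simp only [h1, h2, Option.getD_none, Option.getD_some] at this
  · rfl
  · exact absurd this (h' _ (List.mem_of_getElem? h2)).ne
  · exact absurd this (h _ (List.mem_of_getElem? h1)).ne'
  · rw [this]

theorem NoEmpty.pos {T : STab} (h : NoEmpty T) : ∀ m ∈ shapeOf T, 0 < m := by
  intro m hm
  obtain ⟨row, hr, rfl⟩ := List.mem_map.1 hm
  exact List.length_pos_iff.2 (h row hr)

theorem isSome_stair (t : ℤ) (sh : List ℕ) (r c : ℕ) :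
    (stair t sh r c).isSome = decide (r ≤ c ∧ c < r + sh.getD r 0) := by
  unfold stair
  split_ifs with h
  · simpa using h
  · simpa using h

theorem shapeOf_eq_iff {T : STab} {t : ℤ} {sh : List ℕ} (hsh : ∀ m ∈ sh, 0 < m) :
    shapeOf T = sh ↔ NoEmpty T ∧ ∀ r c, (entry? T r c).isSome = (stair t sh r c).isSome := by
  simp only [isSome_entry?, isSome_stair]
  constructor
  · rintro rfl
    refine ⟨fun row hr => List.length_pos_iff.1 (hsh _ (List.mem_map_of_mem hr)), fun r c => rfl⟩
  · rintro ⟨hN, h⟩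
    refine eq_of_getD_eq hN.pos hsh fun r => ?_
    have h1 := h r (r + (shapeOf T).getD r 0)
    have h2 := h r (r + sh.getD r 0)
    simp only [decide_eq_decide] at h1 h2
    omega

theorem entry?_Tlam (sh : List ℕ) : entry? (Tlam sh) = stair 0 sh := by
  have e : ∀ r, (Tlam sh).getD r [] =
      (List.range (sh.getD r 0)).map fun k : ℕ => ⟨2 * (r : ℤ) + (k : ℤ) + 1, false⟩ := fun r => by
    unfold Tlam
    rw [List.getD_eq_getElem?_getD, List.getElem?_map]
    rcases lt_or_ge r sh.length with h | h
    · simp [h, List.map_flatMap, ← List.map_eq_flatMap]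
    · simp [h]
  funext r c
  rcases lt_or_ge c r with h | h
  · rw [entry?_of_lt _ h, stair, if_neg (by omega)]
  · rw [entry?_of_le _ h, e, List.getElem?_map, stair]
    by_cases h' : c < r + sh.getD r 0
    · rw [if_pos ⟨h, h'⟩, List.getElem?_range (by omega), Option.map_some]
      congr 2; push_cast [h]; ring
    · rw [if_neg (by omega), List.getElem?_eq_none (by rw [List.length_range]; omega)]
      rfl

theorem shapeOf_Tlam (sh : List ℕ) : shapeOf (Tlam sh) = sh := by
  unfold shapeOf Tlam
  refine List.ext_getElem (by simp) fun r h1 h2 => ?_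
  simp [h2]

theorem noEmpty_Tlam {sh : List ℕ} (hsh : ∀ m ∈ sh, 0 < m) : NoEmpty (Tlam sh) :=
  ((shapeOf_eq_iff (t := 0) hsh).1 (shapeOf_Tlam sh)).1

theorem isSemistandard_iff (T : STab) : IsSemistandard T ↔ Semi (entry? T) := by
  constructor
  · rintro ⟨h1, h2, h3, h4, h5⟩
    refine ⟨fun r c x h => h1 x ?_, h2, h3, h4, h5⟩
    rcases lt_or_ge c r with hc | hc
    · rw [entry?_of_lt _ hc] at h; cases h
    · rw [entry?_of_le _ hc] at h
      have hr := List.mem_of_getElem? h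
      rw [List.getD_eq_getElem?_getD] at hr
      rcases e : T[r]? with _ | row
      · simp [e] at hr
      · rw [e] at hr
        exact List.mem_flatten.2 ⟨row, List.mem_of_getElem? e, hr⟩
  · intro h
    refine ⟨fun x hx => ?_, h.row, h.col, h.row_rep, h.col_rep⟩
    obtain ⟨row, hr, hx⟩ := List.mem_flatten.1 hx
    obtain ⟨r, hr', rfl⟩ := List.getElem_of_mem hr
    obtain ⟨k, hk, rfl⟩ := List.getElem_of_mem hx
    refine h.pos r (r + k) _ ?_
    rw [entry?_add, List.getD_eq_getElem?_getD, List.getElem?_eq_getElem hr']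
    exact List.getElem?_eq_getElem hk

theorem dominant_of_invRothe {sh : List ℕ} {z : Equiv.Perm ℤ}
    (h : invRothe z = Prod.swap '' SDset sh) : Dominant 0 sh z := by
  intro i j
  have hm : (i, j) ∈ invRothe z ↔ (j, i) ∈ SDset sh := by
    rw [h, Set.image_swap_eq_preimage_swap]; rfl
  change (i, j) ∈ invRothe z ↔ _
  rw [hm]
  constructor
  · rintro ⟨a, b, h1, h2, h3, h4, h5, h6⟩
    simp only at h5 h6
    exact ⟨a - 1, by push_cast [h1]; omega, by omega, by omega⟩
  · rintro ⟨r, h1, h2, h3⟩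
    refine ⟨r + 1, (i - j + 1).toNat, by omega, ?_, by omega, ?_, by push_cast; omega,
      by push_cast; omega⟩
    swap
    · rw [Nat.add_sub_cancel]; omega
    by_contra hc
    rw [List.getD_eq_default _ _ (by omega)] at h3
    simp at h3; omega

theorem IZ.isInv {z : Equiv.Perm ℤ} (hz : IZ z) : IsInv z := fun x => by
  rw [← Equiv.Perm.mul_apply, hz.2]; rfl

/-- The biword with letters `φ n` in degree `n + 1`. -/
def biword (φ : ℕ → PWord) (N : ℕ) : List (ℤ × Letter) :=
  ((List.range N).map fun n => (φ n).map fun x => ((n : ℤ) + 1, x)).flatten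

/-- The letters of degree `n + 1`. -/
def part (b : List (ℤ × Letter)) (n : ℕ) : PWord :=
  (b.filter fun p => decide (p.1 = (n : ℤ) + 1)).map Prod.snd

theorem biword_succ (φ : ℕ → PWord) (N : ℕ) :
    biword φ (N + 1) = biword φ N ++ (φ N).map fun x => ((N : ℤ) + 1, x) := by
  simp [biword, List.range_succ]

theorem map_snd_biword (φ : ℕ → PWord) (N : ℕ) :
    (biword φ N).map Prod.snd = ((List.range N).map φ).flatten := by
  induction N with
  | zero => rfl
  | succ N ih => rw [biword_succ, List.map_append, ih, List.range_succ]; simp [Function.comp_def]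

theorem part_append (b b' : List (ℤ × Letter)) (n : ℕ) : part (b ++ b') n = part b n ++ part b' n := by
  simp [part]

theorem part_map (a : PWord) (m n : ℕ) :
    part (a.map fun x => ((m : ℤ) + 1, x)) n = if m = n then a else [] := by
  unfold part
  split_ifs with h
  · subst h
    rw [List.filter_eq_self.2 (by simp)]
    simp [Function.comp_def]
  · rw [List.filter_eq_nil_iff.2 (by simp; omega)]
    rfl

theorem part_biword (φ : ℕ → PWord) (N n : ℕ) : part (biword φ N) n = if n < N then φ n else [] := by
  induction N with
  | zero => rfl
  | succ N ih =>
    rw [biword_succ, part_append, ih, part_map]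
    split_ifs <;> first | omega | simp_all

theorem mem_biword {φ : ℕ → PWord} {N : ℕ} {p : ℤ × Letter} (h : p ∈ biword φ N) :
    1 ≤ p.1 ∧ p.1 ≤ N := by
  simp only [biword, List.mem_flatten, List.mem_map, List.mem_range] at h
  obtain ⟨l, ⟨n, hn, rfl⟩, hp⟩ := h
  obtain ⟨x, -, rfl⟩ := List.mem_map.1 hp
  simp only; omega

/-- The strict order relation between letters of a biword. -/
def BiLt (p p' : ℤ × Letter) : Prop := p.1 < p'.1 ∨ (p.1 = p'.1 ∧ p.2.ceil < p'.2.ceil)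

instance : IsTrans (ℤ × Letter) BiLt := ⟨fun p q r h h' => by unfold BiLt at *; omega⟩

theorem BiOrd.pairwise {b : List (ℤ × Letter)} (h : BiOrd b) : b.Pairwise BiLt :=
  List.isChain_iff_pairwise.1 h.chain

theorem biOrd_biword {φ : ℕ → PWord} (h : ∀ n, (φ n).Pairwise fun x y => x.ceil < y.ceil) (N : ℕ) :
    BiOrd (biword φ N) := by
  refine ⟨fun p hp => (mem_biword hp).1, List.Pairwise.isChain ?_⟩
  induction N with
  | zero => simp [biword]
  | succ N ih =>
    rw [biword_succ, List.pairwise_append]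
    refine ⟨ih, List.pairwise_map.2 ((h N).imp fun hxy => Or.inr ⟨rfl, hxy⟩), fun p hp q hq => ?_⟩
    obtain ⟨x, -, rfl⟩ := List.mem_map.1 hq
    exact Or.inl (by have := (mem_biword hp).2; simp only; omega)

theorem BiOrd.pairwise_part {b : List (ℤ × Letter)} (h : BiOrd b) (n : ℕ) :
    (part b n).Pairwise fun x y => x.ceil < y.ceil := by
  refine List.pairwise_map.2 ((List.pairwise_filter.2 (h.pairwise.imp ?_)))
  intro p q hpq hp hq
  simp only [decide_eq_true_eq] at hp hq
  unfold BiLt at hpq; omega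

theorem mem_part {b : List (ℤ × Letter)} {n : ℕ} {x : Letter} :
    x ∈ part b n ↔ ((n : ℤ) + 1, x) ∈ b := by
  simp [part]

theorem BiOrd.ext {b b' : List (ℤ × Letter)} (h : BiOrd b) (h' : BiOrd b')
    (e : ∀ n, part b n = part b' n) : b = b' := by
  have nd : ∀ {b : List (ℤ × Letter)}, BiOrd b → b.Nodup := fun h =>
    h.pairwise.imp fun {p q} hpq => by rintro rfl; unfold BiLt at hpq; omega
  have mem : ∀ {b b' : List (ℤ × Letter)}, BiOrd b → (∀ n, part b n = part b' n) → ∀ p ∈ b, p ∈ b' := by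
    rintro b b' h e ⟨i, x⟩ hp
    have hi := h.pos _ hp
    obtain ⟨n, rfl⟩ : ∃ n : ℕ, i = (n : ℤ) + 1 := ⟨(i - 1).toNat, by simp only at hi; omega⟩
    rw [← mem_part, ← e, mem_part]; exact hp
  refine List.Perm.eq_of_pairwise (le := BiLt) (fun p q _ _ h1 h2 => ?_) h.pairwise h'.pairwise
    ((List.perm_ext_iff_of_nodup (nd h) (nd h')).2 fun p =>
      ⟨mem h e p, mem h' (fun n => (e n).symm) p⟩)
  unfold BiLt at *; omega

theorem BiOrd.biword_part {b : List (ℤ × Letter)} (h : BiOrd b) :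
    ∃ N : ℕ, (∀ n, N ≤ n → part b n = []) ∧ biword (part b) N = b := by
  obtain ⟨N, hN⟩ : ∃ N : ℕ, ∀ p ∈ b, p.1 ≤ N := by
    clear h
    induction b with
    | nil => exact ⟨0, by simp⟩
    | cons p b ih =>
      obtain ⟨N, hN⟩ := ih
      refine ⟨max N p.1.toNat, fun q hq => ?_⟩
      rcases List.mem_cons.1 hq with rfl | hq
      · omega
      · have := hN q hq; omega
  have h0 : ∀ n, N ≤ n → part b n = [] := fun n hn => by
    rw [List.eq_nil_iff_forall_not_mem]
    intro x hx
    have := hN _ (mem_part.1 hx)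
    simp only at this; omega
  refine ⟨N, h0, (biOrd_biword h.pairwise_part N).ext h fun n => ?_⟩
  rw [part_biword]
  split_ifs with hn
  · rfl
  · exact (h0 n (by omega)).symm

theorem AscW.chain_ceil {a : PWord} {y : ℤ → ℤ} (hy : IsInv y) (ha : AscW y a)
    (hc : a.IsChain (· ≤ ·)) : a.Pairwise fun x x' => x.ceil < x'.ceil := by
  have : IsTrans Letter fun x x' => x.ceil < x'.ceil := ⟨fun _ _ _ h h' => lt_trans h h'⟩
  refine List.isChain_iff_pairwise.1 ?_
  induction a generalizing y with
  | nil => simp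
  | cons x a ih =>
    rcases a with _ | ⟨x', a⟩
    · simp
    · rw [List.isChain_cons_cons] at hc ⊢
      refine ⟨?_, ih (hy.istep _) ha.2 hc.2⟩
      have h1 := (Letter.le_iff _ _).1 hc.1
      have h2 : x.ceil ≠ x'.ceil := fun e => not_ascW_self y hy x x' e ⟨ha.1, ha.2.1, trivial⟩
      omega

theorem AscW.of_mem {l : List PWord} {a : PWord} {y : ℤ → ℤ} (hy : IsInv y) (h : AscW y l.flatten)
    (ha : a ∈ l) : ∃ u, IsInv u ∧ AscW u a := by
  obtain ⟨s, t, rfl⟩ := List.append_of_mem ha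
  rw [List.flatten_append, List.flatten_cons, ascW_append, ascW_append] at h
  exact ⟨_, hy.irun _, h.2.1⟩

theorem length_part (b : List (ℤ × Letter)) (n : ℕ) :
    (part b n).length = b.countP fun p => decide (p.1 = (n : ℤ) + 1) := by
  rw [part, List.length_map, List.countP_eq_length_filter]

theorem exists_biOrd (a : PWord) : ∃ b, BiOrd b ∧ b.map Prod.snd = a := by
  suffices h : ∃ b : List (ℤ × Letter), BiOrd b ∧ b.map Prod.snd = a ∧ ∀ p ∈ b, p.1 ≤ a.length from
    h.imp fun b hb => ⟨hb.1, hb.2.1⟩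
  induction a using List.reverseRecOn with
  | nil => exact ⟨[], ⟨by simp, by simp⟩, rfl, by simp⟩
  | append_singleton a x ih =>
    obtain ⟨b, hb, rfl, hl⟩ := ih
    refine ⟨b ++ [((b.length : ℤ) + 1, x)], ⟨?_, List.isChain_append.2 ⟨hb.chain, by simp, ?_⟩⟩,
      by simp, ?_⟩
    · intro p hp
      rcases List.mem_append.1 hp with hp | hp
      · exact hb.pos p hp
      · rw [List.mem_singleton.1 hp]; simp only; omega
    · intro p hp q hq
      have := hl p (List.mem_of_getLast? hp)
      simp only [List.head?_cons, Option.mem_some_iff] at hq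
      subst hq
      rw [List.length_map] at this
      exact Or.inl (by simp only; omega)
    · intro p hp
      rcases List.mem_append.1 hp with hp | hp
      · have := hl p hp; simp at this ⊢; omega
      · rw [List.mem_singleton.1 hp]; simp

theorem ncard_eq_of_rel {α β : Type*} {s : Set α} {t : Set β} (R : α → β → Prop)
    (h1 : ∀ a ∈ s, ∃ b ∈ t, R a b) (h2 : ∀ b ∈ t, ∃ a ∈ s, R a b)
    (h3 : ∀ a b b', R a b → R a b' → b = b') (h4 : ∀ a a' b, R a b → R a' b → a = a') :
    s.ncard = t.ncard := by
  choose f hf hR using h1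
  refine Set.ncard_congr f hf (fun a a' ha ha' e => h4 _ _ _ (hR a ha) (e ▸ hR a' ha')) fun b hb => ?_
  obtain ⟨a, ha, hab⟩ := h2 b hb
  exact ⟨a, ha, h3 _ _ _ (hR a ha) hab⟩

section Dominant

variable {sh : List ℕ} {z : Equiv.Perm ℤ}

theorem good_stair (hsh : IsStrictPartition sh) (hz : IZ z) (hd : Dominant 0 sh z) :
    Good z (stair 0 sh) := by
  obtain ⟨a, ha⟩ := exists_builds hz.isInv (inversions_finite hz.isInv hz.1)
  obtain ⟨b, hb, rfl⟩ := exists_biOrd a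
  obtain ⟨G, S, h⟩ := Rec.of_builds b ha.1 hb
  rw [ha.2] at h
  rw [← h.good.1.eq_stair hsh hd]
  exact h.good.1

theorem exists_rec (hsh : IsStrictPartition sh) (hd : Dominant 0 sh z) {b : List (ℤ × Letter)}
    (hb : BiOrd b) (ha : Builds (b.map Prod.snd) z) :
    ∃ T, NoEmpty T ∧ shapeOf T = sh ∧ Rec z b (stair 0 sh) (entry? T) ∧
      T.flatten.length = b.length ∧ ∀ i : ℤ, T.flatten.countP (fun x => decide (x.ceil = i)) =
        b.countP (fun p => decide (p.1 = i)) := by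
  obtain ⟨G, S, h⟩ := Rec.of_builds b ha.1 hb
  rw [ha.2] at h
  obtain rfl := h.good.1.eq_stair hsh hd
  obtain ⟨T, hN, rfl, hl, hc⟩ := h.content
  exact ⟨T, hN, (shapeOf_eq_iff hsh.2).2 ⟨hN, h.good.2⟩, h, hl, hc⟩

theorem mem_RinvPlus_iff (hsh : IsStrictPartition sh) (hd : Dominant 0 sh z) {a : PWord} :
    a ∈ RinvPlus z ↔ Builds a z := by
  refine ⟨builds_of_mem, mem_of_builds fun a b ha hb => ?_⟩
  have key : ∀ a, Builds a z → a.length = sh.sum := fun a ha => by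
    obtain ⟨b, hb, rfl⟩ := exists_biOrd a
    obtain ⟨T, -, rfl, -, hl, -⟩ := exists_rec hsh hd hb ha
    rw [List.length_map, ← hl, List.length_flatten]
    rfl
  rw [key a ha, key b hb]

theorem peg_eq (hsh : IsStrictPartition sh) (hd : Dominant 0 sh z) {a : PWord}
    (ha : a ∈ RinvPlus z) : PEG a = Tlam sh := by
  obtain ⟨b, hb, rfl⟩ := exists_biOrd a
  obtain ⟨T, -, -, h, -⟩ := exists_rec hsh hd hb (builds_of_mem ha)
  exact entry?_inj h.peg.1 (noEmpty_Tlam hsh.2) (h.peg.2.trans (entry?_Tlam sh).symm)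

theorem ncard_biwords (hsh : IsStrictPartition sh) (hz : IZ z) (hd : Dominant 0 sh z) (d : ℤ → ℕ) :
    {b : List (ℤ × Letter) | BiOrd b ∧ Builds (b.map Prod.snd) z ∧
      ∀ i : ℤ, d i = b.countP (fun p => decide (p.1 = i))}.ncard =
    {T : STab | shapeOf T = sh ∧ IsSemistandard T ∧
      ∀ i : ℤ, d i = T.flatten.countP (fun x => decide (x.ceil = i))}.ncard := by
  refine ncard_eq_of_rel (fun b T => NoEmpty T ∧ Rec z b (stair 0 sh) (entry? T)) ?_ ?_ ?_ ?_
  · rintro b ⟨hb, ha, hw⟩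
    obtain ⟨T, hN, hT, h, -, hc⟩ := exists_rec hsh hd hb ha
    exact ⟨T, ⟨hT, (isSemistandard_iff T).2 h.inv.1, fun i => (hw i).trans (hc i).symm⟩, hN, h⟩
  · rintro T ⟨hT, hS, hw⟩
    obtain ⟨hN, hs⟩ := (shapeOf_eq_iff (t := 0) hsh.2).1 hT
    obtain ⟨b, h⟩ := Rec.exists_of_semi (good_stair hsh hz hd) ((isSemistandard_iff T).1 hS) hs
    obtain ⟨T', hN', hT', -, hc⟩ := h.content
    obtain rfl := entry?_inj hN' hN hT'
    exact ⟨b, ⟨h.builds.2, h.builds.1, fun i => (hw i).trans (hc i)⟩, hN, h⟩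
  · rintro b T T' ⟨hN, h⟩ ⟨hN', h'⟩
    exact entry?_inj hN hN' (h.fwd_unique h').2.2
  · rintro b b' T ⟨-, h⟩ ⟨-, h'⟩
    exact h.bwd_unique h'

theorem ncard_sequences (hsh : IsStrictPartition sh) (hd : Dominant 0 sh z) (d : ℤ → ℕ) :
    {φ : ℕ → PWord | φ ∈ IncrSeq z ∧ (∀ i : ℕ, d ((i : ℤ) + 1) = (φ i).length) ∧
      (∀ j : ℤ, j ≤ 0 → d j = 0)}.ncard =
    {b : List (ℤ × Letter) | BiOrd b ∧ Builds (b.map Prod.snd) z ∧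
      ∀ i : ℤ, d i = b.countP (fun p => decide (p.1 = i))}.ncard := by
  refine ncard_eq_of_rel (fun φ b => BiOrd b ∧ ∀ n, part b n = φ n) ?_ ?_ ?_ ?_
  · rintro φ ⟨⟨hc, N, hN, ha⟩, hw, hw0⟩
    have ha := builds_of_mem ha
    have hp : ∀ n, (φ n).Pairwise fun x y => x.ceil < y.ceil := fun n => by
      rcases lt_or_ge n N with h | h
      · obtain ⟨u, hu, h⟩ := AscW.of_mem isInv_id ha.1
          (List.mem_map_of_mem (List.mem_range.2 h) : φ n ∈ _)
        exact h.chain_ceil hu (hc n)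
      · simp [hN n h]
    have hb := biOrd_biword hp N
    have he : ∀ n, part (biword φ N) n = φ n := fun n => by
      rw [part_biword]
      split_ifs with h
      · rfl
      · exact (hN n (by omega)).symm
    refine ⟨biword φ N, ⟨hb, by rw [map_snd_biword]; exact ha, fun i => ?_⟩, hb, he⟩
    rcases le_or_gt i 0 with hi | hi
    · rw [hw0 i hi, eq_comm, List.countP_eq_zero]
      intro p hp
      have := hb.pos p hp
      simp only [decide_eq_true_eq]; omega
    · obtain ⟨n, rfl⟩ : ∃ n : ℕ, i = (n : ℤ) + 1 := ⟨(i - 1).toNat, by omega⟩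
      rw [hw, ← he, length_part]
  · rintro b ⟨hb, ha, hw⟩
    obtain ⟨N, hN, he⟩ := hb.biword_part
    refine ⟨part b, ⟨⟨fun n => ?_, N, hN, ?_⟩, fun n => ?_, fun j hj => ?_⟩, hb, fun n => rfl⟩
    · exact ((hb.pairwise_part n).imp fun h => (Letter.le_iff _ _).2 (Or.inl h)).isChain
    · rw [mem_RinvPlus_iff hsh hd, ← map_snd_biword, he]
      exact ha
    · rw [hw, length_part]
    · rw [hw, List.countP_eq_zero]
      intro p hp
      have := hb.pos p hp
      simp only [decide_eq_true_eq]; omega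
  · rintro φ b b' ⟨hb, h⟩ ⟨hb', h'⟩
    exact hb.ext hb' fun n => (h n).trans (h' n).symm
  · rintro φ φ' b ⟨-, h⟩ ⟨-, h'⟩
    exact funext fun n => (h n).symm.trans (h' n)

theorem Qz_eq (hsh : IsStrictPartition sh) (hz : IZ z) (hd : Dominant 0 sh z) :
    Qz z = SchurQ sh := by
  funext d
  unfold Qz SchurQ
  rw [← ncard_biwords hsh hz hd d, ncard_sequences hsh hd d]

end Dominant

/-- Lemma 3.25: if `λ` is a strict partition and `z_λ ∈ I_ℤ` is the
dominant involution whose involution Rothe diagram is the transpose of `SD_λ`, then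
`Q_{z_λ} = Q_λ` and `P_EGᴼ(a) = T_λ` for every `a ∈ R_inv⁺(z_λ)`. -/
theorem stmt10 (sh : List ℕ) (hsh : IsStrictPartition sh) (z : Equiv.Perm ℤ) (hz : IZ z)
    (hD : invRothe z = Prod.swap '' SDset sh) :
    Qz z = SchurQ sh ∧ ∀ a ∈ RinvPlus z, PEG a = Tlam sh :=
  ⟨Qz_eq hsh hz (dominant_of_invRothe hD), fun _ => peg_eq hsh (dominant_of_invRothe hD)⟩
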